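/- arXiv:1606.00409 — 4 statements merged into one kernel-verified Lean document; each statement's English description precedes it below -/
import Mathlib

section
/- Let H = ℓ²(ℕ, ℂ) and let m ≥ 1 be a natural number. Suppose u and v are diagonalizable unitary operators on H (each admits an orthonormal basis of H consisting of eigenvectors) such that ℓ(u) ≤ m · ℓ_ess(v). Then there exist a complex number λ with |λ| = 1, unitary operators g₁, …, g_{128m} on H, and signs ε₁, …, ε_{128m} ∈ {1, −1} such that u = λ · ∏_{i=1}^{128m} gᵢ v^{εᵢ} gᵢ⁻¹. -/
/- Statement 0: For diagonalizable unitaries `u, v` on `H = ℓ²(ℕ, ℂ)` with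
`ℓ(u) ≤ m · ℓ_ess(v)`, `u` is a unimodular scalar multiple of a product of `128·m`
conjugates of `v` or `v⁻¹ = star v` by unitaries. -/

noncomputable section

/-- `H = ℓ²(ℕ, ℂ)`. -/
abbrev H : Type := lp (fun _ : ℕ => ℂ) 2

/-- `ℓ(x) = inf_{|λ| = 1} ‖1 - λ x‖` (operator norm). -/
noncomputable def ell (x : H →L[ℂ] H) : ℝ :=
  ⨅ lam : {l : ℂ // ‖l‖ = 1}, ‖1 - (lam : ℂ) • x‖

/-- `ℓ_ess(x) = inf_{|λ| = 1} ‖1 - λ x‖_ess`, where the essential norm is the distance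
to the ideal of compact operators. -/
noncomputable def ellEss (x : H →L[ℂ] H) : ℝ :=
  ⨅ lam : {l : ℂ // ‖l‖ = 1},
    Metric.infDist (1 - (lam : ℂ) • x) {k : H →L[ℂ] H | IsCompactOperator (⇑k)}

/-- A unitary is diagonalizable if there is an orthonormal (Hilbert) basis of eigenvectors. -/
def Diagonalizable (x : H →L[ℂ] H) : Prop :=
  ∃ (b : HilbertBasis ℕ ℂ H) (μ : ℕ → ℂ), ∀ n, x (b n) = μ n • b n

section HilbertBases

variable {ι κ E : Type*} [NormedAddCommGroup E] [InnerProductSpace ℂ E]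

/-- An orthonormal family whose span contains a Hilbert basis is a Hilbert basis. -/
theorem HilbertBasis.exists_of_mem_span [CompleteSpace E] (b : HilbertBasis ι ℂ E) {w : κ → E}
    (hw : Orthonormal ℂ w) (hb : ∀ i, b i ∈ Submodule.span ℂ (Set.range w)) :
    ∃ b' : HilbertBasis κ ℂ E, ⇑b' = w := by
  have hle : Submodule.span ℂ (Set.range b) ≤ Submodule.span ℂ (Set.range w) :=
    Submodule.span_le.2 (by rintro _ ⟨i, rfl⟩; exact hb i)
  exact ⟨HilbertBasis.mk hw (b.dense_span.ge.trans (Submodule.topologicalClosure_mono hle)),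
    HilbertBasis.coe_mk _ _⟩

theorem HilbertBasis.exists_reindex [CompleteSpace E] (b : HilbertBasis ι ℂ E) (e : κ ≃ ι) :
    ∃ b' : HilbertBasis κ ℂ E, ⇑b' = b ∘ e :=
  b.exists_of_mem_span (b.orthonormal.comp e e.injective) fun i =>
    Submodule.subset_span ⟨e.symm i, by simp⟩

theorem HilbertBasis.exists_map_eq (b b' : HilbertBasis ι ℂ E) :
    ∃ T : E ≃ₗᵢ[ℂ] E, ∀ i, T (b i) = b' i := by
  classical
  exact ⟨b.repr.trans b'.repr.symm, fun i => by
    rw [LinearIsometryEquiv.trans_apply, b.repr_self, b'.repr_symm_single]⟩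

theorem HilbertBasis.clm_ext {F : Type*} [NormedAddCommGroup F] [NormedSpace ℂ F]
    (b : HilbertBasis ι ℂ E) {f g : E →L[ℂ] F}
    (h : ∀ i, f (b i) = g (b i)) : f = g := by
  refine ContinuousLinearMap.ext_on (s := Set.range b) ?_ (by rintro _ ⟨i, rfl⟩; exact h i)
  rw [dense_iff_closure_eq, ← Submodule.topologicalClosure_coe, b.dense_span]
  rfl

theorem HilbertBasis.isometryEquiv_ext (b : HilbertBasis ι ℂ E) {f g : E ≃ₗᵢ[ℂ] E}
    (h : ∀ i, f (b i) = g (b i)) : f = g := by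
  have := b.clm_ext (f := (f : E →L[ℂ] E)) (g := (g : E →L[ℂ] E)) h
  ext x
  exact DFunLike.congr_fun this x

variable [CompleteSpace E]

theorem HilbertBasis.exists_diag (b : HilbertBasis ι ℂ E) (d : ι → Circle) :
    ∃ T : E ≃ₗᵢ[ℂ] E, ∀ i, T (b i) = (d i : ℂ) • b i := by
  classical
  have ho : Orthonormal ℂ fun i => (d i : ℂ) • b i := by
    have := b.orthonormal
    rw [orthonormal_iff_ite] at this ⊢
    intro i j
    rw [inner_smul_left, inner_smul_right, this]
    split_ifs with h
    · subst h
      rw [mul_one, ← Circle.coe_inv_eq_conj, Circle.coe_inv, inv_mul_cancel₀ (Circle.coe_ne_zero _)]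
    · simp
  obtain ⟨b', hb'⟩ := b.exists_of_mem_span ho fun i => by
    have : b i = (d i : ℂ)⁻¹ • (d i : ℂ) • b i := by
      rw [smul_smul, inv_mul_cancel₀ (Circle.coe_ne_zero _), one_smul]
    rw [this]
    exact Submodule.smul_mem _ _ (Submodule.subset_span ⟨i, rfl⟩)
  obtain ⟨T, hT⟩ := b.exists_map_eq b'
  exact ⟨T, fun i => by rw [hT, hb']⟩

/-- The unitary that is diagonal with eigenvalues `d` in the Hilbert basis `b`. -/
def HilbertBasis.diag (b : HilbertBasis ι ℂ E) : (ι → Circle) →* (E ≃ₗᵢ[ℂ] E) :=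
  MonoidHom.mk' (fun d => (b.exists_diag d).choose) fun d d' => b.isometryEquiv_ext fun i => by
    rw [LinearIsometryEquiv.coe_mul, Function.comp_apply, (b.exists_diag _).choose_spec,
      (b.exists_diag _).choose_spec, map_smul, (b.exists_diag _).choose_spec, smul_smul,
      Pi.mul_apply, Circle.coe_mul, mul_comm]

theorem HilbertBasis.diag_apply (b : HilbertBasis ι ℂ E) (d : ι → Circle) (i : ι) :
    b.diag d (b i) = (d i : ℂ) • b i :=
  (b.exists_diag d).choose_spec i

theorem HilbertBasis.eq_diag (b : HilbertBasis ι ℂ E) {d : ι → Circle} {T : E ≃ₗᵢ[ℂ] E}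
    (h : ∀ i, T (b i) = (d i : ℂ) • b i) : T = b.diag d :=
  b.isometryEquiv_ext fun i => by rw [h, diag_apply]

theorem HilbertBasis.exists_conj_diag (b b' : HilbertBasis ι ℂ E) :
    ∃ T : E ≃ₗᵢ[ℂ] E, ∀ d, b'.diag d = T * b.diag d * T⁻¹ := by
  obtain ⟨T, hT⟩ := b.exists_map_eq b'
  refine ⟨T, fun d => eq_mul_inv_of_mul_eq (b.isometryEquiv_ext fun i => ?_)⟩
  simp only [LinearIsometryEquiv.coe_mul, Function.comp_apply, hT, diag_apply, map_smul]

theorem HilbertBasis.exists_block (b : HilbertBasis (κ × Fin 2) ℂ E)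
    (M : κ → Matrix.unitaryGroup (Fin 2) ℂ) :
    ∃ T : E ≃ₗᵢ[ℂ] E, ∀ k i, T (b (k, i)) = ∑ j, (M k : Matrix (Fin 2) (Fin 2) ℂ) j i • b (k, j) := by
  classical
  have ho : Orthonormal ℂ fun p : κ × Fin 2 =>
      ∑ j, (M p.1 : Matrix (Fin 2) (Fin 2) ℂ) j p.2 • b (p.1, j) := by
    have hb := b.orthonormal
    rw [orthonormal_iff_ite] at hb ⊢
    rintro ⟨k, i⟩ ⟨l, j⟩
    simp only [sum_inner, inner_sum, inner_smul_left, inner_smul_right, hb, Prod.mk.injEq]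
    by_cases hkl : k = l
    · subst hkl
      have hM := congr_fun (congr_fun (Matrix.mem_unitaryGroup_iff'.1 (M k).2) i) j
      rw [Matrix.mul_apply] at hM
      simp only [Matrix.star_apply, Matrix.one_apply, RCLike.star_def] at hM
      simpa [mul_comm] using hM
    · simp [hkl]
  obtain ⟨b', hb'⟩ := b.exists_of_mem_span ho fun p => by
    obtain ⟨k, i⟩ := p
    have hM := Matrix.mem_unitaryGroup_iff.1 (M k).2
    have : b (k, i) = ∑ l, star ((M k : Matrix (Fin 2) (Fin 2) ℂ) i l) •
        ∑ j, (M k : Matrix (Fin 2) (Fin 2) ℂ) j l • b (k, j) := by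
      simp_rw [Finset.smul_sum, smul_smul]
      rw [Finset.sum_comm]
      simp_rw [← Finset.sum_smul]
      have h2 : ∀ j, ∑ l, star ((M k : Matrix (Fin 2) (Fin 2) ℂ) i l) * (M k : Matrix (Fin 2) (Fin 2) ℂ) j l
          = if j = i then 1 else 0 := fun j => by
        have := congr_fun (congr_fun hM j) i
        rw [Matrix.mul_apply, Matrix.one_apply] at this
        rw [← this]
        exact Finset.sum_congr rfl fun l _ => mul_comm _ _
      simp_rw [h2]
      simp
    rw [this]
    exact Submodule.sum_mem _ fun l _ =>
      Submodule.smul_mem _ _ (Submodule.subset_span ⟨(k, l), rfl⟩)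
  obtain ⟨T, hT⟩ := b.exists_map_eq b'
  exact ⟨T, fun k i => by rw [hT, hb']⟩

/-- The unitary that acts by the `2 × 2` unitary matrix `M k` on the span of the vectors
`b (k, 0)` and `b (k, 1)`. -/
def HilbertBasis.block (b : HilbertBasis (κ × Fin 2) ℂ E) :
    (κ → Matrix.unitaryGroup (Fin 2) ℂ) →* (E ≃ₗᵢ[ℂ] E) :=
  MonoidHom.mk' (fun M => (b.exists_block M).choose) fun M N => b.isometryEquiv_ext fun p => by
    obtain ⟨k, i⟩ := p
    rw [LinearIsometryEquiv.coe_mul, Function.comp_apply, (b.exists_block _).choose_spec,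
      (b.exists_block _).choose_spec, map_sum]
    simp_rw [map_smul, (b.exists_block _).choose_spec, Finset.smul_sum, smul_smul]
    rw [Finset.sum_comm]
    simp_rw [← Finset.sum_smul]
    refine Finset.sum_congr rfl fun j _ => ?_
    rw [Pi.mul_apply, Matrix.UnitaryGroup.mul_val, Matrix.mul_apply]
    congr 1
    exact Finset.sum_congr rfl fun l _ => mul_comm _ _

theorem HilbertBasis.block_apply (b : HilbertBasis (κ × Fin 2) ℂ E)
    (M : κ → Matrix.unitaryGroup (Fin 2) ℂ) (k : κ) (i : Fin 2) :
    b.block M (b (k, i)) = ∑ j, (M k : Matrix (Fin 2) (Fin 2) ℂ) j i • b (k, j) :=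
  (b.exists_block M).choose_spec k i

/-- The diagonal unitary matrix with diagonal entries `x` and `y`. -/
def diagUnitary (x y : Circle) : Matrix.unitaryGroup (Fin 2) ℂ :=
  ⟨Matrix.diagonal ![(x : ℂ), (y : ℂ)], by
    rw [Matrix.mem_unitaryGroup_iff', Matrix.star_eq_conjTranspose, Matrix.diagonal_conjTranspose,
      Matrix.diagonal_mul_diagonal, ← Matrix.diagonal_one]
    congr 1
    ext i
    fin_cases i <;> simp [← Complex.normSq_eq_conj_mul_self]⟩

theorem HilbertBasis.diag_eq_block (b : HilbertBasis (κ × Fin 2) ℂ E) (d : κ × Fin 2 → Circle) :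
    b.diag d = b.block fun k => diagUnitary (d (k, 0)) (d (k, 1)) := by
  refine b.isometryEquiv_ext fun p => ?_
  obtain ⟨k, i⟩ := p
  rw [diag_apply, block_apply]
  fin_cases i <;> simp [diagUnitary]

end HilbertBases

section TwoByTwo

open Matrix

theorem exists_unitary_conj_eq_diagUnitary (M : unitaryGroup (Fin 2) ℂ) (z : Circle)
    (hdet : (M : Matrix (Fin 2) (Fin 2) ℂ).det = 1)
    (htr : (M : Matrix (Fin 2) (Fin 2) ℂ).trace = z + (z : ℂ)⁻¹) :
    ∃ h : unitaryGroup (Fin 2) ℂ, diagUnitary z z⁻¹ = h * M * h⁻¹ := by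
  have hz : (z : ℂ) ≠ 0 := Circle.coe_ne_zero z
  set A : Matrix (Fin 2) (Fin 2) ℂ := M.1 with hA
  have hker : (A - Matrix.scalar (Fin 2) (z : ℂ)).det = 0 := by
    rw [det_fin_two] at hdet ⊢
    rw [trace_fin_two] at htr
    simp only [Matrix.sub_apply, scalar_apply, diagonal_apply_eq, Fin.isValue, ne_eq, zero_ne_one,
      not_false_eq_true, diagonal_apply_ne, one_ne_zero, sub_zero]
    have : (z : ℂ) * (z : ℂ)⁻¹ = 1 := mul_inv_cancel₀ hz
    linear_combination hdet - (z : ℂ) * htr - this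
  obtain ⟨x, hx0, hx⟩ := exists_mulVec_eq_zero_iff.2 hker
  have hn : 0 < Complex.normSq (x 0) + Complex.normSq (x 1) := by
    by_contra hcon
    apply hx0
    have h0 := Complex.normSq_nonneg (x 0)
    have h1 := Complex.normSq_nonneg (x 1)
    ext i
    fin_cases i
    · exact Complex.normSq_eq_zero.1 (show Complex.normSq (x 0) = 0 by linarith)
    · exact Complex.normSq_eq_zero.1 (show Complex.normSq (x 1) = 0 by linarith)
  set r : ℝ := Real.sqrt (Complex.normSq (x 0) + Complex.normSq (x 1))
  have hr : 0 < r := Real.sqrt_pos.2 hn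
  have hrC : (r : ℂ) ≠ 0 := by exact_mod_cast hr.ne'
  have hr2 : (r : ℂ) * r = star (x 0) * x 0 + star (x 1) * x 1 := by
    simp only [RCLike.star_def, ← Complex.normSq_eq_conj_mul_self]
    exact_mod_cast Real.mul_self_sqrt hn.le
  set y0 : ℂ := x 0 / r
  set y1 : ℂ := x 1 / r
  have hy : star y0 * y0 + star y1 * y1 = 1 := by
    simp only [y0, y1, RCLike.star_def, map_div₀, Complex.conj_ofReal] at hr2 ⊢
    field_simp
    linear_combination -hr2
  have e0 : A 0 0 * y0 + A 0 1 * y1 = z * y0 := by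
    have := congr_fun hx 0
    simp [mulVec, dotProduct] at this
    simp only [y0, y1]; field_simp; linear_combination this
  have e1 : A 1 0 * y0 + A 1 1 * y1 = z * y1 := by
    have := congr_fun hx 1
    simp [mulVec, dotProduct] at this
    simp only [y0, y1]; field_simp; linear_combination this
  clear_value y0 y1
  let P : Matrix (Fin 2) (Fin 2) ℂ := !![y0, -star y1; y1, star y0]
  have hP : P ∈ unitaryGroup (Fin 2) ℂ := by
    rw [mem_unitaryGroup_iff']
    ext i j
    fin_cases i <;> fin_cases j <;> simp [P, mul_apply] <;> simp at hy <;>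
      first | ring1 | linear_combination hy
  let Q : unitaryGroup (Fin 2) ℂ := ⟨P, hP⟩
  let N := Q⁻¹ * M * Q
  have hNdet : (N : Matrix (Fin 2) (Fin 2) ℂ).det = 1 := by
    have : (P.det) * (star P).det = 1 := by
      rw [← det_mul, mem_unitaryGroup_iff.1 hP, det_one]
    simp only [N, Q, UnitaryGroup.mul_val, UnitaryGroup.inv_val, det_mul]
    rw [← hA, hdet]; linear_combination this
  have hN00 : (N : Matrix (Fin 2) (Fin 2) ℂ) 0 0 = z := by
    simp [N, Q, P, UnitaryGroup.inv_val, mul_apply, ← hA]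
    simp at hy
    linear_combination starRingEnd ℂ y0 * e0 + starRingEnd ℂ y1 * e1 + z * hy
  have hN10 : (N : Matrix (Fin 2) (Fin 2) ℂ) 1 0 = 0 := by
    simp [N, Q, P, UnitaryGroup.inv_val, mul_apply, ← hA]
    linear_combination -y1 * e0 + y0 * e1
  have hzz : (z : ℂ) * star (z : ℂ) = 1 := by
    rw [RCLike.star_def, Complex.mul_conj]; simp
  have hN01 : (N : Matrix (Fin 2) (Fin 2) ℂ) 0 1 = 0 := by
    have := congr_fun (congr_fun (mem_unitaryGroup_iff.1 N.2) 0) 0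
    simp only [mul_apply, Fin.sum_univ_two, star_apply, one_apply_eq, hN00, hzz] at this
    simpa using this
  have hN11 : (N : Matrix (Fin 2) (Fin 2) ℂ) 1 1 = (z : ℂ)⁻¹ := by
    rw [det_fin_two, hN00, hN01, zero_mul, sub_zero] at hNdet
    exact eq_inv_of_mul_eq_one_right hNdet
  refine ⟨Q⁻¹, ?_⟩
  rw [inv_inv]
  change _ = N
  ext i j
  fin_cases i <;> fin_cases j <;> simp [diagUnitary, hN00, hN01, hN10, hN11]

/-- The conjugate of `diagUnitary a b` by a suitable rotation times its inverse can have any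
eigenvalues `z, z⁻¹` with `|z - 1| ≤ |a - b|`. -/
theorem exists_diagUnitary_eq_conj_mul_conj_inv (a b z : Circle)
    (h : ‖(z : ℂ) - 1‖ ≤ ‖(a : ℂ) - b‖) :
    ∃ g h : unitaryGroup (Fin 2) ℂ, diagUnitary z z⁻¹ =
      (g * diagUnitary a b * g⁻¹) * (h * (diagUnitary a b)⁻¹ * h⁻¹) := by
  set s : ℝ := ‖(z : ℂ) - 1‖ / ‖(a : ℂ) - b‖
  have hs0 : 0 ≤ s := by positivity
  have hs1 : s ≤ 1 := div_le_one_of_le₀ h (norm_nonneg _)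
  have hs : s ^ 2 * ‖(a : ℂ) - b‖ ^ 2 = ‖(z : ℂ) - 1‖ ^ 2 := by
    rw [← mul_pow]
    congr 1
    rcases eq_or_ne (‖(a : ℂ) - b‖) 0 with h0 | h0
    · rw [h0] at h ⊢
      rw [mul_zero]
      exact le_antisymm (norm_nonneg _) h
    · exact div_mul_cancel₀ _ h0
  set c : ℝ := Real.sqrt (1 - s ^ 2)
  have hc : c ^ 2 + s ^ 2 = 1 := by
    rw [Real.sq_sqrt (by nlinarith)]; ring
  have hcC : (c : ℂ) ^ 2 + (s : ℂ) ^ 2 = 1 := by exact_mod_cast hc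
  let R : Matrix (Fin 2) (Fin 2) ℂ := !![(c : ℂ), -(s : ℂ); (s : ℂ), (c : ℂ)]
  have hR : R ∈ unitaryGroup (Fin 2) ℂ := by
    rw [mem_unitaryGroup_iff']
    ext i j
    fin_cases i <;> fin_cases j <;> simp [R, mul_apply] <;>
      first | ring1 | linear_combination hcC
  let Q : unitaryGroup (Fin 2) ℂ := ⟨R, hR⟩
  let D := diagUnitary a b
  have hD : (D : Matrix (Fin 2) (Fin 2) ℂ) = diagonal ![(a : ℂ), (b : ℂ)] := rfl
  let M := D * (Q * D⁻¹ * Q⁻¹)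
  have hdet : (M : Matrix (Fin 2) (Fin 2) ℂ).det = 1 := by
    have h1 : ∀ U : unitaryGroup (Fin 2) ℂ,
        (U : Matrix (Fin 2) (Fin 2) ℂ).det * (star (U : Matrix (Fin 2) (Fin 2) ℂ)).det = 1 :=
      fun U => by rw [← det_mul, mem_unitaryGroup_iff.1 U.2, det_one]
    simp only [M, UnitaryGroup.mul_val, UnitaryGroup.inv_val, det_mul]
    linear_combination (Q : Matrix (Fin 2) (Fin 2) ℂ).det *
      (star (Q : Matrix (Fin 2) (Fin 2) ℂ)).det * h1 D + h1 Q
  have hnorm : ∀ w : Circle, (w : ℂ) * star (w : ℂ) = 1 := fun w => by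
    rw [RCLike.star_def, Complex.mul_conj]; simp
  have hsub : ∀ w w' : Circle, ((‖(w : ℂ) - w'‖ ^ 2 : ℝ) : ℂ) =
      2 - w * star (w' : ℂ) - star (w : ℂ) * w' := fun w w' => by
    push_cast
    rw [← Complex.mul_conj', map_sub, ← RCLike.star_def]
    linear_combination hnorm w + hnorm w'
  have hsC : (s : ℂ) ^ 2 * (2 - a * star (b : ℂ) - star (a : ℂ) * b) = 2 - z - star (z : ℂ) := by
    have h1 := hsub z 1
    rw [Circle.coe_one, star_one, ← hs] at h1
    push_cast at h1
    have h2 := hsub a b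
    push_cast at h2
    rw [h2] at h1
    linear_combination h1
  have htr : (M : Matrix (Fin 2) (Fin 2) ℂ).trace = z + (z : ℂ)⁻¹ := by
    rw [← Circle.coe_inv, Circle.coe_inv_eq_conj, ← RCLike.star_def]
    have : (M : Matrix (Fin 2) (Fin 2) ℂ).trace =
        (a : ℂ) * (c ^ 2 * star (a : ℂ) + s ^ 2 * star (b : ℂ)) +
        (b : ℂ) * (s ^ 2 * star (a : ℂ) + c ^ 2 * star (b : ℂ)) := by
      simp only [M, UnitaryGroup.mul_val, UnitaryGroup.inv_val, hD, trace_fin_two, mul_apply,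
        Fin.sum_univ_two, star_apply]
      simp [Q, R]
      ring
    rw [this]
    linear_combination (c : ℂ) ^ 2 * hnorm a + (c : ℂ) ^ 2 * hnorm b + 2 * hcC - hsC
  obtain ⟨g, hg⟩ := exists_unitary_conj_eq_diagUnitary M z hdet htr
  refine ⟨g, g * Q, ?_⟩
  rw [hg]
  simp only [M, D]
  group

end TwoByTwo

section ConjProd

variable {G : Type*} [Group G]

/-- `x` is a product of `n` conjugates of `v` or `v⁻¹`. -/
def IsConjProd (v : G) (n : ℕ) (x : G) : Prop :=
  ∃ l : List (G × Bool), l.length = n ∧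
    x = (l.map fun p => p.1 * (if p.2 then v else v⁻¹) * p.1⁻¹).prod

theorem IsConjProd.mul {v x y : G} {n k : ℕ} (hx : IsConjProd v n x) (hy : IsConjProd v k y) :
    IsConjProd v (n + k) (x * y) := by
  obtain ⟨l, rfl, rfl⟩ := hx
  obtain ⟨l', rfl, rfl⟩ := hy
  exact ⟨l ++ l', by simp, by simp⟩

theorem IsConjProd.pow {v x : G} {n : ℕ} (hx : IsConjProd v n x) (k : ℕ) :
    IsConjProd v (n * k) (x ^ k) := by
  induction k with
  | zero => exact ⟨[], by simp, by simp⟩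
  | succ k ih => simpa only [Nat.mul_succ, pow_succ] using ih.mul hx

theorem isConjProd_conj_mul_conj_inv (v g h : G) :
    IsConjProd v 2 ((g * v * g⁻¹) * (h * v⁻¹ * h⁻¹)) :=
  ⟨[(g, true), (h, false)], rfl, by simp⟩

end ConjProd

section Reindexing

/-- An injection with infinite complement extends to a bijection from a disjoint union. -/
theorem exists_sum_equiv_extending {κ τ ι : Type*} [Countable ι] [Countable τ] [Infinite τ]
    {x : κ → ι} (hx : Function.Injective x) (hc : (Set.range x)ᶜ.Infinite) :
    ∃ e : κ ⊕ τ ≃ ι, ∀ k, e (Sum.inl k) = x k := by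
  classical
  have := hc.to_subtype
  obtain ⟨r⟩ : Nonempty (τ ≃ ((Set.range x)ᶜ : Set ι)) := nonempty_equiv_of_countable
  exact ⟨((Equiv.ofInjective x hx).sumCongr r).trans (Equiv.Set.sumCompl _), fun k => by simp⟩

theorem exists_prod_equiv_extending {κ ι : Type*} [Countable ι] {x : κ × Fin 2 → ι}
    (hx : Function.Injective x) (hc : (Set.range x)ᶜ.Infinite) :
    ∃ e : (κ ⊕ ℕ) × Fin 2 ≃ ι, ∀ k i, e (Sum.inl k, i) = x (k, i) := by
  obtain ⟨e, he⟩ := exists_sum_equiv_extending (τ := ℕ × Fin 2) hx hc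
  exact ⟨(Equiv.sumProdDistrib _ _ _).trans e, fun k i => by simp [he]⟩

end Reindexing

section Swindle

variable {ι ι' κ E : Type*} [NormedAddCommGroup E] [InnerProductSpace ℂ E] [CompleteSpace E]

theorem HilbertBasis.diag_reindex {b : HilbertBasis ι ℂ E} {b' : HilbertBasis κ ℂ E} (e : κ ≃ ι)
    (h : ⇑b' = b ∘ e) (d : ι → Circle) : b'.diag (d ∘ e) = b.diag d := by
  refine b'.isometryEquiv_ext fun i => ?_
  rw [diag_apply, h]
  exact (b.diag_apply d (e i)).symm

theorem HilbertBasis.isConjProd_diag_block (b b' : HilbertBasis (κ × Fin 2) ℂ E)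
    (μ : κ × Fin 2 → Circle) (f : κ × Fin 2 → Circle) (hf : ∀ k, f (k, 1) = (f (k, 0))⁻¹)
    (h : ∀ k, ‖(f (k, 0) : ℂ) - 1‖ ≤ ‖(μ (k, 0) : ℂ) - μ (k, 1)‖) :
    IsConjProd (b.diag μ) 2 (b'.diag f) := by
  choose g g' hg using fun k => exists_diagUnitary_eq_conj_mul_conj_inv _ _ _ (h k)
  have key : b.diag f = (b.block g * b.diag μ * (b.block g)⁻¹) *
      (b.block g' * (b.diag μ)⁻¹ * (b.block g')⁻¹) := by
    rw [diag_eq_block, diag_eq_block]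
    simp only [← map_mul, ← map_inv]
    congr 1
    funext k
    rw [hf]
    exact hg k
  obtain ⟨T, hT⟩ := b.exists_conj_diag b'
  rw [hT, key]
  convert isConjProd_conj_mul_conj_inv (b.diag μ) (T * b.block g) (T * b.block g') using 1
  group

variable [Countable ι] [Countable ι']

theorem HilbertBasis.isConjProd_diag_of_pairing (b : HilbertBasis ι ℂ E) (μ : ι → Circle)
    {x : κ × Fin 2 → ι} (hx : Function.Injective x) (hxc : (Set.range x)ᶜ.Infinite)
    (b' : HilbertBasis ι' ℂ E) (f : ι' → Circle)
    {y : κ × Fin 2 → ι'} (hy : Function.Injective y) (hyc : (Set.range y)ᶜ.Infinite)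
    (hf : ∀ k, f (y (k, 1)) = (f (y (k, 0)))⁻¹) (hf1 : ∀ i, i ∉ Set.range y → f i = 1)
    (h : ∀ k, ‖(f (y (k, 0)) : ℂ) - 1‖ ≤ ‖(μ (x (k, 0)) : ℂ) - μ (x (k, 1))‖) :
    IsConjProd (b.diag μ) 2 (b'.diag f) := by
  obtain ⟨e, he⟩ := exists_prod_equiv_extending hx hxc
  obtain ⟨e', he'⟩ := exists_prod_equiv_extending hy hyc
  obtain ⟨c, hc⟩ := b.exists_reindex e
  obtain ⟨c', hc'⟩ := b'.exists_reindex e'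
  have hrest : ∀ n i, f (e' (Sum.inr n, i)) = 1 := fun n i => hf1 _ <| by
    rintro ⟨⟨k, j⟩, hk⟩
    rw [← he'] at hk
    simpa using e'.injective hk
  rw [← diag_reindex e hc, ← diag_reindex e' hc']
  apply isConjProd_diag_block
  · rintro (k | n)
    · simpa [he'] using hf k
    · simp [hrest]
  · rintro (k | n)
    · simpa [he, he'] using h k
    · simp [hrest]

theorem HilbertBasis.isConjProd_diag_column (b : HilbertBasis ι ℂ E) (μ : ι → Circle)
    {x : (ℕ × ℕ) × Fin 2 → ι} (hx : Function.Injective x) (hxc : (Set.range x)ᶜ.Infinite)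
    {δ : ℝ} (hδ : ∀ k, δ ≤ ‖(μ (x (k, 0)) : ℂ) - μ (x (k, 1))‖)
    (b' : HilbertBasis ((ℕ × ℕ) ⊕ ℕ) ℂ E) (f : (ℕ × ℕ) ⊕ ℕ → Circle)
    (hf : ∀ i, (∀ n, i ≠ Sum.inl (n, 0)) → f i = 1)
    (h : ∀ n, ‖(f (Sum.inl (n, 0)) : ℂ) - 1‖ ≤ δ) :
    IsConjProd (b.diag μ) 4 (b'.diag f) := by
  set c : ℕ → Circle := fun n => f (Sum.inl (n, 0))
  let f₁ : (ℕ × ℕ) ⊕ ℕ → Circle :=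
    Sum.elim (fun p => if p.2 % 2 = 0 then c p.1 else (c p.1)⁻¹) fun _ => 1
  let f₂ : (ℕ × ℕ) ⊕ ℕ → Circle :=
    Sum.elim (fun p => if p.2 = 0 then 1 else if p.2 % 2 = 0 then (c p.1)⁻¹ else c p.1) fun _ => 1
  have hmul : f = f₁ * f₂ := by
    funext i
    rcases i with ⟨n, j⟩ | n
    · rcases eq_or_ne j 0 with rfl | hj
      · simp [f₁, f₂, c]
      · rw [hf _ (by simp [hj])]
        by_cases hj2 : j % 2 = 0 <;> simp [f₁, f₂, hj, hj2]
    · rw [hf _ (by simp)]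
      simp [f₁, f₂]
  have hinf : ∀ s : Set ((ℕ × ℕ) ⊕ ℕ), (∀ n, Sum.inr n ∉ s) → sᶜ.Infinite := fun s hs =>
    (Set.infinite_range_of_injective Sum.inr_injective).mono (by rintro _ ⟨n, rfl⟩; exact hs n)
  rw [hmul, map_mul]
  refine IsConjProd.mul (n := 2) (k := 2) ?_ ?_
  · refine b.isConjProd_diag_of_pairing μ hx hxc b' f₁
      (y := fun p => Sum.inl (p.1.1, 2 * p.1.2 + p.2)) ?_ (hinf _ (by simp)) ?_ ?_ ?_
    · rintro ⟨⟨n, j⟩, i⟩ ⟨⟨n', j'⟩, i'⟩ hp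
      simp only [Sum.inl.injEq, Prod.mk.injEq] at hp
      simp only [Prod.mk.injEq, Fin.ext_iff]
      omega
    · rintro ⟨n, j⟩
      simp [f₁, Nat.add_mod]
    · rintro (⟨n, j⟩ | n) hi
      · refine absurd ⟨((n, j / 2), ⟨j % 2, Nat.mod_lt _ two_pos⟩), ?_⟩ hi
        simp [Nat.div_add_mod]
      · rfl
    · rintro ⟨n, j⟩
      simpa [f₁] using (h n).trans (hδ (n, j))
  · refine b.isConjProd_diag_of_pairing μ hx hxc b' f₂
      (y := fun p => Sum.inl (p.1.1, 2 * p.1.2 + 1 + p.2)) ?_ (hinf _ (by simp)) ?_ ?_ ?_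
    · rintro ⟨⟨n, j⟩, i⟩ ⟨⟨n', j'⟩, i'⟩ hp
      simp only [Sum.inl.injEq, Prod.mk.injEq] at hp
      simp only [Prod.mk.injEq, Fin.ext_iff]
      omega
    · rintro ⟨n, j⟩
      simp [f₂, Nat.add_mod]
    · rintro (⟨n, j⟩ | n) hi
      · rcases j with _ | j
        · simp [f₂]
        · refine absurd ⟨((n, j / 2), ⟨j % 2, Nat.mod_lt _ two_pos⟩), ?_⟩ hi
          simp only [Sum.inl.injEq, Prod.mk.injEq, true_and]
          omega
      · rfl
    · rintro ⟨n, j⟩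
      simpa [f₂, Nat.add_mod] using (h n).trans (hδ (n, j))

theorem HilbertBasis.isConjProd_diag_of_range (b : HilbertBasis ι ℂ E) (μ : ι → Circle)
    {x : (ℕ × ℕ) × Fin 2 → ι} (hx : Function.Injective x) (hxc : (Set.range x)ᶜ.Infinite)
    {δ : ℝ} (hδ : ∀ k, δ ≤ ‖(μ (x (k, 0)) : ℂ) - μ (x (k, 1))‖)
    (b' : HilbertBasis ι' ℂ E) (f : ι' → Circle) {y : ℕ → ι'} (hy : Function.Injective y)
    (hyc : (Set.range y)ᶜ.Infinite) (hf : ∀ i, i ∉ Set.range y → f i = 1)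
    (h : ∀ n, ‖(f (y n) : ℂ) - 1‖ ≤ δ) :
    IsConjProd (b.diag μ) 4 (b'.diag f) := by
  obtain ⟨e₁, he₁⟩ := exists_sum_equiv_extending (τ := ℕ)
    (x := fun n : ℕ => (Sum.inl (n, 0) : (ℕ × ℕ) ⊕ ℕ)) (fun n n' hn => by simpa using hn)
    ((Set.infinite_range_of_injective Sum.inr_injective).mono (by rintro _ ⟨n, rfl⟩; simp))
  obtain ⟨e₂, he₂⟩ := exists_sum_equiv_extending (τ := ℕ) hy hyc
  have he : ∀ n, (e₁.symm.trans e₂) (Sum.inl (n, 0)) = y n := fun n => by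
    rw [← he₁, Equiv.trans_apply, Equiv.symm_apply_apply, he₂]
  obtain ⟨c, hc⟩ := b'.exists_reindex (e₁.symm.trans e₂)
  rw [← diag_reindex _ hc]
  refine b.isConjProd_diag_column μ hx hxc hδ c _ (fun i hi => hf _ ?_) fun n => ?_
  · rintro ⟨n, hn⟩
    rw [← he] at hn
    exact hi n ((Equiv.injective _ hn).symm)
  · rw [Function.comp_apply, he]
    exact h n

theorem HilbertBasis.isConjProd_diag (b : HilbertBasis ι ℂ E) (μ : ι → Circle)
    {x : (ℕ × ℕ) × Fin 2 → ι} (hx : Function.Injective x) (hxc : (Set.range x)ᶜ.Infinite)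
    {δ : ℝ} (hδ : ∀ k, δ ≤ ‖(μ (x (k, 0)) : ℂ) - μ (x (k, 1))‖)
    (b' : HilbertBasis ℕ ℂ E) (f : ℕ → Circle) (h : ∀ n, ‖(f n : ℂ) - 1‖ ≤ δ) :
    IsConjProd (b.diag μ) 8 (b'.diag f) := by
  have hmul : f = (fun n => if n % 2 = 0 then f n else 1) *
      fun n => if n % 2 = 0 then 1 else f n := by
    funext n
    by_cases hn : n % 2 = 0 <;> simp [hn]
  rw [hmul, map_mul]
  refine IsConjProd.mul (n := 4) (k := 4) ?_ ?_
  · refine b.isConjProd_diag_of_range μ hx hxc hδ b' _ (y := fun n => 2 * n)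
      (fun n n' hn => by simpa using hn) ?_ (fun i hi => ?_) fun n => ?_
    · refine (Set.infinite_range_of_injective (f := fun n : ℕ => 2 * n + 1)
        fun n n' hn => by simpa using hn).mono ?_
      rintro _ ⟨n, rfl⟩ ⟨k, hk⟩
      simp only at hk
      omega
    · exact if_neg fun hi2 => hi ⟨i / 2, by simp only; omega⟩
    · simpa using h (2 * n)
  · refine b.isConjProd_diag_of_range μ hx hxc hδ b' _ (y := fun n => 2 * n + 1)
      (fun n n' hn => by simpa using hn) ?_ (fun i hi => ?_) fun n => ?_
    · refine (Set.infinite_range_of_injective (f := fun n : ℕ => 2 * n)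
        fun n n' hn => by simpa using hn).mono ?_
      rintro _ ⟨n, rfl⟩ ⟨k, hk⟩
      simp only at hk
      omega
    · exact if_pos (by by_contra hi2; exact hi ⟨i / 2, by simp only; omega⟩)
    · simpa [Nat.add_mod] using h (2 * n + 1)

end Swindle

section DiagonalOperators

variable {ι E : Type*} [NormedAddCommGroup E] [InnerProductSpace ℂ E]

theorem HilbertBasis.opNorm_le_of_forall_eigenvalue (b : HilbertBasis ι ℂ E) {T : E →L[ℂ] E}
    {t : ι → ℂ} (hT : ∀ i, T (b i) = t i • b i) {C : ℝ} (hC : 0 ≤ C) (ht : ∀ i, ‖t i‖ ≤ C) :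
    ‖T‖ ≤ C := by
  classical
  refine T.opNorm_le_bound hC fun x => ?_
  have hrepr : ∀ i, b.repr (T x) i = t i * b.repr x i := fun i => by
    have h : (innerSL ℂ (b i)).comp T = t i • innerSL ℂ (b i) := b.clm_ext fun j => by
      have ho := orthonormal_iff_ite.1 b.orthonormal i j
      simp only [ContinuousLinearMap.comp_apply, hT, smul_apply,
        innerSL_apply_apply, inner_smul_right, smul_eq_mul, ho]
      split_ifs with hij
      · rw [hij]
      · simp
    simpa [b.repr_apply_apply] using DFunLike.congr_fun h x
  calc ‖T x‖ = ‖b.repr (T x)‖ := (b.repr.norm_map _).symm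
    _ ≤ ‖(C : ℂ) • b.repr x‖ := lp.norm_mono two_ne_zero fun i => by
        rw [hrepr, lp.coeFn_smul, Pi.smul_apply, norm_smul, norm_mul, Complex.norm_real,
          Real.norm_of_nonneg hC]
        exact mul_le_mul_of_nonneg_right (ht i) (norm_nonneg _)
    _ = C * ‖x‖ := by
        rw [norm_smul, Complex.norm_real, Real.norm_of_nonneg hC, b.repr.norm_map]

theorem HilbertBasis.isCompactOperator_finset_sum (b : HilbertBasis ι ℂ E) (F : Finset ι)
    (t : ι → ℂ) :
    IsCompactOperator (⇑(∑ i ∈ F, t i • (innerSL ℂ (b i)).smulRight (b i)) : E → E) := by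
  classical
  induction F using Finset.induction_on with
  | empty => simpa using isCompactOperator_zero
  | insert i F hi ih =>
    rw [Finset.sum_insert hi]
    refine IsCompactOperator.add ?_ ih
    exact ((isCompactOperator_of_locallyCompactSpace_rng
      (ContinuousLinearMap.toSpanSingleton ℂ (b i))).comp_clm
        (innerSL ℂ (b i))).smul (t i)

theorem HilbertBasis.infDist_compact_le (b : HilbertBasis ι ℂ E) {T : E →L[ℂ] E}
    {t : ι → ℂ} (hT : ∀ i, T (b i) = t i • b i) {C : ℝ} (hC : 0 ≤ C)
    (ht : {i | C < ‖t i‖}.Finite) :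
    Metric.infDist T {k : E →L[ℂ] E | IsCompactOperator ⇑k} ≤ C := by
  classical
  set K : E →L[ℂ] E := ∑ i ∈ ht.toFinset, t i • (innerSL ℂ (b i)).smulRight (b i) with hK
  have hcomp : K ∈ {k : E →L[ℂ] E | IsCompactOperator ⇑k} := b.isCompactOperator_finset_sum _ t
  refine (Metric.infDist_le_dist_of_mem hcomp).trans ?_
  rw [dist_eq_norm]
  have hKb : ∀ j, K (b j) = (if C < ‖t j‖ then t j else 0) • b j := fun j => by
    have ho := fun i => orthonormal_iff_ite.1 b.orthonormal i j
    simp [hK, ho]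
  refine b.opNorm_le_of_forall_eigenvalue (t := fun i => if C < ‖t i‖ then 0 else t i)
    (fun j => ?_) hC fun j => ?_
  · rw [sub_apply, hT, hKb, ← sub_smul]
    split_ifs <;> simp
  · split_ifs with h
    · simpa using hC
    · exact not_lt.1 h

end DiagonalOperators

section Circle

theorem Circle.exists_infinite_near (μ : ℕ → Circle) :
    ∃ a : Circle, ∀ ε > 0, {n | ‖(μ n : ℂ) - a‖ < ε}.Infinite := by
  obtain ⟨a, ha⟩ := exists_clusterPt_of_compactSpace (Filter.map μ Filter.atTop)
  refine ⟨a, fun ε hε => Nat.frequently_atTop_iff_infinite.1 ?_⟩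
  have : ∃ᶠ n in Filter.atTop, μ n ∈ Metric.ball a ε :=
    (mapClusterPt_iff_frequently.1 ha) _ (Metric.ball_mem_nhds a hε)
  refine this.mono fun n hn => ?_
  change dist (μ n : ℂ) a < ε at hn
  rwa [dist_eq_norm] at hn

theorem Circle.exists_pow_eq (ζ : Circle) {k : ℕ} (hk : k ≠ 0) :
    ∃ w : Circle, w ^ k = ζ ∧ ‖(w : ℂ) - 1‖ ≤ Real.pi / 2 * ‖1 - (ζ : ℂ)‖ / k := by
  have hk' : (k : ℝ) ≠ 0 := by exact_mod_cast hk
  refine ⟨Circle.exp (Complex.arg ζ / k), ?_, ?_⟩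
  · rw [← Circle.exp_natCast_mul, mul_div_cancel₀ _ hk', Circle.exp_arg]
  · have h1 := Complex.angle_le_mul_norm_sub (x := 1) (y := ζ) (by simp) ζ.norm_coe
    rw [Complex.angle_one_left (Circle.coe_ne_zero ζ)] at h1
    have h2 := Real.norm_exp_I_mul_ofReal_sub_one_le (x := Complex.arg ζ / k)
    rw [Circle.coe_exp, mul_comm]
    refine h2.trans ?_
    rw [Real.norm_eq_abs, abs_div, Nat.abs_cast]
    gcongr

end Circle

section EssentialSpread

theorem ellEss_nonneg (v : H →L[ℂ] H) : 0 ≤ ellEss v :=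
  Real.iInf_nonneg fun _ => Metric.infDist_nonneg

theorem exists_separated_pairs {v : H →L[ℂ] H} (b : HilbertBasis ℕ ℂ H) (μ : ℕ → Circle)
    (hv : ∀ n, v (b n) = (μ n : ℂ) • b n) (hpos : 0 < ellEss v) :
    ∃ x : (ℕ × ℕ) × Fin 2 → ℕ, Function.Injective x ∧ (Set.range x)ᶜ.Infinite ∧
      ∀ k, ellEss v / 2 ≤ ‖(μ (x (k, 0)) : ℂ) - μ (x (k, 1))‖ := by
  set L := ellEss v
  obtain ⟨a, ha⟩ := Circle.exists_infinite_near μ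
  have hA := ha (L / 4) (by positivity)
  have hB : {n | 3 * L / 4 < ‖(μ n : ℂ) - a‖}.Infinite := by
    intro hfin
    have hnorm : ‖((a⁻¹ : Circle) : ℂ)‖ = 1 := Circle.norm_coe _
    have h1 : ∀ n, (1 - ((a⁻¹ : Circle) : ℂ) • v) (b n) = (1 - ((a⁻¹ * μ n : Circle) : ℂ)) • b n :=
      fun n => by
        rw [sub_apply, smul_apply, hv, smul_smul, sub_smul,
          one_smul, one_apply_eq_self, Circle.coe_mul]
    have h2 : ∀ n, ‖1 - ((a⁻¹ * μ n : Circle) : ℂ)‖ = ‖(μ n : ℂ) - a‖ := fun n => by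
      rw [← one_mul ‖1 - _‖, ← a.norm_coe, ← norm_mul, mul_sub, ← Circle.coe_mul,
        mul_inv_cancel_left, mul_one, norm_sub_rev]
    have h3 := b.infDist_compact_le h1 (C := 3 * L / 4) (by positivity) (by simpa only [h2])
    have h4 : L ≤ Metric.infDist (1 - ((a⁻¹ : Circle) : ℂ) • v)
        {k : H →L[ℂ] H | IsCompactOperator (⇑k)} :=
      ciInf_le (f := fun lam : {l : ℂ // ‖l‖ = 1} => Metric.infDist (1 - (lam : ℂ) • v)
        {k : H →L[ℂ] H | IsCompactOperator (⇑k)})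
        ⟨0, by rintro _ ⟨_, rfl⟩; exact Metric.infDist_nonneg⟩ ⟨_, hnorm⟩
    linarith
  let α := hA.natEmbedding
  let β := hB.natEmbedding
  have hαβ : ∀ i j, L / 2 ≤ ‖(μ (α i) : ℂ) - μ (β j)‖ := fun i j => by
    have h1 : ‖(μ (α i) : ℂ) - a‖ < L / 4 := (α i).2
    have h2 : 3 * L / 4 < ‖(μ (β j) : ℂ) - a‖ := (β j).2
    have h3 : ‖(μ (β j) : ℂ) - a‖ ≤ ‖(μ (α i) : ℂ) - μ (β j)‖ + ‖(μ (α i) : ℂ) - a‖ := by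
      rw [norm_sub_rev (μ (α i) : ℂ) (μ (β j))]
      exact norm_sub_le_norm_sub_add_norm_sub _ _ _
    linarith
  have hne : ∀ i j, (α i : ℕ) ≠ β j := fun i j h => by
    have := hαβ i j
    rw [h, sub_self, norm_zero] at this
    linarith
  have hα : ∀ i j, (α i : ℕ) = α j ↔ i = j := fun i j => by
    rw [Subtype.coe_inj, α.injective.eq_iff]
  have hβ : ∀ i j, (β i : ℕ) = β j ↔ i = j := fun i j => by
    rw [Subtype.coe_inj, β.injective.eq_iff]
  refine ⟨fun p => if p.2 = 0 then α (2 * Nat.pair p.1.1 p.1.2) else β (Nat.pair p.1.1 p.1.2),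
    ?_, ?_, fun k => ?_⟩
  · rintro ⟨k, i⟩ ⟨k', i'⟩ h
    fin_cases i <;> fin_cases i' <;>
      simp_all [(hne _ _).symm, Prod.ext_iff]
  · refine (Set.infinite_range_of_injective (f := fun n => (α (2 * n + 1) : ℕ))
      fun n n' hn => by simpa [hα] using hn).mono ?_
    rintro _ ⟨n, rfl⟩ ⟨⟨k, i⟩, hk⟩
    dsimp only at hk
    split_ifs at hk
    · rw [hα] at hk
      omega
    · exact hne _ _ hk.symm
  · simpa using hαβ _ _

theorem exists_norm_eq_ell (u : H →L[ℂ] H) :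
    ∃ lam : Circle, ‖1 - (lam : ℂ) • u‖ = ell u := by
  obtain ⟨lam, -, h⟩ := isCompact_univ.exists_isMinOn (s := (Set.univ : Set Circle))
    Set.univ_nonempty
    (f := fun lam : Circle => ‖1 - (lam : ℂ) • u‖) (by fun_prop)
  refine ⟨lam, le_antisymm ?_ ?_⟩
  · have : Nonempty {l : ℂ // ‖l‖ = 1} := ⟨⟨1, norm_one⟩⟩
    refine le_ciInf fun l => ?_
    exact isMinOn_univ_iff.1 h ⟨l.1, mem_sphere_zero_iff_norm.2 l.2⟩
  · exact ciInf_le (f := fun l : {l : ℂ // ‖l‖ = 1} => ‖1 - (l : ℂ) • u‖)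
      ⟨0, by rintro _ ⟨_, rfl⟩; exact norm_nonneg _⟩ ⟨lam, lam.norm_coe⟩

theorem exists_circle_eigenvalues {x : H →L[ℂ] H} (hx : x ∈ unitary (H →L[ℂ] H))
    (hd : Diagonalizable x) :
    ∃ (b : HilbertBasis ℕ ℂ H) (μ : ℕ → Circle), ∀ n, x (b n) = (μ n : ℂ) • b n := by
  obtain ⟨b, μ, h⟩ := hd
  have hμ : ∀ n, ‖μ n‖ = 1 := fun n => by
    have := x.norm_map_of_mem_unitary hx (b n)
    rwa [h, norm_smul, b.orthonormal.norm_eq_one, mul_one] at this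
  exact ⟨b, fun n => ⟨μ n, mem_sphere_zero_iff_norm.2 (hμ n)⟩, h⟩

/-- The invertible isometry of `H` given by a unitary operator. -/
def toIsometryEquiv (v : H →L[ℂ] H) (hv : v ∈ unitary (H →L[ℂ] H)) : H ≃ₗᵢ[ℂ] H :=
  Unitary.linearIsometryEquiv ⟨v, hv⟩

theorem IsConjProd.exists_ofFn {v : H →L[ℂ] H} {hv : v ∈ unitary (H →L[ℂ] H)} {n : ℕ}
    {X : H ≃ₗᵢ[ℂ] H} (hX : IsConjProd (toIsometryEquiv v hv) n X) :
    ∃ (g : Fin n → H →L[ℂ] H) (ε : Fin n → Bool), (∀ i, g i ∈ unitary (H →L[ℂ] H)) ∧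
      (X : H →L[ℂ] H) = (List.ofFn fun i =>
        g i * (if ε i then v else star v) * star (g i)).prod := by
  obtain ⟨l, rfl, rfl⟩ := hX
  let φ : (H ≃ₗᵢ[ℂ] H) →* (H →L[ℂ] H) :=
    (unitary (H →L[ℂ] H)).subtype.comp Unitary.linearIsometryEquiv.symm.toMonoidHom
  have hinv : ∀ y, φ y⁻¹ = star (φ y) := fun y => by
    simp only [φ, MonoidHom.comp_apply, map_inv, ← Unitary.star_eq_inv]
    rfl
  have hφv : φ (toIsometryEquiv v hv) = v := by
    simp [φ, toIsometryEquiv]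
  refine ⟨fun i => φ (l.get i).1, fun i => (l.get i).2, fun i => Subtype.property _, ?_⟩
  change φ _ = _
  rw [map_list_prod, List.map_map]
  congr 1
  conv_lhs => rw [← List.ofFn_get l, List.map_ofFn]
  congr 1
  funext i
  simp only [Function.comp_apply, map_mul, hinv]
  split_ifs <;> simp [hinv, hφv]

end EssentialSpread

theorem diagonalizable_unitary_prod_conjugates
    (m : ℕ) (hm : 1 ≤ m) (u v : H →L[ℂ] H)
    (hu : u ∈ unitary (H →L[ℂ] H)) (hv : v ∈ unitary (H →L[ℂ] H))
    (hud : Diagonalizable u) (hvd : Diagonalizable v)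
    (h : ell u ≤ (m : ℝ) * ellEss v) :
    ∃ lam : ℂ, ‖lam‖ = 1 ∧
      ∃ (g : Fin (128 * m) → H →L[ℂ] H) (ε : Fin (128 * m) → Bool),
        (∀ i, g i ∈ unitary (H →L[ℂ] H)) ∧
        u = lam • (List.ofFn fun i =>
              g i * (if ε i then v else star v) * star (g i)).prod := by
  obtain ⟨b, μ, hb⟩ := exists_circle_eigenvalues hv hvd
  obtain ⟨b', ν, hb'⟩ := exists_circle_eigenvalues hu hud
  obtain ⟨lam, hlam⟩ := exists_norm_eq_ell u
  have hν : ∀ n, ‖1 - ((lam * ν n : Circle) : ℂ)‖ ≤ m * ellEss v := fun n => by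
    have h1 := (1 - (lam : ℂ) • u).le_opNorm (b' n)
    rw [sub_apply, smul_apply, hb', smul_smul,
      one_apply_eq_self, ← Circle.coe_mul] at h1
    nth_rw 1 [← one_smul ℂ (b' n)] at h1
    rw [← sub_smul, norm_smul, b'.orthonormal.norm_eq_one, mul_one, mul_one, hlam] at h1
    exact h1.trans h
  have hV : toIsometryEquiv v hv = b.diag μ := b.eq_diag hb
  suffices hX : IsConjProd (toIsometryEquiv v hv) (128 * m) (b'.diag fun n => lam * ν n) by
    obtain ⟨g, ε, hg, hprod⟩ := hX.exists_ofFn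
    refine ⟨((lam⁻¹ : Circle) : ℂ), Circle.norm_coe _, g, ε, hg, ?_⟩
    rw [← hprod]
    refine b'.clm_ext fun n => ?_
    rw [hb', smul_apply]
    change _ = _ • b'.diag _ (b' n)
    rw [b'.diag_apply, smul_smul, ← Circle.coe_mul, inv_mul_cancel_left]
  rcases (ellEss_nonneg v).eq_or_lt with h0 | hpos
  · have h1 : (fun n => lam * ν n) = 1 := by
      funext n
      have := hν n
      rw [← h0, mul_zero, norm_le_zero_iff, sub_eq_zero] at this
      exact Circle.ext this.symm
    rw [h1, map_one]
    have := (isConjProd_conj_mul_conj_inv (toIsometryEquiv v hv) 1 1).pow (64 * m)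
    rw [show 2 * (64 * m) = 128 * m by ring] at this
    simpa using this
  · obtain ⟨x, hx, hxc, hδ⟩ := exists_separated_pairs b μ hb hpos
    have hk : 16 * m ≠ 0 := by omega
    choose w hw hw1 using fun n => Circle.exists_pow_eq (lam * ν n) hk
    have hwδ : ∀ n, ‖(w n : ℂ) - 1‖ ≤ ellEss v / 2 := fun n => by
      refine (hw1 n).trans ?_
      have hm0 : (0 : ℝ) < m := by exact_mod_cast hm
      push_cast
      rw [div_le_iff₀ (by positivity)]
      calc Real.pi / 2 * ‖1 - ((lam * ν n : Circle) : ℂ)‖ ≤ 2 * (m * ellEss v) := by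
            gcongr
            · linarith [Real.pi_le_four]
            · exact hν n
        _ ≤ ellEss v / 2 * (16 * m) := by nlinarith [mul_pos hm0 hpos]
    have hpow := (b.isConjProd_diag μ hx hxc hδ b' w hwδ).pow (16 * m)
    rw [← map_pow, show w ^ (16 * m) = fun n => lam * ν n from funext hw, ← hV,
      show 8 * (16 * m) = 128 * m by ring] at hpow
    exact hpow
end
end

section
/- Let H = ℓ²(ℕ, ℂ) and let m ≥ 1 be a natural number. Suppose u and v are unitary operators on H such that ℓ(u) ≤ m · ℓ_ess(v). Then for every ε > 0 there exist a complex number λ with |λ| = 1, unitary operators g₁, …, g_{128m} on H, and signs ε₁, …, ε_{128m} ∈ {1, −1} such that the operator t := u − λ · ∏_{i=1}^{128m} gᵢ v^{εᵢ} gᵢ⁻¹ is a Hilbert–Schmidt operator of Hilbert–Schmidt norm less than ε; concretely, for the standard orthonormal basis (eₙ)_{n∈ℕ} of H one has ∑_{n∈ℕ} ‖t eₙ‖² < ε². -/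
/- Statement 1: For unitaries `u, v` on `H = ℓ²(ℕ, ℂ)` with `ℓ(u) ≤ m · ℓ_ess(v)` and any
`ε > 0`, `u` is within Hilbert–Schmidt distance `ε` from a unimodular scalar multiple of a
product of `128·m` conjugates of `v` or `v⁻¹ = star v` by unitaries. -/

noncomputable section

/-- The standard orthonormal basis of `H`. -/
noncomputable def e (n : ℕ) : H := lp.single 2 n (1 : ℂ)

section Auxiliary

set_option linter.unusedSectionVars false

open scoped ENNReal InnerProductSpace

section HilbertSchmidt

variable {E : Type*} [NormedAddCommGroup E] [InnerProductSpace ℂ E] [CompleteSpace E]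

lemma HilbertBasis.clm_ext_s1 {ι : Type*} (b : HilbertBasis ι ℂ E) {T S : E →L[ℂ] E}
    (h : ∀ n, T (b n) = S (b n)) : T = S :=
  ContinuousLinearMap.ext_on (Submodule.dense_iff_topologicalClosure_eq_top.2 b.dense_span)
    (by rintro _ ⟨n, rfl⟩; exact h n)

lemma HilbertBasis.ext_inner {ι : Type*} (b : HilbertBasis ι ℂ E) {x y : E}
    (h : ∀ n, ⟪b n, x⟫_ℂ = ⟪b n, y⟫_ℂ) : x = y := by
  apply b.repr.injective
  ext n
  rw [b.repr_apply_apply, b.repr_apply_apply, h]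

lemma HilbertBasis.clm_ext_inner {ι : Type*} (b : HilbertBasis ι ℂ E) {T S : E →L[ℂ] E}
    (h : ∀ m n, ⟪b m, T (b n)⟫_ℂ = ⟪b m, S (b n)⟫_ℂ) : T = S :=
  b.clm_ext_s1 fun n => b.ext_inner fun m => h m n

lemma HilbertBasis.enorm_sq_eq_tsum {ι : Type*} (b : HilbertBasis ι ℂ E) (x : E) :
    ‖x‖ₑ ^ 2 = ∑' n, ‖⟪b n, x⟫_ℂ‖ₑ ^ 2 := by
  have hs : HasSum (fun n => ‖b.repr x n‖ ^ 2) (‖x‖ ^ 2) := by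
    have := lp.hasSum_norm (p := 2) (by norm_num) (b.repr x)
    simpa using this
  have h1 : ∀ n, ‖⟪b n, x⟫_ℂ‖ₑ ^ 2 = ENNReal.ofReal (‖b.repr x n‖ ^ 2) := fun n => by
    rw [b.repr_apply_apply, ENNReal.ofReal_pow (norm_nonneg _), ofReal_norm]
  simp_rw [h1]
  rw [← ENNReal.ofReal_tsum_of_nonneg (fun n => by positivity) hs.summable, hs.tsum_eq,
    ENNReal.ofReal_pow (norm_nonneg _), ofReal_norm]

variable (b : HilbertBasis ℕ ℂ E)

/-- The square of the Hilbert–Schmidt norm, computed in the Hilbert basis `b`. -/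
def hsSq (T : E →L[ℂ] E) : ℝ≥0∞ := ∑' n, ‖T (b n)‖ₑ ^ 2

lemma hsSq_star (T : E →L[ℂ] E) : hsSq b (star T) = hsSq b T := by
  unfold hsSq
  simp_rw [b.enorm_sq_eq_tsum]
  rw [ENNReal.tsum_comm]
  refine tsum_congr fun m => tsum_congr fun n => ?_
  rw [ContinuousLinearMap.star_eq_adjoint, ContinuousLinearMap.adjoint_inner_right,
    ← inner_conj_symm, RCLike.enorm_conj]

lemma hsSq_mul_le_left (S T : E →L[ℂ] E) : hsSq b (S * T) ≤ ‖S‖ₑ ^ 2 * hsSq b T := by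
  unfold hsSq
  rw [← ENNReal.tsum_mul_left]
  refine ENNReal.tsum_le_tsum fun n => ?_
  rw [← mul_pow]
  gcongr
  exact S.le_opENorm _

lemma hsSq_add_le (S T : E →L[ℂ] E) : hsSq b (S + T) ≤ 2 * (hsSq b S + hsSq b T) := by
  unfold hsSq
  rw [← ENNReal.tsum_add, ← ENNReal.tsum_mul_left]
  refine ENNReal.tsum_le_tsum fun n => ?_
  have h : ‖(S + T) (b n)‖ₑ ≤ ‖S (b n)‖ₑ + ‖T (b n)‖ₑ := enorm_add_le _ _
  calc ‖(S + T) (b n)‖ₑ ^ 2 ≤ (‖S (b n)‖ₑ + ‖T (b n)‖ₑ) ^ 2 := by gcongr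
    _ ≤ _ := by
      have := ENNReal.rpow_add_le_mul_rpow_add_rpow ‖S (b n)‖ₑ ‖T (b n)‖ₑ one_le_two
      norm_num at this
      exact_mod_cast this

lemma hsSq_smul (c : ℂ) (T : E →L[ℂ] E) : hsSq b (c • T) = ‖c‖ₑ ^ 2 * hsSq b T := by
  unfold hsSq
  simp [enorm_smul, mul_pow, ENNReal.tsum_mul_left]

lemma enorm_apply_sq_le (T : E →L[ℂ] E) (x : E) : ‖T x‖ₑ ^ 2 ≤ hsSq b T * ‖x‖ₑ ^ 2 := by
  rw [← hsSq_star, hsSq, ← ENNReal.tsum_mul_right, b.enorm_sq_eq_tsum (T x)]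
  refine ENNReal.tsum_le_tsum fun n => ?_
  rw [← ContinuousLinearMap.adjoint_inner_left, ← ContinuousLinearMap.star_eq_adjoint, ← mul_pow]
  gcongr
  rw [← ofReal_norm, ← ofReal_norm, ← ofReal_norm, ← ENNReal.ofReal_mul (norm_nonneg _)]
  exact ENNReal.ofReal_le_ofReal (norm_inner_le_norm _ _)

lemma norm_le_of_hsSq_le {T : E →L[ℂ] E} {r : ℝ} (hr : 0 ≤ r)
    (h : hsSq b T ≤ ENNReal.ofReal (r ^ 2)) : ‖T‖ ≤ r := by
  refine T.opNorm_le_bound hr fun x => ?_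
  have h1 : ‖T x‖ₑ ^ 2 ≤ ENNReal.ofReal (r ^ 2) * ‖x‖ₑ ^ 2 :=
    (enorm_apply_sq_le b T x).trans (by gcongr)
  rw [← ofReal_norm, ← ofReal_norm, ← ENNReal.ofReal_pow (norm_nonneg _),
    ← ENNReal.ofReal_pow (norm_nonneg _), ← ENNReal.ofReal_mul (by positivity),
    ENNReal.ofReal_le_ofReal_iff (by positivity), ← mul_pow] at h1
  exact (sq_le_sq₀ (norm_nonneg _) (by positivity)).1 h1

lemma hsSq_sub_comm (S T : E →L[ℂ] E) : hsSq b (S - T) = hsSq b (T - S) := by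
  unfold hsSq
  refine tsum_congr fun n => ?_
  rw [← neg_sub, neg_apply, enorm_neg]

lemma hsSq_mul_le_of_norm_le_one {S : E →L[ℂ] E} (hS : ‖S‖ ≤ 1) (T : E →L[ℂ] E) :
    hsSq b (S * T) ≤ hsSq b T := by
  refine (hsSq_mul_le_left b S T).trans ?_
  have : ‖S‖ₑ ≤ 1 := by
    rw [← ofReal_norm]; exact ENNReal.ofReal_le_one.2 hS
  calc ‖S‖ₑ ^ 2 * hsSq b T ≤ 1 ^ 2 * hsSq b T := by gcongr
    _ = hsSq b T := by simp

lemma hsSq_mul_le_of_norm_le_one' {T : E →L[ℂ] E} (hT : ‖T‖ ≤ 1) (S : E →L[ℂ] E) :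
    hsSq b (S * T) ≤ hsSq b S := by
  rw [← hsSq_star, star_mul, ← hsSq_star b S]
  exact hsSq_mul_le_of_norm_le_one b (by rwa [norm_star]) _

end HilbertSchmidt

section Blocks

variable {A : Type*} [Ring A] [StarRing A] [Algebra ℂ A] [StarModule ℂ A]

/-- `S₁`, `S₂` are isometries with orthogonal ranges. -/
structure OrthIsom (S₁ S₂ : A) : Prop where
  one : star S₁ * S₁ = 1
  two : star S₂ * S₂ = 1
  orth : star S₁ * S₂ = 0

namespace OrthIsom

variable {S₁ S₂ : A} (h : OrthIsom S₁ S₂)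
include h

lemma orth' : star S₂ * S₁ = 0 := by
  simpa using congrArg star h.orth

lemma one_assoc (x : A) : star S₁ * (S₁ * x) = x := by rw [← mul_assoc, h.one, one_mul]
lemma two_assoc (x : A) : star S₂ * (S₂ * x) = x := by rw [← mul_assoc, h.two, one_mul]
lemma orth_assoc (x : A) : star S₁ * (S₂ * x) = 0 := by rw [← mul_assoc, h.orth, zero_mul]
lemma orth'_assoc (x : A) : star S₂ * (S₁ * x) = 0 := by rw [← mul_assoc, h.orth', zero_mul]

end OrthIsom

/-- The operator with `2 × 2` block matrix `(x, y; z, w)` with respect to `S₁`, `S₂`. -/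
def blk (S₁ S₂ x y z w : A) : A :=
  S₁ * x * star S₁ + S₁ * y * star S₂ + S₂ * z * star S₁ + S₂ * w * star S₂

lemma blk_mul {S₁ S₂ : A} (h : OrthIsom S₁ S₂) (x y z w x' y' z' w' : A) :
    blk S₁ S₂ x y z w * blk S₁ S₂ x' y' z' w' =
      blk S₁ S₂ (x * x' + y * z') (x * y' + y * w') (z * x' + w * z') (z * y' + w * w') := by
  simp only [blk, mul_add, add_mul, mul_assoc, h.one_assoc, h.two_assoc, h.orth_assoc,
    h.orth'_assoc, mul_zero, add_zero, zero_add]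
  abel

lemma star_blk (S₁ S₂ x y z w : A) :
    star (blk S₁ S₂ x y z w) = blk S₁ S₂ (star x) (star z) (star y) (star w) := by
  simp only [blk, star_add, star_mul, star_star, mul_assoc]
  abel

lemma blk_add (S₁ S₂ x y z w x' y' z' w' : A) :
    blk S₁ S₂ x y z w + blk S₁ S₂ x' y' z' w' =
      blk S₁ S₂ (x + x') (y + y') (z + z') (w + w') := by
  simp only [blk, mul_add, add_mul]
  abel

lemma smul_blk (c : ℂ) (S₁ S₂ x y z w : A) :
    c • blk S₁ S₂ x y z w = blk S₁ S₂ (c • x) (c • y) (c • z) (c • w) := by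
  simp only [blk, smul_add, mul_smul_comm, smul_mul_assoc]

lemma star_mul_eq_smul_of_unitary {X S : A} (hX : X ∈ unitary A) {a : ℂ} (ha : ‖a‖ = 1)
    (h : X * S = a • S) : star S * X = a • star S := by
  have h1 : star X * X * S = S := by rw [Unitary.star_mul_self_of_mem hX, one_mul]
  rw [mul_assoc, h, mul_smul_comm] at h1
  have ha' : star a * a = 1 := by
    rw [RCLike.star_def, Complex.conj_mul', ha]; simp
  have h2 : star X * S = star a • S := by
    rw [← h1, mul_smul_comm, smul_smul, ha', one_smul, ← mul_smul_comm, h1]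
  simpa using congrArg star h2

lemma exists_conj_of_ranges_eq {S₁ S₂ Y₁ Y₂ X : A} (hS : OrthIsom S₁ S₂) (hY : OrthIsom Y₁ Y₂)
    (hp : Y₁ * star Y₁ + Y₂ * star Y₂ = S₁ * star S₁ + S₂ * star S₂)
    {α β : ℂ} (h1 : X * S₁ = α • S₁) (h2 : X * S₂ = β • S₂)
    (h1' : star S₁ * X = α • star S₁) (h2' : star S₂ * X = β • star S₂) :
    ∃ g ∈ unitary A, g * X * star g =
      α • (Y₁ * star Y₁) + β • (Y₂ * star Y₂) + X * (1 - blk S₁ S₂ 1 0 0 1) := by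
  have hp' : blk S₁ S₂ 1 0 0 1 = Y₁ * star Y₁ + Y₂ * star Y₂ := by rw [hp]; simp [blk]
  have e1 : star S₁ * blk S₁ S₂ 1 0 0 1 = star S₁ := by
    simp [blk, mul_add, hS.one_assoc, hS.orth_assoc]
  have e2 : star S₂ * blk S₁ S₂ 1 0 0 1 = star S₂ := by
    simp [blk, mul_add, hS.two_assoc, hS.orth'_assoc]
  have e3 : blk S₁ S₂ 1 0 0 1 * S₁ = S₁ := by
    simp [blk, add_mul, mul_assoc, hS.one, hS.orth']
  have e4 : blk S₁ S₂ 1 0 0 1 * S₂ = S₂ := by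
    simp [blk, add_mul, mul_assoc, hS.two, hS.orth]
  have e5 : star Y₁ * blk S₁ S₂ 1 0 0 1 = star Y₁ := by
    simp [hp', mul_add, hY.one_assoc, hY.orth_assoc]
  have e6 : star Y₂ * blk S₁ S₂ 1 0 0 1 = star Y₂ := by
    simp [hp', mul_add, hY.two_assoc, hY.orth'_assoc]
  have e7 : blk S₁ S₂ 1 0 0 1 * Y₁ = Y₁ := by
    simp [hp', add_mul, mul_assoc, hY.one, hY.orth']
  have e8 : blk S₁ S₂ 1 0 0 1 * Y₂ = Y₂ := by
    simp [hp', add_mul, mul_assoc, hY.two, hY.orth]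
  have e9 : X * blk S₁ S₂ 1 0 0 1 = blk S₁ S₂ 1 0 0 1 * X := by
    simp only [blk, mul_one, mul_zero, zero_mul, add_zero, mul_add, add_mul, ← mul_assoc, h1, h2]
    simp only [mul_assoc, h1', h2', smul_mul_assoc, mul_smul_comm]
  have e10 : blk S₁ S₂ 1 0 0 1 * blk S₁ S₂ 1 0 0 1 = blk S₁ S₂ 1 0 0 1 := by
    simp [blk_mul hS]
  have e11 : star (blk S₁ S₂ 1 0 0 1) = blk S₁ S₂ 1 0 0 1 := by simp [star_blk]
  have e12 : S₁ * star S₁ + S₂ * star S₂ = blk S₁ S₂ 1 0 0 1 := by simp [blk]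
  have assoc : ∀ {x y z : A}, x * y = z → ∀ w, x * (y * w) = z * w := fun h w => by
    rw [← mul_assoc, h]
  rw [e12] at hp
  generalize blk S₁ S₂ 1 0 0 1 = p at *
  refine ⟨Y₁ * star S₁ + Y₂ * star S₂ + (1 - p), ?_, ?_⟩
  · rw [Unitary.mem_iff]
    constructor
    · simp only [star_add, star_mul, star_star, star_sub, star_one, e11, mul_add, add_mul, mul_sub,
        sub_mul, mul_one, one_mul, mul_assoc, hY.one_assoc, hY.orth_assoc, hY.two_assoc,
        hY.orth'_assoc, e5, e6, e7, e8, assoc e5, assoc e6, assoc e7, assoc e8, e10, mul_zero]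
      rw [← e12]; abel
    · simp only [star_add, star_mul, star_star, star_sub, star_one, e11, mul_add, add_mul, mul_sub,
        sub_mul, mul_one, one_mul, mul_assoc, hS.one_assoc, hS.orth_assoc, hS.two_assoc,
        hS.orth'_assoc, e1, e2, e3, e4, assoc e1, assoc e2, assoc e3, assoc e4, e10, mul_zero]
      rw [← hp]; abel
  · simp only [star_add, star_mul, star_star, star_sub, star_one, e11, mul_add, add_mul, mul_sub,
        sub_mul, mul_one, one_mul, mul_assoc, hS.one_assoc, hS.orth_assoc, hS.two_assoc,
        hS.orth'_assoc, e1, e2, e3, e4, assoc e1, assoc e2, assoc e3, assoc e4, e10, mul_zero,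
        h1, h2, assoc h1, assoc h2, assoc h1', assoc h2', h1', h2', smul_mul_assoc, mul_smul_comm,
        e9, assoc e9, assoc e10, smul_zero]
    abel

/-- A unitary of determinant one and trace `2κ` in a corner yields a projection. -/
lemma isProj_of_trace {p N : A} (hpN : p * N = N) (hNp : N * p = N) (hpp : p * p = p)
    {κ : ℝ} {ρ : ℂ} (hρ : ‖ρ‖ = 1) (hκ : 2 * ρ * κ = 1 + ρ ^ 2) (hρ1 : ρ ^ 2 ≠ 1)
    (hp : star p = p) (htr : N + star N = ((2 * κ : ℝ) : ℂ) • p) (hN : N * star N = p) :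
    let Q := (ρ ^ 2 - 1)⁻¹ • (ρ • N - p)
    star Q = Q ∧ Q * Q = Q ∧ Q * p = Q ∧ p * Q = Q ∧ ρ ^ 2 • Q + (p - Q) = ρ • N := by
  have hs : star N = ((2 * κ : ℝ) : ℂ) • p - N := by rw [← htr]; abel
  have hNN : N * N = ((2 * κ : ℝ) : ℂ) • N - p := by
    rw [hs, mul_sub, mul_smul_comm, hNp] at hN
    rw [← hN]; abel
  have hne : ρ ^ 2 - 1 ≠ 0 := sub_ne_zero.2 hρ1
  have hρ0 : ρ ≠ 0 := by rintro rfl; simp at hρ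
  have hconj : (starRingEnd ℂ) ρ = ρ⁻¹ := by
    rw [Complex.inv_def, Complex.normSq_eq_norm_sq, hρ]; simp
  intro Q
  refine ⟨?_, ?_, ?_, ?_, ?_⟩
  · have h2 : (ρ⁻¹ ^ 2 - 1)⁻¹ = - (ρ ^ 2 * (ρ ^ 2 - 1)⁻¹) := by
      have : ρ⁻¹ ^ 2 - 1 = - (ρ ^ 2 - 1) * (ρ ^ 2)⁻¹ := by field_simp; ring
      rw [this, mul_inv, inv_neg, inv_inv]; ring
    simp only [Q, star_smul, star_sub, hp, hs, star_inv₀, star_pow, star_one, RCLike.star_def,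
      hconj, h2]
    have h3 : ρ * ρ⁻¹ = 1 := mul_inv_cancel₀ hρ0
    have h4 : (ρ ^ 2 - 1) * (ρ ^ 2 - 1)⁻¹ = 1 := mul_inv_cancel₀ hne
    generalize (ρ ^ 2 - 1)⁻¹ = c at *
    generalize ρ⁻¹ = r at *
    push_cast
    match_scalars
    · linear_combination (-c) * hκ - c * 2 * ρ * κ * h3
    · linear_combination ρ * c * h3
  · simp only [Q, sub_mul, mul_sub, smul_mul_assoc, mul_smul_comm, hNN, hpN, hNp, hpp]
    have h4 : (ρ ^ 2 - 1) * (ρ ^ 2 - 1)⁻¹ = 1 := mul_inv_cancel₀ hne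
    generalize (ρ ^ 2 - 1)⁻¹ = c at *
    push_cast
    match_scalars
    · linear_combination c ^ 2 * ρ * hκ + c * ρ * h4
    · linear_combination (-c) * h4
  · simp only [Q, smul_mul_assoc, sub_mul, hNp, hpp]
  · simp only [Q, mul_smul_comm, mul_sub, hpN, hpp]
  · simp only [Q]
    match_scalars
    · field_simp
      ring
    · field_simp
      ring
end Blocks

section Compactness

variable {E : Type*} [NormedAddCommGroup E] [InnerProductSpace ℂ E]

lemma isCompactOperator_of_range_le {F : Type*} [NormedAddCommGroup F] [NormedSpace ℂ F]
    (K : Submodule ℂ F) [FiniteDimensional ℂ K]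
    (Q : E →L[ℂ] F) (h : ∀ x, Q x ∈ K) : IsCompactOperator Q := by
  have : ProperSpace K := FiniteDimensional.proper ℂ K
  have h1 : IsCompactOperator (Q.codRestrict K h) :=
    isCompactOperator_of_locallyCompactSpace_dom
      (Q.codRestrict K h)
  exact h1.clm_comp K.subtypeL

lemma HilbertBasis.not_isCompactOperator_one (b : HilbertBasis ℕ ℂ E) :
    ¬ IsCompactOperator (1 : E →L[ℂ] E) := by
  intro h
  have : FiniteDimensional ℂ E := FiniteDimensional.of_isCompactOperator_id (𝕜 := ℂ) h
  have := b.orthonormal.linearIndependent.finite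
  exact not_finite ℕ

variable [CompleteSpace E]

lemma HilbertBasis.countable_of_orthonormal (b : HilbertBasis ℕ ℂ E) {ι : Type*} {w : ι → E}
    (hw : Orthonormal ℂ w) : Countable ι := by
  have h1 : (⋃ n : ℕ, Function.support fun i => ‖⟪w i, b n⟫_ℂ‖ ^ 2).Countable :=
    Set.countable_iUnion fun n => (hw.inner_products_summable (b n)).countable_support
  rw [← Set.countable_univ_iff]
  refine h1.mono fun i _ => ?_
  by_contra hi
  simp only [Set.mem_iUnion, Function.mem_support, not_exists, not_not] at hi
  refine hw.ne_zero i (b.ext_inner fun n => ?_)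
  rw [inner_zero_right, inner_eq_zero_symm]
  simpa using hi n

lemma isometry_of_inner {Y : E →L[ℂ] E} (h : ∀ x y, ⟪Y x, Y y⟫_ℂ = ⟪x, y⟫_ℂ) :
    star Y * Y = 1 := by
  ext x
  refine ext_inner_left ℂ fun y => ?_
  rw [ContinuousLinearMap.star_eq_adjoint, mul_apply_eq_comp,
    ContinuousLinearMap.adjoint_inner_right, h, one_apply_eq_self]

/-- An infinite-rank projection on a separable Hilbert space is the range projection of an
isometry. -/
lemma HilbertBasis.exists_isometry_range (b : HilbertBasis ℕ ℂ E) {Q : E →L[ℂ] E}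
    (hs : star Q = Q) (hQ : Q * Q = Q) (hc : ¬ IsCompactOperator Q) :
    ∃ Y : E →L[ℂ] E, star Y * Y = 1 ∧ Y * star Y = Q := by
  let K : Submodule ℂ E := LinearMap.ker ((1 - Q : E →L[ℂ] E) : E →ₗ[ℂ] E)
  have hK : ∀ x, x ∈ K ↔ Q x = x := fun x => by
    simp [K, LinearMap.mem_ker, sub_eq_zero, eq_comm (a := x)]
  have hQK : ∀ x, Q x ∈ K := fun x => (hK _).2 (by rw [← mul_apply_eq_comp, hQ])
  have hcl : IsClosed (K : Set E) := (1 - Q : E →L[ℂ] E).isClosed_ker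
  have : CompleteSpace K := hcl.completeSpace_coe
  obtain ⟨w, b', hb'⟩ := exists_hilbertBasis ℂ K
  have hw : Orthonormal ℂ (fun i : w => ((b' i : K) : E)) :=
    b'.orthonormal.comp_linearIsometry K.subtypeₗᵢ
  have hcount : Countable w := b.countable_of_orthonormal hw
  have hinf : Infinite w := by
    by_contra hfin
    rw [not_infinite_iff_finite] at hfin
    have := Fintype.ofFinite w
    have : FiniteDimensional ℂ K := b'.toOrthonormalBasis.toBasis.finiteDimensional_of_finite
    exact hc (isCompactOperator_of_range_le K Q hQK)
  obtain ⟨hden⟩ := nonempty_denumerable w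
  let b'' : HilbertBasis ℕ ℂ K := HilbertBasis.mk
    (v := fun n => b' ((Denumerable.eqv w).symm n))
    (b'.orthonormal.comp _ (Denumerable.eqv w).symm.injective) (by
      have := b'.dense_span
      rw [← this]
      refine Submodule.topologicalClosure_mono (Submodule.span_mono ?_)
      rintro _ ⟨i, rfl⟩
      exact ⟨Denumerable.eqv w i, by simp⟩)
  let V : E ≃ₗᵢ[ℂ] K := b.repr.trans b''.repr.symm
  let Y : E →L[ℂ] E := K.subtypeL.comp (V : E ≃L[ℂ] K).toContinuousLinearMap
  have hY : ∀ x, Y x = (V x : E) := fun x => rfl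
  have h1 : star Y * Y = 1 := isometry_of_inner fun x y => by
    rw [hY, hY, ← Submodule.coe_inner, V.inner_map_map]
  refine ⟨Y, h1, ?_⟩
  have h2 : Q * Y = Y := by
    ext x
    exact (hK _).1 (V x).2
  have h3 : Y * star Y * Q = Q := by
    ext x
    obtain ⟨z, hz⟩ := V.surjective ⟨Q x, hQK x⟩
    have hz' : Y z = Q x := by rw [hY, hz]
    rw [mul_apply_eq_comp, ← hz', ← mul_apply_eq_comp, mul_assoc, h1,
      mul_one]
  have h4 : star (Y * star Y * Q) = Q * (Y * star Y) := by
    simp only [star_mul, star_star, hs]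
  rw [h3, hs, ← mul_assoc, h2] at h4
  exact h4.symm

end Compactness

section Factorization

lemma exists_sqrt_of_norm_eq_one {ζ : ℂ} (hζ : ‖ζ‖ = 1) :
    ∃ ρ : ℂ, ‖ρ‖ = 1 ∧ ρ ^ 2 = ζ ∧ 2 * ρ * ((‖1 + ζ‖ / 2 : ℝ) : ℂ) = 1 + ρ ^ 2 := by
  obtain ⟨s, hs⟩ := IsAlgClosed.exists_pow_nat_eq ζ (n := 2) (by norm_num)
  have key : ∀ ρ : ℂ, ρ ^ 2 = ζ → 0 ≤ ρ.re →
      ‖ρ‖ = 1 ∧ ρ ^ 2 = ζ ∧ 2 * ρ * ((‖1 + ζ‖ / 2 : ℝ) : ℂ) = 1 + ρ ^ 2 := by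
    intro ρ hρ hre
    have h1 : ‖ρ‖ = 1 := by
      have : ‖ρ‖ ^ 2 = 1 := by rw [← norm_pow, hρ, hζ]
      exact (pow_eq_one_iff_of_nonneg (norm_nonneg ρ) two_ne_zero).1 this
    have h2 : 1 + ρ ^ 2 = ρ * ((2 * ρ.re : ℝ) : ℂ) := by
      have h3 : ρ * (starRingEnd ℂ) ρ = 1 := by rw [Complex.mul_conj']; simp [h1]
      have h4 : ρ + (starRingEnd ℂ) ρ = ((2 * ρ.re : ℝ) : ℂ) := Complex.add_conj ρ
      rw [← h4]; linear_combination -h3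
    refine ⟨h1, hρ, ?_⟩
    have h5 : ‖1 + ζ‖ = 2 * ρ.re := by
      rw [← hρ, h2, norm_mul, h1, one_mul, Complex.norm_real, Real.norm_of_nonneg (by positivity)]
    rw [h5, h2]; push_cast; ring
  rcases le_total 0 s.re with h | h
  · exact ⟨s, key s hs h⟩
  · exact ⟨-s, key (-s) (by rw [neg_sq, hs]) (by simpa using h)⟩

variable {A : Type*} [Ring A] [StarRing A] [Algebra ℂ A] [StarModule ℂ A]

/-- The properties of a unitary of the corner cut out by `S₁`, `S₂` that has trace `2κ`. -/
structure HasTrace (S₁ S₂ N : A) (κ : ℝ) : Prop where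
  left : blk S₁ S₂ 1 0 0 1 * N = N
  right : N * blk S₁ S₂ 1 0 0 1 = N
  add_star : N + star N = ((2 * κ : ℝ) : ℂ) • blk S₁ S₂ 1 0 0 1
  mul_star : N * star N = blk S₁ S₂ 1 0 0 1
  trace : star S₁ * N * S₁ + star S₂ * N * S₂ = ((2 * κ : ℝ) : ℂ) • 1

lemma hasTrace_blk {C : Type*} [CommRing C] [StarRing C] [Algebra ℂ C] [StarModule ℂ C]
    (F : C →⋆ₐ[ℂ] A)
    {S₁ S₂ : A} (hS : OrthIsom S₁ S₂) {z h t : C} {κ : ℝ} (hz : z * star z = 1)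
    (hh : h + star h = algebraMap ℂ C ((2 * κ : ℝ) : ℂ)) (ht : star t = t)
    (hht : h * star h + t ^ 2 = 1) :
    HasTrace S₁ S₂ (blk S₁ S₂ (F h) (F (Complex.I • (t * z))) (F (Complex.I • (t * star z)))
      (F (star h))) κ := by
  have hI : star Complex.I = -Complex.I := Complex.conj_I
  have hII : Complex.I * Complex.I = -1 := Complex.I_mul_I
  refine ⟨by simp [blk_mul hS], by simp [blk_mul hS], ?_, ?_, ?_⟩
  · simp only [star_blk, ← map_star, star_star, star_smul, star_mul, blk_add, ← map_add, hI,
      smul_blk, smul_zero, ht, hh]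
    congr 1
    · rw [AlgHomClass.commutes, Algebra.algebraMap_eq_smul_one]
    · rw [mul_comm, neg_smul, add_neg_cancel, map_zero]
    · rw [mul_comm, neg_smul, add_neg_cancel, map_zero]
    · rw [add_comm, hh, AlgHomClass.commutes, Algebra.algebraMap_eq_smul_one]
  · simp only [star_blk, ← map_star, star_star, star_smul, star_mul, blk_mul hS, ← map_add, hI,
      ht, ← map_mul, smul_mul_assoc, mul_smul_comm, smul_smul, hII, neg_neg, one_smul,
      neg_mul]
    rw [← map_one F, ← map_zero F]
    congr 2
    · linear_combination hht + t ^ 2 * hz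
    · rw [neg_smul, mul_comm h, mul_comm z t, mul_comm (t * z)]; simp [mul_comm]
    · rw [neg_smul]; simp [mul_comm]
    · linear_combination hht + t ^ 2 * hz
  · simp only [blk, mul_add, add_mul, mul_assoc, hS.one_assoc, hS.two_assoc, hS.orth_assoc,
      hS.orth'_assoc, hS.one, hS.two, hS.orth, hS.orth', mul_zero, mul_one, add_zero, zero_add]
    rw [← map_add, hh, AlgHomClass.commutes, Algebra.algebraMap_eq_smul_one]

lemma exists_hasTrace_mul_star {C : Type*} [CommRing C] [StarRing C] [Algebra ℂ C]
    [StarModule ℂ C] (F : C →⋆ₐ[ℂ] A)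
    {S₁ S₂ : A} (hS : OrthIsom S₁ S₂) {z h t : C} {κ : ℝ} (hz : z * star z = 1)
    (hzh : star h = z * h)
    (hh : h + star h = algebraMap ℂ C ((2 * κ : ℝ) : ℂ)) (ht : star t = t)
    (hht : h * star h + t ^ 2 = 1) :
    ∃ N₁ N₂ : A, HasTrace S₁ S₂ N₁ κ ∧ HasTrace S₁ S₂ N₂ κ ∧
      N₁ * star N₂ = blk S₁ S₂ (F z) 0 0 (star (F z)) := by
  have hI : star Complex.I = -Complex.I := Complex.conj_I
  have hII : Complex.I * Complex.I = -1 := Complex.I_mul_I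
  refine ⟨_, _, hasTrace_blk F hS (h := star h) hz (by rw [star_star, add_comm, hh]) ht
    (by rw [star_star, mul_comm, hht]), hasTrace_blk F hS (z := 1) (by simp) hh ht hht, ?_⟩
  simp only [star_blk, ← map_star, star_star, star_smul, blk_mul hS, ← map_add, hI,
      ht, ← map_mul, smul_mul_assoc, mul_smul_comm, smul_smul, hII, neg_neg, one_smul,
      neg_mul, star_one, mul_one, one_mul]
  rw [← map_zero F]
  have hzh' : star z * star h = h := by rw [hzh]; linear_combination h * hz
  congr 2
  · rw [hzh] at hht ⊢
    linear_combination z * hht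
  · rw [hzh, neg_smul, ← sub_eq_neg_add, ← smul_sub, sub_eq_zero.2, smul_zero]; ring
  · rw [neg_smul, ← sub_eq_add_neg, ← smul_sub, sub_eq_zero.2, smul_zero]
    linear_combination t * hzh'
  · rw [hzh] at hht
    linear_combination star z * hht - h ^ 2 * hz

end Factorization

section KeyLemma

variable {E : Type*} [NormedAddCommGroup E] [InnerProductSpace ℂ E] [CompleteSpace E]

lemma norm_one_add_ge {z ζ : ℂ} (hz : ‖z‖ = 1) (hζ : ‖ζ‖ = 1) (h : ‖1 - z‖ ≤ ‖1 - ζ‖) :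
    ‖1 + ζ‖ ≤ ‖1 + z‖ := by
  have h1 := parallelogram_law_with_norm ℝ 1 z
  have h2 := parallelogram_law_with_norm ℝ 1 ζ
  rw [hz] at h1
  rw [hζ] at h2
  have h3 : ‖1 - z‖ * ‖1 - z‖ ≤ ‖1 - ζ‖ * ‖1 - ζ‖ := by gcongr
  exact nonneg_le_nonneg_of_sq_le_sq (norm_nonneg _) (by linarith)

lemma unitary_spectrum_bound {A : E →L[ℂ] E} (hA : A ∈ unitary (E →L[ℂ] E)) {z : ℂ}
    (hz : z ∈ spectrum ℂ A) : ‖z‖ = 1 ∧ ‖1 - z‖ ≤ ‖1 - A‖ := by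
  have h1 : ‖z‖ = 1 := by
    simpa using spectrum.subset_circle_of_unitary (𝕜 := ℂ) hA hz
  refine ⟨h1, ?_⟩
  have h2 : 1 - z ∈ spectrum ℂ (1 - A) := by
    have h3 := spectrum.singleton_sub_eq A (1 : ℂ)
    rw [map_one] at h3
    rw [← h3]
    exact Set.sub_mem_sub rfl hz
  exact (spectrum.norm_le_norm_mul_of_mem h2).trans
    (mul_le_of_le_one_right (norm_nonneg _) ContinuousLinearMap.norm_id_le)

/-- A unitary `A` close to `1` gives rise to corner unitaries of trace `2κ` with quotient
`diag(A, A*)`. -/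
lemma exists_hasTrace_of_norm_le {S₁ S₂ A : E →L[ℂ] E} (hS : OrthIsom S₁ S₂)
    (hA : A ∈ unitary (E →L[ℂ] E)) {ζ : ℂ} (hζ : ‖ζ‖ = 1) (h : ‖1 - A‖ ≤ ‖1 - ζ‖) :
    ∃ N₁ N₂ : E →L[ℂ] E, HasTrace S₁ S₂ N₁ (‖1 + ζ‖ / 2) ∧ HasTrace S₁ S₂ N₂ (‖1 + ζ‖ / 2) ∧
      N₁ * star N₂ = blk S₁ S₂ A 0 0 (star A) := by
  have hn : IsStarNormal A := isStarNormal_of_mem_unitary hA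
  set κ := ‖1 + ζ‖ / 2 with hκ
  have hsp : ∀ z ∈ spectrum ℂ A, ‖z‖ = 1 ∧ 2 * κ ≤ ‖1 + z‖ := fun z hz => by
    obtain ⟨h1, h2⟩ := unitary_spectrum_bound hA hz
    refine ⟨h1, ?_⟩
    linarith [norm_one_add_ge h1 hζ (h2.trans h)]
  have hκ0 : 0 ≤ κ := by positivity
  have hcont : Continuous fun z : spectrum ℂ A => (((2 * κ : ℝ) : ℂ) / (1 + (z : ℂ))) := by
    rcases hκ0.eq_or_lt with h0 | h0
    · simp only [← h0, mul_zero, Complex.ofReal_zero, zero_div]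
      exact continuous_const
    · refine Continuous.div continuous_const (by fun_prop) fun z => ?_
      have := (hsp z z.2).2
      exact norm_pos_iff.1 (by linarith)
  let hf : C(spectrum ℂ A, ℂ) := ⟨_, hcont⟩
  let tf : C(spectrum ℂ A, ℂ) := ⟨fun z => ((√(1 - ‖hf z‖ ^ 2) : ℝ) : ℂ), by fun_prop⟩
  let zf : C(spectrum ℂ A, ℂ) := (ContinuousMap.id ℂ).restrict (spectrum ℂ A)
  have hzf : cfcHom (R := ℂ) hn zf = A := cfcHom_id hn
  rw [← hzf]
  have hne : κ ≠ 0 → ∀ z : spectrum ℂ A, (1 + (z : ℂ)) ≠ 0 := fun h0 z => by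
    have := (hsp z z.2).2
    have := hκ0.lt_of_ne h0.symm
    exact norm_pos_iff.1 (by linarith)
  have hconj : ∀ z : spectrum ℂ A, (starRingEnd ℂ) (z : ℂ) = (z : ℂ)⁻¹ := fun z => by
    rw [Complex.inv_def, Complex.normSq_eq_norm_sq, (hsp z z.2).1]; simp
  have hz0 : ∀ z : spectrum ℂ A, (z : ℂ) ≠ 0 := fun z => by
    rw [← norm_pos_iff, (hsp z z.2).1]; norm_num
  refine exists_hasTrace_mul_star (cfcHom (R := ℂ) hn) hS (z := zf) (h := hf) (t := tf)
    ?_ ?_ ?_ ?_ ?_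
  · ext z
    simp [zf, hconj z, hz0 z]
  · ext z
    by_cases h0 : κ = 0
    · simp [hf, h0]
    have := hne h0 z
    have h3 := hz0 z
    have h4 : 1 + (z : ℂ)⁻¹ = (1 + (z : ℂ)) * (z : ℂ)⁻¹ := by field_simp; ring
    simp only [zf, hf, ContinuousMap.star_apply, ContinuousMap.coe_mk, ContinuousMap.mul_apply,
      RCLike.star_def, map_div₀, Complex.conj_ofReal, map_add, map_one, hconj z,
      ContinuousMap.restrict_apply, ContinuousMap.id_apply, h4]
    field_simp
  · ext z
    by_cases h0 : κ = 0
    · simp [hf, h0]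
    have := hne h0 z
    have h3 := hz0 z
    have h4 : 1 + (z : ℂ)⁻¹ = (1 + (z : ℂ)) * (z : ℂ)⁻¹ := by field_simp; ring
    simp only [hf, ContinuousMap.star_apply, ContinuousMap.coe_mk, ContinuousMap.add_apply,
      RCLike.star_def, map_div₀, Complex.conj_ofReal, map_add, map_one, hconj z,
      algebraMap_apply, smul_eq_mul, mul_one, h4]
    field_simp
  · ext z
    simp [tf]
  · ext z
    have h1 : ‖hf z‖ ^ 2 ≤ 1 := by
      have : ‖hf z‖ ≤ 1 := by
        simp only [hf, ContinuousMap.coe_mk, norm_div, Complex.norm_real, Real.norm_eq_abs]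
        rw [abs_of_nonneg (by positivity)]
        exact div_le_one_of_le₀ (hsp z z.2).2 (norm_nonneg _)
      nlinarith [norm_nonneg (hf z)]
    have h2 : ((√(1 - ‖hf z‖ ^ 2) : ℝ) : ℂ) ^ 2 = 1 - (‖hf z‖ : ℂ) ^ 2 := by
      rw [← Complex.ofReal_pow, Real.sq_sqrt (by linarith)]; push_cast; ring
    simp only [ContinuousMap.add_apply, ContinuousMap.mul_apply, ContinuousMap.star_apply,
      RCLike.star_def, Complex.mul_conj', ContinuousMap.pow_apply, ContinuousMap.one_apply]
    change _ + ((√(1 - ‖hf z‖ ^ 2) : ℝ) : ℂ) ^ 2 = 1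
    rw [h2]; ring

end KeyLemma

section KeyLemma

variable {E : Type*} [NormedAddCommGroup E] [InnerProductSpace ℂ E] [CompleteSpace E]

lemma HilbertBasis.not_isCompactOperator_of_compress (b : HilbertBasis ℕ ℂ E)
    {S₁ S₂ Q : E →L[ℂ] E} (h : star S₁ * Q * S₁ + star S₂ * Q * S₂ = 1) :
    ¬ IsCompactOperator Q := fun hQ => by
  apply b.not_isCompactOperator_one
  rw [← h]
  have h1 : ∀ S : E →L[ℂ] E, IsCompactOperator (star S * Q * S) := fun S =>
    (hQ.clm_comp (star S)).comp_clm S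
  exact (h1 S₁).add (h1 S₂)

lemma HilbertBasis.exists_conj_of_hasTrace (b : HilbertBasis ℕ ℂ E) {S₁ S₂ X N : E →L[ℂ] E}
    (hS : OrthIsom S₁ S₂)
    (hX : X ∈ unitary (E →L[ℂ] E)) {α β ρ : ℂ} (hα : ‖α‖ = 1) (hβ : ‖β‖ = 1) (hρ : ‖ρ‖ = 1)
    (h1 : X * S₁ = α • S₁) (h2 : X * S₂ = β • S₂) (hαβ : α = ρ ^ 2 * β) (hρ1 : ρ ^ 2 ≠ 1)
    {κ : ℝ} (hκ : 2 * ρ * κ = 1 + ρ ^ 2) (hN : HasTrace S₁ S₂ N κ) :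
    ∃ g ∈ unitary (E →L[ℂ] E), g * X * star g =
      (β * ρ) • N + X * (1 - blk S₁ S₂ 1 0 0 1) := by
  have hpp : blk S₁ S₂ 1 0 0 1 * blk S₁ S₂ 1 0 0 1 = blk S₁ S₂ 1 0 0 1 := by simp [blk_mul hS]
  have hps : star (blk S₁ S₂ 1 0 0 1) = blk S₁ S₂ 1 0 0 1 := by simp [star_blk]
  obtain ⟨q1, q2, q3, q4, q5⟩ :=
    isProj_of_trace hN.left hN.right hpp hρ hκ hρ1 hps hN.add_star hN.mul_star
  have hp2 : star S₁ * blk S₁ S₂ 1 0 0 1 * S₁ + star S₂ * blk S₁ S₂ 1 0 0 1 * S₂ =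
      (2 : ℂ) • (1 : E →L[ℂ] E) := by
    simp only [blk, mul_add, add_mul, mul_assoc, hS.one_assoc, hS.two_assoc, hS.orth_assoc,
      hS.orth'_assoc, hS.one, hS.two, hS.orth, hS.orth', mul_zero, mul_one, add_zero, zero_add,
      one_mul, zero_mul, two_smul]
  have hne : ρ ^ 2 - 1 ≠ 0 := sub_ne_zero.2 hρ1
  have q6 : star S₁ * ((ρ ^ 2 - 1)⁻¹ • (ρ • N - blk S₁ S₂ 1 0 0 1)) * S₁ +
      star S₂ * ((ρ ^ 2 - 1)⁻¹ • (ρ • N - blk S₁ S₂ 1 0 0 1)) * S₂ = 1 := by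
    have e : star S₁ * ((ρ ^ 2 - 1)⁻¹ • (ρ • N - blk S₁ S₂ 1 0 0 1)) * S₁ +
      star S₂ * ((ρ ^ 2 - 1)⁻¹ • (ρ • N - blk S₁ S₂ 1 0 0 1)) * S₂ =
      (ρ ^ 2 - 1)⁻¹ • (ρ • (star S₁ * N * S₁ + star S₂ * N * S₂) -
        (star S₁ * blk S₁ S₂ 1 0 0 1 * S₁ + star S₂ * blk S₁ S₂ 1 0 0 1 * S₂)) := by
      simp only [mul_smul_comm, smul_mul_assoc, mul_sub, sub_mul, smul_sub, smul_add]
      abel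
    rw [e, hp2, hN.trace, smul_smul, ← sub_smul, smul_smul]
    have : (ρ ^ 2 - 1)⁻¹ * (ρ * ((2 * κ : ℝ) : ℂ) - 2) = 1 := by
      rw [inv_mul_eq_one₀ hne]; push_cast; linear_combination -hκ
    rw [this, one_smul]
  set p := blk S₁ S₂ 1 0 0 1 with hp
  set Q := (ρ ^ 2 - 1)⁻¹ • (ρ • N - p) with hQ
  obtain ⟨Y₁, y1, y1'⟩ := b.exists_isometry_range q1 q2 (b.not_isCompactOperator_of_compress q6)
  obtain ⟨Y₂, y2, y2'⟩ := b.exists_isometry_range (Q := p - Q) (by rw [star_sub, hps, q1])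
    (by rw [sub_mul, mul_sub, mul_sub, hpp, q2, q3, q4]; abel)
    (b.not_isCompactOperator_of_compress (S₁ := S₁) (S₂ := S₂) (by
      have e : star S₁ * (p - Q) * S₁ + star S₂ * (p - Q) * S₂ =
        (star S₁ * p * S₁ + star S₂ * p * S₂) - (star S₁ * Q * S₁ + star S₂ * Q * S₂) := by
        simp only [mul_sub, sub_mul]; abel
      rw [e, hp2, q6, two_smul, add_sub_cancel_right]))
  have hY : OrthIsom Y₁ Y₂ := by
    refine ⟨y1, y2, ?_⟩
    have : star Y₁ * Y₂ = star Y₁ * (Y₁ * star Y₁) * ((Y₂ * star Y₂) * Y₂) := by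
      rw [mul_assoc Y₂, y2, mul_one, ← mul_assoc, y1, one_mul]
    rw [this, y1', y2', mul_assoc, ← mul_assoc Q, mul_sub, q3, q2, sub_self, zero_mul, mul_zero]
  have hpS : p = S₁ * star S₁ + S₂ * star S₂ := by simp [hp, blk]
  obtain ⟨g, hg, hgX⟩ := exists_conj_of_ranges_eq hS hY
    (by rw [y1', y2', ← hpS]; abel) h1 h2
    (star_mul_eq_smul_of_unitary hX hα h1) (star_mul_eq_smul_of_unitary hX hβ h2)
  refine ⟨g, hg, ?_⟩
  rw [hgX, y1', y2', ← hp, hαβ, mul_comm, mul_smul, ← smul_add, q5, smul_smul]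

/-- If a unitary `X` has two eigenvalues `α ≠ β` of infinite multiplicity, then every unitary of
the form `diag(A, A*) ⊕ 1` with `‖1 - A‖ ≤ |α - β|` is a product of a conjugate of `X` and a
conjugate of `X⁻¹`. -/
theorem HilbertBasis.exists_conj_mul_conj_eq_blk (b : HilbertBasis ℕ ℂ E)
    {S₁ S₂ X A : E →L[ℂ] E} (hS : OrthIsom S₁ S₂)
    (hX : X ∈ unitary (E →L[ℂ] E)) {α β : ℂ} (hα : ‖α‖ = 1) (hβ : ‖β‖ = 1) (hαβ : α ≠ β)
    (h1 : X * S₁ = α • S₁) (h2 : X * S₂ = β • S₂)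
    (hA : A ∈ unitary (E →L[ℂ] E)) (hle : ‖1 - A‖ ≤ ‖α - β‖) :
    ∃ g₁ ∈ unitary (E →L[ℂ] E), ∃ g₂ ∈ unitary (E →L[ℂ] E),
      g₁ * X * star g₁ * (g₂ * star X * star g₂) =
        blk S₁ S₂ A 0 0 (star A) + (1 - blk S₁ S₂ 1 0 0 1) := by
  have hβ0 : β ≠ 0 := by rintro rfl; simp at hβ
  obtain ⟨ρ, hρ, hρ2, hκ⟩ := exists_sqrt_of_norm_eq_one (ζ := α / β) (by simp [hα, hβ])
  have hζ : ‖1 - α / β‖ = ‖α - β‖ := by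
    rw [norm_sub_rev α β, one_sub_div hβ0, norm_div, hβ, div_one]
  have hαρ : α = ρ ^ 2 * β := by rw [hρ2, div_mul_cancel₀ _ hβ0]
  have hρ1 : ρ ^ 2 ≠ 1 := by
    rw [hρ2]; intro h; exact hαβ ((div_eq_one_iff_eq hβ0).1 h)
  obtain ⟨N₁, N₂, t1, t2, hN⟩ := exists_hasTrace_of_norm_le hS hA (ζ := α / β)
    (by simp [hα, hβ]) (hle.trans_eq hζ.symm)
  obtain ⟨g₁, hg₁, e1⟩ := b.exists_conj_of_hasTrace hS hX hα hβ hρ h1 h2 hαρ hρ1 hκ t1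
  obtain ⟨g₂, hg₂, e2⟩ := b.exists_conj_of_hasTrace hS hX hα hβ hρ h1 h2 hαρ hρ1 hκ t2
  refine ⟨g₁, hg₁, g₂, hg₂, ?_⟩
  have e3 : g₂ * star X * star g₂ = star (g₂ * X * star g₂) := by
    simp only [star_mul, star_star, mul_assoc]
  have h1' := star_mul_eq_smul_of_unitary hX hα h1
  have h2' := star_mul_eq_smul_of_unitary hX hβ h2
  have hXp : X * blk S₁ S₂ 1 0 0 1 = blk S₁ S₂ 1 0 0 1 * X := by
    simp only [blk, mul_one, mul_zero, zero_mul, add_zero, mul_add, add_mul, ← mul_assoc, h1, h2]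
    simp only [mul_assoc, h1', h2', smul_mul_assoc, mul_smul_comm]
  have hpp : blk S₁ S₂ 1 0 0 1 * blk S₁ S₂ 1 0 0 1 = blk S₁ S₂ 1 0 0 1 := by simp [blk_mul hS]
  have hps : star (blk S₁ S₂ 1 0 0 1) = blk S₁ S₂ 1 0 0 1 := by simp [star_blk]
  have hXX : X * star X = 1 := Unitary.mul_star_self_of_mem hX
  have r1 := t1.right
  have r2 : blk S₁ S₂ 1 0 0 1 * star N₂ = star N₂ := by
    have := congrArg star t2.right
    rwa [star_mul, hps] at this
  rw [e3, e1, e2, star_add, star_smul, star_mul X, star_sub, star_one, hps, ← hN]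
  generalize blk S₁ S₂ 1 0 0 1 = p at *
  have c : β * ρ * star (β * ρ) = 1 := by
    rw [RCLike.star_def, Complex.mul_conj']; simp [hβ, hρ]
  generalize β * ρ = γ at *
  have k1 : N₁ * (1 - p) = 0 := by rw [mul_sub, mul_one, r1, sub_self]
  have k2 : (1 - p) * star N₂ = 0 := by rw [sub_mul, one_mul, r2, sub_self]
  have k3 : (1 - p) * (1 - p) = 1 - p := by
    simp only [mul_sub, sub_mul, mul_one, one_mul, hpp]; abel
  have k4 : X * (1 - p) = (1 - p) * X := by rw [mul_sub, sub_mul, mul_one, one_mul, hXp]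
  calc _ = (γ * star γ) • (N₁ * star N₂) + γ • (N₁ * (1 - p) * star X) +
        star γ • (X * ((1 - p) * star N₂)) + X * ((1 - p) * (1 - p)) * star X := by
          simp only [mul_add, add_mul, smul_mul_assoc, mul_smul_comm, mul_assoc, smul_smul, smul_add, mul_comm γ]
          abel
    _ = _ := by
      rw [c, k1, k2, k3, k4, mul_assoc, hXX]; simp

end KeyLemma

section Swindle

variable {E : Type*} [NormedAddCommGroup E] [InnerProductSpace ℂ E] [CompleteSpace E]

omit [CompleteSpace E] in
lemma exists_lp_diag {ι : Type*} [DecidableEq ι] (T : ι → E →L[ℂ] E) {c : ℝ} (hc : 0 ≤ c)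
    (hT : ∀ i, ‖T i‖ ≤ c) :
    ∃ M : lp (fun _ : ι => E) 2 →L[ℂ] lp (fun _ : ι => E) 2, ‖M‖ ≤ c ∧
      ∀ i x, M (lp.single 2 i x) = lp.single 2 i (T i x) := by
  have h2 : (0 : ℝ) < (2 : ℝ≥0∞).toReal := by norm_num
  have hle : ∀ (f : lp (fun _ : ι => E) 2) i, ‖T i (f i)‖ ^ (2 : ℝ≥0∞).toReal ≤
      c ^ (2 : ℝ≥0∞).toReal * ‖f i‖ ^ (2 : ℝ≥0∞).toReal := fun f i => by
    rw [← Real.mul_rpow hc (norm_nonneg _)]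
    gcongr
    exact ((T i).le_opNorm _).trans (by gcongr; exact hT i)
  have hsum : ∀ f : lp (fun _ : ι => E) 2, Summable fun i =>
      c ^ (2 : ℝ≥0∞).toReal * ‖f i‖ ^ (2 : ℝ≥0∞).toReal := fun f =>
    ((lp.memℓp f).summable h2).mul_left _
  have hmem : ∀ f : lp (fun _ : ι => E) 2, Memℓp (fun i => T i (f i)) 2 := fun f =>
    memℓp_gen (Summable.of_nonneg_of_le (fun i => by positivity) (hle f) (hsum f))
  let M : lp (fun _ : ι => E) 2 →ₗ[ℂ] lp (fun _ : ι => E) 2 :=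
    { toFun := fun f => ⟨fun i => T i (f i), hmem f⟩
      map_add' := fun f g => by ext i; simp; rfl
      map_smul' := fun a f => by ext i; simp }
  have hM : ∀ f, ‖M f‖ ≤ c * ‖f‖ := fun f => by
    refine lp.norm_le_of_tsum_le h2 (by positivity) ?_
    rw [Real.mul_rpow hc (norm_nonneg _), lp.norm_rpow_eq_tsum h2, ← tsum_mul_left]
    exact ((hmem f).summable h2).tsum_le_tsum (hle f) (hsum f)
  refine ⟨M.mkContinuous c hM, M.mkContinuous_norm_le hc hM, fun i x => ?_⟩
  ext j
  change T j ((lp.single 2 i x : lp (fun _ : ι => E) 2) j) = _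
  by_cases h : j = i
  · subst h; simp
  · simp [lp.single_apply, h]

lemma HilbertBasis.exists_linearIsometry (b : HilbertBasis ℕ ℂ E) {w : ℕ → E}
    (hw : Orthonormal ℂ w) : ∃ V : E →ₗᵢ[ℂ] E, ∀ n, V (b n) = w n := by
  refine ⟨hw.orthogonalFamily.linearIsometry.comp b.repr.toLinearIsometry, fun n => ?_⟩
  have := hw.orthogonalFamily.linearIsometry_apply_single (i := n) (1 : ℂ)
  simpa [b.repr_self] using this

lemma HilbertBasis.exists_unitary_reindex (b : HilbertBasis ℕ ℂ E) (σ : ℕ ≃ ℕ) :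
    ∃ W ∈ unitary (E →L[ℂ] E), ∀ n, W (b n) = b (σ n) := by
  obtain ⟨V, hV⟩ := b.exists_linearIsometry (b.orthonormal.comp σ σ.injective)
  obtain ⟨V', hV'⟩ := b.exists_linearIsometry (b.orthonormal.comp σ.symm σ.symm.injective)
  have h1 : star V.toContinuousLinearMap * V.toContinuousLinearMap = 1 :=
    isometry_of_inner V.inner_map_map
  have h2 : V.toContinuousLinearMap * V'.toContinuousLinearMap = 1 := b.clm_ext_s1 fun n => by
    simp [hV, hV']
  have h3 : V'.toContinuousLinearMap = star V.toContinuousLinearMap := by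
    rw [← one_mul V'.toContinuousLinearMap, ← h1, mul_assoc, h2, mul_one]
  exact ⟨V.toContinuousLinearMap, Unitary.mem_iff.2 ⟨h1, by rw [← h3, h2]⟩, hV⟩

/-- `E` splits as a sum of copies of itself indexed by `ℤ`, with a unitary shift and block
diagonal operators. -/
lemma HilbertBasis.exists_decomposition (b : HilbertBasis ℕ ℂ E) :
    ∃ V : ℤ → E →L[ℂ] E, (∀ i, star (V i) * V i = 1) ∧ (∀ i j, i ≠ j → star (V i) * V j = 0) ∧
      (∀ T S : E →L[ℂ] E, (∀ i, T * V i = S * V i) → T = S) ∧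
      (∃ W ∈ unitary (E →L[ℂ] E), ∀ i, W * V i = V (i + 1)) ∧
      ∀ (T : ℤ → E →L[ℂ] E) (c : ℝ), 0 ≤ c → (∀ i, ‖T i‖ ≤ c) →
        ∃ D : E →L[ℂ] E, ‖D‖ ≤ c ∧ ∀ i, D * V i = V i * T i := by
  obtain ⟨e⟩ : Nonempty (ℤ × ℕ ≃ ℕ) := nonempty_equiv_of_countable
  have hw : ∀ i, Orthonormal ℂ fun n => b (e (i, n)) := fun i =>
    b.orthonormal.comp _ fun m n h => by simpa using h
  choose V hV using fun i => b.exists_linearIsometry (hw i)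
  have hb : ∀ k, b k = V (e.symm k).1 (b (e.symm k).2) := fun k => by rw [hV]; simp
  have hext : ∀ T S : E →L[ℂ] E, (∀ i, T * (V i).toContinuousLinearMap =
      S * (V i).toContinuousLinearMap) → T = S := fun T S h => b.clm_ext_s1 fun k => by
    have := DFunLike.congr_fun (h (e.symm k).1) (b (e.symm k).2)
    simpa [← hb] using this
  have horth : ∀ i j, i ≠ j →
      star (V i).toContinuousLinearMap * (V j).toContinuousLinearMap = 0 := fun i j hij => by
    refine b.clm_ext_inner fun m n => ?_
    rw [ContinuousLinearMap.star_eq_adjoint, mul_apply_eq_comp,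
      ContinuousLinearMap.adjoint_inner_right]
    simp only [LinearIsometry.coe_toContinuousLinearMap, hV]
    simpa using b.orthonormal.2 fun h => hij (by simpa using congrArg Prod.fst (e.injective h))
  have hfam : OrthogonalFamily ℂ (fun _ : ℤ => E) V := fun i j hij x y => by
    have := DFunLike.congr_fun (horth i j hij) y
    rw [mul_apply_eq_comp, ContinuousLinearMap.star_eq_adjoint] at this
    have h2 := ContinuousLinearMap.adjoint_inner_right (V i).toContinuousLinearMap x
      ((V j).toContinuousLinearMap y)
    rw [this] at h2
    simpa using h2.symm
  have hsum : IsHilbertSum ℂ (fun _ : ℤ => E) V := by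
    refine IsHilbertSum.mk hfam ?_
    rw [← b.dense_span]
    refine Submodule.topologicalClosure_mono (Submodule.span_le.2 ?_)
    rintro _ ⟨k, rfl⟩
    rw [hb k]
    exact Submodule.mem_iSup_of_mem (e.symm k).1 ⟨_, rfl⟩
  refine ⟨fun i => (V i).toContinuousLinearMap, fun i => isometry_of_inner (V i).inner_map_map,
    horth, hext, ?_, ?_⟩
  · obtain ⟨W, hW, hWb⟩ := b.exists_unitary_reindex
      ((e.symm.trans ((Equiv.addRight (1 : ℤ)).prodCongr (Equiv.refl ℕ))).trans e)
    refine ⟨W, hW, fun i => b.clm_ext_s1 fun n => ?_⟩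
    simp [hV, hWb]
  · intro T c hc hT
    obtain ⟨M, hM, hMs⟩ := exists_lp_diag T hc hT
    let Φ := hsum.linearIsometryEquiv
    refine ⟨(Φ.symm.toLinearIsometry.toContinuousLinearMap.comp M).comp
      Φ.toLinearIsometry.toContinuousLinearMap, ?_, fun i => ?_⟩
    · refine ContinuousLinearMap.opNorm_le_bound _ hc fun x => ?_
      simp only [ContinuousLinearMap.comp_apply, LinearIsometry.coe_toContinuousLinearMap,
        LinearIsometry.norm_map]
      refine (M.le_opNorm _).trans ?_
      rw [LinearIsometry.norm_map]
      gcongr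
    · ext x
      have h1 : Φ (V i x) = lp.single 2 i x := by
        rw [← hsum.linearIsometryEquiv_symm_apply_single x]; exact Φ.apply_symm_apply _
      have h2 : Φ.symm (lp.single 2 i (T i x)) = V i (T i x) := by
        exact hsum.linearIsometryEquiv_symm_apply_single _
      simp [h1, hMs, h2]

end Swindle

section Diag

variable {A : Type*} [Ring A] [StarRing A] [Algebra ℂ A] [StarModule ℂ A]

/-- The operator `diag(x, w) ⊕ 1` with respect to `S₁`, `S₂`. -/
def diagBlk (S₁ S₂ x w : A) : A := blk S₁ S₂ x 0 0 w + (1 - blk S₁ S₂ 1 0 0 1)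

lemma diagBlk_mul {S₁ S₂ : A} (hS : OrthIsom S₁ S₂) (x w x' w' : A) :
    diagBlk S₁ S₂ x w * diagBlk S₁ S₂ x' w' = diagBlk S₁ S₂ (x * x') (w * w') := by
  simp only [diagBlk, mul_add, add_mul, mul_sub, sub_mul, mul_one, one_mul, blk_mul hS, mul_zero,
    zero_mul, add_zero, zero_add]
  abel

lemma star_diagBlk (S₁ S₂ x w : A) :
    star (diagBlk S₁ S₂ x w) = diagBlk S₁ S₂ (star x) (star w) := by
  simp [diagBlk, star_blk]

lemma diagBlk_one (S₁ S₂ : A) : diagBlk S₁ S₂ 1 1 = 1 := by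
  simp [diagBlk]

lemma diagBlk_mem_unitary {S₁ S₂ : A} (hS : OrthIsom S₁ S₂) {x w : A} (hx : x ∈ unitary A)
    (hw : w ∈ unitary A) : diagBlk S₁ S₂ x w ∈ unitary A := by
  rw [Unitary.mem_iff, star_diagBlk, diagBlk_mul hS, diagBlk_mul hS,
    Unitary.star_mul_self_of_mem hx, Unitary.star_mul_self_of_mem hw,
    Unitary.mul_star_self_of_mem hx, Unitary.mul_star_self_of_mem hw, diagBlk_one]
  exact ⟨rfl, rfl⟩

lemma diagBlk_eq (S₁ S₂ x : A) :
    diagBlk S₁ S₂ x 1 = S₁ * x * star S₁ + (1 - S₁ * star S₁) := by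
  simp only [diagBlk, blk, mul_zero, zero_mul, mul_one, add_zero]
  abel

end Diag

section Swindle

variable {E : Type*} [NormedAddCommGroup E] [InnerProductSpace ℂ E] [CompleteSpace E]

lemma norm_le_one_of_mem_unitary {u : E →L[ℂ] E} (hu : u ∈ unitary (E →L[ℂ] E)) : ‖u‖ ≤ 1 :=
  u.opNorm_le_bound zero_le_one fun x => by
    rw [one_mul, ContinuousLinearMap.norm_map_of_mem_unitary hu]

lemma norm_le_one_of_isometry {S : E →L[ℂ] E} (hS : star S * S = 1) : ‖S‖ ≤ 1 := by
  have h1 : ‖S‖ * ‖S‖ ≤ 1 := by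
    rw [← CStarRing.norm_star_mul_self, hS]; exact ContinuousLinearMap.norm_id_le
  nlinarith [norm_nonneg S]

/-- Every unitary `B`, suitably amplified, is a commutator of a unitary that is as close to `1`
as `B` is. -/
lemma HilbertBasis.exists_commutator (b : HilbertBasis ℕ ℂ E) {B : E →L[ℂ] E}
    (hB : B ∈ unitary (E →L[ℂ] E)) :
    ∃ W ∈ unitary (E →L[ℂ] E), ∃ D ∈ unitary (E →L[ℂ] E), ∃ Q : E →L[ℂ] E, star Q * Q = 1 ∧
      ‖1 - D‖ ≤ ‖1 - B‖ ∧
      W * D * star W * star D = Q * B * star Q + (1 - Q * star Q) := by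
  obtain ⟨V, hV1, hV0, hext, ⟨W, hW, hWV⟩, hdiag⟩ := b.exists_decomposition
  have hext' : ∀ T S : E →L[ℂ] E, (∀ i j, star (V j) * (T * V i) = star (V j) * (S * V i)) →
      T = S := by
    intro T S h
    refine hext T S fun i => star_injective (hext _ _ fun j => ?_)
    have := congrArg star (h i j)
    simpa [mul_assoc] using this
  let T : ℤ → E →L[ℂ] E := fun i => if i < 0 then B else 1
  have hT : ∀ i, T i ∈ unitary (E →L[ℂ] E) := fun i => by
    by_cases h : i < 0
    · simpa [T, h] using hB
    · simp [T, h, one_mem]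
  obtain ⟨D, -, hDV⟩ := hdiag T 1 zero_le_one fun i => norm_le_one_of_mem_unitary (hT i)
  obtain ⟨D', -, hDV'⟩ := hdiag (fun i => star (T i)) 1 zero_le_one
    fun i => norm_le_one_of_mem_unitary (Unitary.star_mem (hT i))
  obtain ⟨D'', hD'', hDV''⟩ := hdiag (fun i => 1 - T i) ‖1 - B‖ (norm_nonneg _) fun i => by
    by_cases h : i < 0 <;> simp [T, h]
  have h1 : star D * D = 1 := hext' _ _ fun i j => by
    have : star (V j) * (star D * D * V i) = star (T j) * (star (V j) * V i) * T i := by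
      rw [mul_assoc, hDV, ← mul_assoc, ← star_mul, hDV, star_mul]; simp only [mul_assoc]
    rw [this, one_mul]
    by_cases hij : j = i
    · subst hij
      rw [hV1, mul_one, Unitary.star_mul_self_of_mem (hT j)]
    · rw [hV0 j i hij, mul_zero, zero_mul]
  have h2 : D * D' = 1 := hext _ _ fun i => by
    rw [mul_assoc, hDV', ← mul_assoc, hDV, mul_assoc, Unitary.mul_star_self_of_mem (hT i),
      mul_one, one_mul]
  have h3 : D' = star D := by rw [← one_mul D', ← h1, mul_assoc, h2, mul_one]
  have h4 : 1 - D = D'' := hext _ _ fun i => by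
    rw [hDV'', sub_mul, mul_sub, one_mul, mul_one, hDV]
  have h5 : ∀ i, star W * V i = V (i - 1) := fun i => by
    have := hWV (i - 1)
    rw [sub_add_cancel] at this
    rw [← this, ← mul_assoc, Unitary.star_mul_self_of_mem hW, one_mul]
  refine ⟨W, hW, D, Unitary.mem_iff.2 ⟨h1, by rw [← h3, h2]⟩, V 0, hV1 0, h4 ▸ hD'', ?_⟩
  refine hext _ _ fun i => ?_
  have h6 : W * D * star W * star D * V i = V i * (T (i - 1) * star (T i)) := by
    rw [← h3]
    calc _ = W * (D * (star W * (D' * V i))) := by simp only [mul_assoc]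
      _ = W * (D * (star W * V i)) * star (T i) := by rw [hDV']; simp only [mul_assoc]
      _ = W * V (i - 1) * (T (i - 1) * star (T i)) := by rw [h5, hDV]; simp only [mul_assoc]
      _ = _ := by rw [hWV, sub_add_cancel]
  rw [h6, add_mul, sub_mul, mul_assoc (V 0), mul_assoc (V 0), mul_assoc (V 0), mul_assoc B]
  by_cases hi : i = 0
  · subst hi
    simp [T, hV1]
  · rw [hV0 0 i (Ne.symm hi)]
    have : T (i - 1) = T i := by
      simp only [T]
      exact if_congr (by omega) rfl rfl
    rw [this, Unitary.mul_star_self_of_mem (hT i)]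
    simp

/-- A unitary fixing an infinite-dimensional subspace pointwise is a conjugate of a commutator
involving a unitary of the form `diag(D, D*) ⊕ 1`. -/
lemma HilbertBasis.exists_eq_conj_commutator (b : HilbertBasis ℕ ℂ E) {S₁ S₂ R u : E →L[ℂ] E}
    (hS : OrthIsom S₁ S₂) (hu : u ∈ unitary (E →L[ℂ] E)) (hR : star R * R = 1)
    (huR : u * R = R) :
    ∃ D ∈ unitary (E →L[ℂ] E), ‖1 - D‖ ≤ ‖1 - u‖ ∧ ∃ W ∈ unitary (E →L[ℂ] E),
      ∃ g ∈ unitary (E →L[ℂ] E),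
        u = g * (W * diagBlk S₁ S₂ D (star D) * star W * star (diagBlk S₁ S₂ D (star D))) *
          star g := by
  have assoc : ∀ {x y z : E →L[ℂ] E}, x * y = z → ∀ w, x * (y * w) = z * w := fun h w => by
    rw [← mul_assoc, h]
  have hRa := assoc hR
  simp only [one_mul] at hRa
  obtain ⟨R₁, hR₁⟩ : ∃ R₁, R₁ = R * S₁ := ⟨_, rfl⟩
  have r1 : star R₁ * R₁ = 1 := by rw [hR₁, star_mul, mul_assoc, hRa, hS.one]
  have ur1 : u * R₁ = R₁ := by rw [hR₁, ← mul_assoc, huR]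
  have r1u : star R₁ * u = star R₁ := by
    simpa using star_mul_eq_smul_of_unitary hu (a := 1) (by simp) (by simpa using ur1)
  have r1a := assoc r1
  simp only [one_mul] at r1a
  obtain ⟨O, o1, o2⟩ := b.exists_isometry_range (Q := 1 - R₁ * star R₁) (by simp)
    (by simp only [mul_sub, sub_mul, mul_one, one_mul, mul_assoc, r1a]; abel)
    (b.not_isCompactOperator_of_compress (S₁ := R * S₂) (S₂ := 0) (by
      simp only [hR₁, star_mul, mul_sub, mul_one, mul_assoc, hRa, hS.orth'_assoc, hS.two,
        mul_zero, sub_zero, add_zero]))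
  have o1a := assoc o1
  simp only [one_mul] at o1a
  have oR : star O * R₁ = 0 := by
    have : star O * R₁ = star O * (O * star O) * R₁ := by rw [← mul_assoc, o1, one_mul]
    rw [this, o2, mul_assoc, sub_mul, one_mul, mul_assoc, r1, mul_one, sub_self, mul_zero]
  have Ro : star R₁ * O = 0 := by simpa using congrArg star oR
  have ou : O * star O * u = u * (O * star O) := by
    rw [o2, mul_sub, sub_mul, mul_one, one_mul, ← mul_assoc, ur1, mul_assoc, r1u]
  have uou : u * (O * star O) * star u = O * star O := by
    rw [← ou, mul_assoc, Unitary.mul_star_self_of_mem hu, mul_one]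
  have uou' : star u * (O * star O) * u = O * star O := by
    rw [mul_assoc, ou, ← mul_assoc, Unitary.star_mul_self_of_mem hu, one_mul]
  have hB : star O * u * O ∈ unitary (E →L[ℂ] E) := by
    rw [Unitary.mem_iff]
    constructor
    · calc _ = star O * (star u * (O * star O) * u) * O := by
            simp only [star_mul, star_star, mul_assoc]
        _ = 1 := by rw [uou', mul_assoc, mul_assoc, o1, mul_one, o1]
    · calc _ = star O * (u * (O * star O) * star u) * O := by
            simp only [star_mul, star_star, mul_assoc]
        _ = 1 := by rw [uou, mul_assoc, mul_assoc, o1, mul_one, o1]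
  have hBu : ‖1 - star O * u * O‖ ≤ ‖1 - u‖ := by
    have : 1 - star O * u * O = star O * (1 - u) * O := by
      rw [mul_sub, sub_mul, mul_one, o1]
    rw [this]
    have h1 := norm_le_one_of_isometry o1
    calc _ ≤ ‖star O‖ * ‖1 - u‖ * ‖O‖ := (norm_mul_le _ _).trans (by gcongr; exact norm_mul_le _ _)
      _ ≤ 1 * ‖1 - u‖ * 1 := by gcongr; rwa [norm_star]
      _ = _ := by ring
  have hdec : u = O * (star O * u * O) * star O + R₁ * star R₁ := by
    calc u = (O * star O + R₁ * star R₁) * u := by rw [o2]; simp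
      _ = (O * star O * (O * star O) + R₁ * star R₁) * u := by
        rw [mul_assoc O, ← mul_assoc (star O) O, o1, one_mul]
      _ = _ := by
        rw [add_mul, mul_assoc (O * star O), ou, mul_assoc R₁, r1u]
        simp only [mul_assoc]
  generalize star O * u * O = B at *
  obtain ⟨W, hW, D, hD, Q, hQ, hDB, hcomm⟩ := b.exists_commutator hB
  have hQa := assoc hQ
  simp only [one_mul] at hQa
  obtain ⟨N, hN⟩ : ∃ N, N = S₁ * Q := ⟨_, rfl⟩
  have n1 : star N * N = 1 := by rw [hN, star_mul, mul_assoc, hS.one_assoc, hQ]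
  have n1a := assoc n1
  simp only [one_mul] at n1a
  obtain ⟨M, m1, m2⟩ := b.exists_isometry_range (Q := 1 - N * star N) (by simp)
    (by simp only [mul_sub, sub_mul, mul_one, one_mul, mul_assoc, n1a]; abel)
    (b.not_isCompactOperator_of_compress (S₁ := S₂) (S₂ := 0) (by
      simp only [hN, star_mul, mul_sub, mul_one, mul_assoc, hS.orth'_assoc, hS.two, mul_zero,
        sub_zero, add_zero]))
  have m1a := assoc m1
  simp only [one_mul] at m1a
  have nm : star N * M = 0 := by
    have : star N * M = star N * (M * star M) * M := by rw [mul_assoc, mul_assoc, m1, mul_one]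
    rw [this, m2, mul_sub, mul_one, ← mul_assoc, n1, one_mul, sub_self, zero_mul]
  have mn : star M * N = 0 := by simpa using congrArg star nm
  have oRa := assoc oR
  have Roa := assoc Ro
  have nma := assoc nm
  have mna := assoc mn
  simp only [zero_mul] at oRa Roa nma mna
  refine ⟨D, hD, hDB.trans hBu, diagBlk S₁ S₂ W 1, diagBlk_mem_unitary hS hW (one_mem _),
    O * star N + R₁ * star M, ?_, ?_⟩
  · rw [Unitary.mem_iff]
    constructor
    · simp only [star_add, star_mul, star_star, mul_add, add_mul, mul_assoc, o1a, oRa, Roa, r1a,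
        mul_zero, add_zero, zero_add]
      rw [m2]; abel
    · simp only [star_add, star_mul, star_star, mul_add, add_mul, mul_assoc, n1a, nma, mna, m1a,
        mul_zero, add_zero, zero_add]
      rw [o2]; abel
  · have hc : diagBlk S₁ S₂ W 1 * diagBlk S₁ S₂ D (star D) * star (diagBlk S₁ S₂ W 1) *
        star (diagBlk S₁ S₂ D (star D)) = N * B * star N + M * star M := by
      rw [star_diagBlk, star_diagBlk, diagBlk_mul hS, diagBlk_mul hS, diagBlk_mul hS, hcomm,
        star_star, star_one, one_mul, mul_one, Unitary.star_mul_self_of_mem hD, diagBlk_eq, m2, hN]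
      simp only [star_mul, mul_add, add_mul, mul_sub, sub_mul, mul_one, mul_assoc]
      abel
    rw [hc]
    simp only [star_add, star_mul, star_star, mul_add, add_mul, mul_assoc, n1a, nma, mna, m1a,
        mul_zero, add_zero, zero_add]
    rw [← mul_assoc]
    exact hdec

end Swindle

section ConjSet

open scoped Pointwise

variable {A : Type*} [Monoid A] [StarMul A]

/-- The set of all unitary conjugates of `v` and of `star v`. -/
def conjSet (v : A) : Set A :=
  {x | ∃ g ∈ unitary A, x = g * v * star g ∨ x = g * star v * star g}

lemma self_mem_conjSet (v : A) : v ∈ conjSet v := ⟨1, one_mem _, Or.inl (by simp)⟩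

lemma star_mem_conjSet {v x : A} (hx : x ∈ conjSet v) : star x ∈ conjSet v := by
  obtain ⟨g, hg, rfl | rfl⟩ := hx
  · exact ⟨g, hg, Or.inr (by simp [mul_assoc])⟩
  · exact ⟨g, hg, Or.inl (by simp [mul_assoc])⟩

lemma conj_mem_conjSet {v x g : A} (hg : g ∈ unitary A) (hx : x ∈ conjSet v) :
    g * x * star g ∈ conjSet v := by
  obtain ⟨g', hg', rfl | rfl⟩ := hx
  · exact ⟨g * g', mul_mem hg hg', Or.inl (by simp [mul_assoc])⟩
  · exact ⟨g * g', mul_mem hg hg', Or.inr (by simp [mul_assoc])⟩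

lemma star_mem_conjSet_pow {v : A} {n : ℕ} : ∀ {x : A}, x ∈ conjSet v ^ n →
    star x ∈ conjSet v ^ n := by
  induction n with
  | zero => intro x hx; rw [pow_zero, Set.mem_one] at hx ⊢; simp [hx]
  | succ n ih =>
    intro x hx
    rw [pow_succ] at hx
    obtain ⟨y, hy, z, hz, rfl⟩ := hx
    rw [pow_succ']
    exact ⟨star z, star_mem_conjSet hz, star y, ih hy, by simp⟩

lemma conj_mem_conjSet_pow {v g : A} (hg : g ∈ unitary A) {n : ℕ} : ∀ {x : A},
    x ∈ conjSet v ^ n → g * x * star g ∈ conjSet v ^ n := by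
  induction n with
  | zero =>
    intro x hx
    rw [pow_zero, Set.mem_one] at hx ⊢
    simp [hx, Unitary.mul_star_self_of_mem hg]
  | succ n ih =>
    intro x hx
    rw [pow_succ] at hx ⊢
    obtain ⟨y, hy, z, hz, rfl⟩ := hx
    refine ⟨g * y * star g, ih hy, g * z * star g, conj_mem_conjSet hg hz, ?_⟩
    calc g * y * star g * (g * z * star g) = g * y * (star g * g) * z * star g := by
          simp only [mul_assoc]
      _ = g * (y * z) * star g := by
          rw [Unitary.star_mul_self_of_mem hg, mul_one]; simp only [mul_assoc]

lemma mul_mem_conjSet_pow {v x y : A} {n k : ℕ} (hx : x ∈ conjSet v ^ n)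
    (hy : y ∈ conjSet v ^ k) : x * y ∈ conjSet v ^ (n + k) := by
  rw [pow_add]; exact Set.mul_mem_mul hx hy

lemma conj_mul_conj_star_mem {v x g₁ g₂ : A} (hg₁ : g₁ ∈ unitary A) (hg₂ : g₂ ∈ unitary A)
    {n : ℕ} (hx : x ∈ conjSet v ^ n) :
    g₁ * x * star g₁ * (g₂ * star x * star g₂) ∈ conjSet v ^ (2 * n) := by
  rw [two_mul]
  exact mul_mem_conjSet_pow (conj_mem_conjSet_pow hg₁ hx)
    (conj_mem_conjSet_pow hg₂ (star_mem_conjSet_pow hx))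

lemma one_mem_conjSet_pow {v : A} (hv : v ∈ unitary A) (j : ℕ) : (1 : A) ∈ conjSet v ^ (2 * j) := by
  rw [pow_mul, pow_two, ← one_pow j]
  refine Set.pow_mem_pow ?_
  exact ⟨v, self_mem_conjSet v, star v, star_mem_conjSet (self_mem_conjSet v),
    Unitary.mul_star_self_of_mem hv⟩

lemma mem_conjSet_pow_of_le {v x : A} (hv : v ∈ unitary A) {k n : ℕ} (hkn : k ≤ n)
    (hx : x ∈ conjSet v ^ (2 * k)) : x ∈ conjSet v ^ (2 * n) := by
  obtain ⟨j, rfl⟩ := Nat.exists_eq_add_of_le hkn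
  rw [mul_add, ← mul_one x]
  exact mul_mem_conjSet_pow hx (one_mem_conjSet_pow hv j)

end ConjSet

section Exact

variable {E : Type*} [NormedAddCommGroup E] [InnerProductSpace ℂ E] [CompleteSpace E]

open scoped Pointwise

lemma pow_mul_eq_smul {v S : E →L[ℂ] E} {α : ℂ} (h : v * S = α • S) (k : ℕ) :
    v ^ k * S = α ^ k • S := by
  induction k with
  | zero => simp
  | succ k ih => rw [pow_succ, mul_assoc, h, mul_smul_comm, ih, smul_smul, ← pow_succ']

lemma HilbertBasis.mem_conjSet_pow_of_diagBlk (b : HilbertBasis ℕ ℂ E)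
    {S₁ S₂ R u v : E →L[ℂ] E} (hS : OrthIsom S₁ S₂) (hu : u ∈ unitary (E →L[ℂ] E))
    (hR : star R * R = 1) (huR : u * R = R) {n : ℕ}
    (hD : ∀ D ∈ unitary (E →L[ℂ] E), ‖1 - D‖ ≤ ‖1 - u‖ →
      diagBlk S₁ S₂ D (star D) ∈ conjSet v ^ n) :
    u ∈ conjSet v ^ (2 * n) := by
  obtain ⟨D, hDu, hle, W, hW, g, hg, h⟩ := b.exists_eq_conj_commutator hS hu hR huR
  have h1 := conj_mul_conj_star_mem hW (one_mem (unitary (E →L[ℂ] E))) (hD D hDu hle)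
  rw [star_one, one_mul, mul_one] at h1
  rw [h]
  exact conj_mem_conjSet_pow hg h1

lemma HilbertBasis.mem_conjSet_pow_of_eigen (b : HilbertBasis ℕ ℂ E)
    {S₁ S₂ R u v : E →L[ℂ] E} (hS : OrthIsom S₁ S₂) (hu : u ∈ unitary (E →L[ℂ] E))
    (hv : v ∈ unitary (E →L[ℂ] E)) (hR : star R * R = 1) (huR : u * R = R) {α β : ℂ}
    (hα : ‖α‖ = 1) (hβ : ‖β‖ = 1) (h1 : v * S₁ = α • S₁) (h2 : v * S₂ = β • S₂) {N : ℕ}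
    (h : (∃ k ≤ N, √2 ≤ ‖α ^ k - β ^ k‖) ∨ ‖1 - u‖ ≤ ‖α ^ N - β ^ N‖) :
    u ∈ conjSet v ^ (8 * N) := by
  have hpow : ∀ k, v ^ k ∈ conjSet v ^ k := fun k => Set.pow_mem_pow (self_mem_conjSet v)
  rcases h with ⟨k, hk, hle⟩ | hle
  · have hne : α ^ k ≠ β ^ k := by
      intro h0
      rw [h0, sub_self, norm_zero] at hle
      exact absurd hle (by simp)
    have hI : (Complex.I • 1 : E →L[ℂ] E) ∈ unitary (E →L[ℂ] E) := by
      rw [Unitary.mem_iff, star_smul]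
      simp [smul_smul]
    have hnI : ‖(1 : E →L[ℂ] E) - Complex.I • 1‖ ≤ √2 := by
      have : (1 : E →L[ℂ] E) - Complex.I • 1 = (1 - Complex.I) • 1 := by rw [sub_smul, one_smul]
      rw [this, norm_smul]
      have h2 : ‖(1 : ℂ) - Complex.I‖ = √2 := by
        rw [Complex.norm_def, Complex.normSq_apply]
        norm_num
      rw [h2]
      exact mul_le_of_le_one_right (Real.sqrt_nonneg 2) ContinuousLinearMap.norm_id_le
    obtain ⟨g₁, hg₁, g₂, hg₂, hY⟩ := b.exists_conj_mul_conj_eq_blk hS (pow_mem hv k)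
      (by simp [hα]) (by simp [hβ]) hne (pow_mul_eq_smul h1 k) (pow_mul_eq_smul h2 k) hI
      (hnI.trans hle)
    have hYm := conj_mul_conj_star_mem hg₁ hg₂ (hpow k)
    rw [hY] at hYm
    have hYm' : diagBlk S₁ S₂ (Complex.I • 1) (star (Complex.I • 1)) ∈ conjSet v ^ (2 * k) := hYm
    have e1 : diagBlk S₁ S₂ (Complex.I • 1) (star (Complex.I • 1)) * S₁ = Complex.I • S₁ := by
      simp only [diagBlk, blk, mul_zero, zero_mul, add_zero, add_mul, sub_mul, mul_assoc, hS.one,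
        hS.orth', mul_one, one_mul]
      simp
    have e2 : diagBlk S₁ S₂ (Complex.I • 1) (star (Complex.I • 1)) * S₂ =
        (-Complex.I) • S₂ := by
      simp only [diagBlk, blk, mul_zero, zero_mul, add_zero, zero_add, add_mul, sub_mul,
        mul_assoc, hS.two, hS.orth, mul_one, one_mul]
      simp
    have hmem := b.mem_conjSet_pow_of_diagBlk (v := v) (n := 2 * (2 * k)) hS hu hR huR
      fun D hD _ => by
        obtain ⟨g₃, hg₃, g₄, hg₄, hZ⟩ := b.exists_conj_mul_conj_eq_blk (A := D) hS
          (diagBlk_mem_unitary hS hI (Unitary.star_mem hI))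
          (by simp) (by simp) (by
            intro h0
            have := congrArg Complex.im h0
            norm_num at this) e1 e2 hD (by
            have h3 : ‖Complex.I - -Complex.I‖ = 2 := by
              rw [sub_neg_eq_add, ← two_mul]; simp
            rw [h3]
            refine (norm_sub_le _ _).trans ?_
            have h4 : ‖(1 : E →L[ℂ] E)‖ ≤ 1 := ContinuousLinearMap.norm_id_le
            linarith [norm_le_one_of_mem_unitary hD])
        have := conj_mul_conj_star_mem hg₃ hg₄ hYm'
        rw [hZ] at this
        exact this
    have h8 : 8 * N = 2 * (4 * N) := by ring
    rw [h8]
    refine mem_conjSet_pow_of_le hv (k := 2 * (2 * k)) (by omega) ?_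
    exact hmem
  · by_cases hne : α ^ N = β ^ N
    · have h8 : 8 * N = 2 * (4 * N) := by ring
      rw [hne, sub_self, norm_zero] at hle
      rw [← sub_eq_zero.1 (norm_le_zero_iff.1 hle), h8]
      exact one_mem_conjSet_pow hv _
    have hmem := b.mem_conjSet_pow_of_diagBlk (v := v) (n := 2 * N) hS hu hR huR
      fun D hD hDu => by
        obtain ⟨g₃, hg₃, g₄, hg₄, hZ⟩ := b.exists_conj_mul_conj_eq_blk (A := D) hS (pow_mem hv N)
          (by simp [hα]) (by simp [hβ]) hne (pow_mul_eq_smul h1 N) (pow_mul_eq_smul h2 N) hD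
          (hDu.trans hle)
        have := conj_mul_conj_star_mem hg₃ hg₄ (hpow N)
        rw [hZ] at this
        exact this
    have h8 : 8 * N = 2 * (4 * N) := by ring
    rw [h8]
    exact mem_conjSet_pow_of_le hv (k := 2 * N) (by omega) hmem

end Exact

section Numbers

lemma norm_one_sub_pow_large {ζ : ℂ} (hζ : ‖ζ‖ = 1) {δ : ℝ} (h : δ ≤ ‖1 - ζ‖)
    (m : ℕ) : (∃ k ≤ 16 * m, √2 ≤ ‖1 - ζ ^ k‖) ∨ 5 * m * δ ≤ ‖1 - ζ ^ (16 * m)‖ := by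
  rw [or_iff_not_imp_left]
  intro hno
  push Not at hno
  have hsq : ∀ z : ℂ, ‖z‖ = 1 → ‖1 - z‖ ^ 2 = 2 - 2 * z.re := fun z hz => by
    have h1 : z.re * z.re + z.im * z.im = 1 := by
      rw [← Complex.normSq_apply, Complex.normSq_eq_norm_sq, hz, one_pow]
    rw [Complex.sq_norm, Complex.normSq_apply]
    simp only [Complex.sub_re, Complex.one_re, Complex.sub_im, Complex.one_im]
    linarith
  have hpos : ∀ k ≤ 16 * m, 0 < (ζ ^ k).re := fun k hk => by
    have h1 := hsq (ζ ^ k) (by simp [hζ])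
    have h2 := hno k hk
    have h3 : ‖1 - ζ ^ k‖ ^ 2 < 2 := by
      rw [← Real.sq_sqrt (zero_le_two (α := ℝ))]
      gcongr
    linarith
  have hbig : ∀ k < 8 * m, 0.7 ≤ (ζ ^ k).re := fun k hk => by
    have h1 := hpos k (by omega)
    have h2 := hpos (k + k) (by omega)
    have h3 : ‖ζ ^ k‖ = 1 := by simp [hζ]
    have h4 : (ζ ^ k).re * (ζ ^ k).re + (ζ ^ k).im * (ζ ^ k).im = 1 := by
      rw [← Complex.normSq_apply, Complex.normSq_eq_norm_sq, h3, one_pow]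
    rw [pow_add, Complex.mul_re] at h2
    by_contra! h5
    nlinarith
  have hsum : 5 * (m : ℝ) ≤ (∑ j ∈ Finset.range (16 * m), ζ ^ j).re := by
    rw [Complex.re_sum, show 16 * m = 8 * m + 8 * m by ring, Finset.sum_range_add]
    have h1 : ∑ _x ∈ Finset.range (8 * m), (0.7 : ℝ) ≤ ∑ x ∈ Finset.range (8 * m), (ζ ^ x).re :=
      Finset.sum_le_sum fun k hk => hbig k (Finset.mem_range.1 hk)
    have h2 : 0 ≤ ∑ x ∈ Finset.range (8 * m), (ζ ^ (8 * m + x)).re :=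
      Finset.sum_nonneg fun k hk => (hpos _ (by have := Finset.mem_range.1 hk; omega)).le
    rw [Finset.sum_const, Finset.card_range, nsmul_eq_mul] at h1
    push_cast at h1
    have : (0 : ℝ) ≤ m := Nat.cast_nonneg m
    linarith
  rw [← mul_neg_geom_sum, norm_mul, mul_comm]
  exact mul_le_mul h (hsum.trans (Complex.re_le_norm _)) (by positivity) (norm_nonneg _)

lemma pow_sub_pow_large {α β : ℂ} (hα : ‖α‖ = 1) (hβ : ‖β‖ = 1) {δ : ℝ}
    (h : δ ≤ ‖α - β‖) (m : ℕ) :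
    (∃ k ≤ 16 * m, √2 ≤ ‖α ^ k - β ^ k‖) ∨ 5 * m * δ ≤ ‖α ^ (16 * m) - β ^ (16 * m)‖ := by
  have hα0 : α ≠ 0 := by intro h0; simp [h0] at hα
  have key : ∀ k, ‖α ^ k - β ^ k‖ = ‖1 - (β / α) ^ k‖ := fun k => by
    rw [div_pow, one_sub_div (pow_ne_zero k hα0), norm_div, norm_pow, hα, one_pow, div_one]
  have := norm_one_sub_pow_large (ζ := β / α) (by simp [hα, hβ])
    (by simpa using h.trans_eq (by simpa using key 1)) m
  simpa only [key] using this

end Numbers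

section EssentialSpectrum

variable {E : Type*} [NormedAddCommGroup E] [InnerProductSpace ℂ E] [CompleteSpace E]

/-- `α` is an approximate eigenvalue of `v` off every finite-dimensional subspace. -/
def IsEssApproxEigenvalue (v : E →L[ℂ] E) (α : ℂ) : Prop :=
  ∀ K : Submodule ℂ E, FiniteDimensional ℂ K → ∀ ε > (0 : ℝ),
    ∃ x ∈ Kᗮ, ‖x‖ = 1 ∧ ‖v x - α • x‖ ≤ ε

/-- The radial retraction of continuous functions onto the ball of radius `r`. -/
lemma ContinuousMap.exists_truncation {X : Type*} [TopologicalSpace X] [CompactSpace X]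
    (f : C(X, ℂ)) {r : ℝ} (hr : 0 < r) :
    ∃ g : C(X, ℂ), ‖g‖ ≤ r ∧ ∀ x, ‖f x‖ ≤ r → g x = f x := by
  have hpos : ∀ x, 0 < max r ‖f x‖ := fun x => hr.trans_le (le_max_left _ _)
  refine ⟨⟨fun x => f x * ((r / max r ‖f x‖ : ℝ) : ℂ), ?_⟩, ?_, fun x hx => ?_⟩
  · refine f.continuous.mul (Complex.continuous_ofReal.comp ?_)
    exact continuous_const.div (by fun_prop) fun x => (hpos x).ne'
  · refine (ContinuousMap.norm_le _ hr.le).2 fun x => ?_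
    rw [ContinuousMap.coe_mk, norm_mul, Complex.norm_real, Real.norm_of_nonneg
      (div_nonneg hr.le (hpos x).le), mul_div_assoc', div_le_iff₀ (hpos x), mul_comm]
    gcongr
    exact le_max_right _ _
  · simp [max_eq_left hx, hr.ne']

lemma exists_orthogonal_of_not_isCompactOperator {F : E →L[ℂ] E} (hF : ¬ IsCompactOperator F)
    (K : Submodule ℂ E) [FiniteDimensional ℂ K] : ∃ y, F y ∈ Kᗮ ∧ F y ≠ 0 := by
  by_contra! h
  refine hF ?_
  let P : LinearMap.range (F : E →ₗ[ℂ] E) →ₗ[ℂ] K :=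
    (K.orthogonalProjectionOnto : E →ₗ[ℂ] K) ∘ₗ Submodule.subtype _
  have hP : Function.Injective P := by
    rw [← LinearMap.ker_eq_bot, LinearMap.ker_eq_bot']
    rintro ⟨_, y, rfl⟩ hy
    have h1 : F y ∈ Kᗮ := by
      rw [← Submodule.orthogonalProjectionOnto_eq_zero_iff]
      exact hy
    exact Subtype.ext (h y h1)
  have : FiniteDimensional ℂ (LinearMap.range (F : E →ₗ[ℂ] E)) :=
    Module.Finite.of_injective P hP
  exact isCompactOperator_of_range_le (LinearMap.range (F : E →ₗ[ℂ] E)) F fun x => ⟨x, rfl⟩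

/-- The essential spectrum of a normal operator. -/
lemma exists_essentialSpectrum {v : E →L[ℂ] E} (hv : IsStarNormal v) :
    ∃ S : Set (spectrum ℂ v),
      (∀ f : C(spectrum ℂ v, ℂ), (∀ x ∈ S, f x = 0) →
        IsCompactOperator (cfcHom (R := ℂ) hv f)) ∧
      ∀ α ∈ S, IsEssApproxEigenvalue v (α : ℂ) := by
  let I : Ideal C(spectrum ℂ v, ℂ) :=
    { carrier := {f | IsCompactOperator (cfcHom (R := ℂ) hv f)}
      add_mem' := fun {f g} hf hg => by
        simp only [Set.mem_ofPred_eq, map_add] at *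
        exact hf.add hg
      zero_mem' := by
        simp only [Set.mem_ofPred_eq, map_zero]
        exact isCompactOperator_zero
      smul_mem' := fun c f hf => by
        simp only [Set.mem_ofPred_eq, smul_eq_mul, map_mul] at *
        exact hf.clm_comp (cfcHom (R := ℂ) hv c) }
  have hI : IsClosed (I : Set C(spectrum ℂ v, ℂ)) :=
    isClosed_setOfPred_isCompactOperator.preimage (cfcHom_continuous hv)
  refine ⟨(ContinuousMap.setOfIdeal I)ᶜ, fun f hf => ?_, fun α hα => ?_⟩
  · have : f ∈ ContinuousMap.idealOfSet ℂ (ContinuousMap.setOfIdeal I) :=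
      ContinuousMap.mem_idealOfSet.2 fun x hx => hf x hx
    rw [ContinuousMap.idealOfSet_ofIdeal_isClosed hI] at this
    exact this
  · intro K _ r hr
    have hα' := ContinuousMap.notMem_setOfIdeal.1 hα
    let f : C(spectrum ℂ v, ℂ) :=
      ⟨fun z => ((max 0 (1 - ‖(z : ℂ) - α‖ / r) : ℝ) : ℂ), by fun_prop⟩
    have hf : f ∉ I := fun hfI => by
      have := hα' hfI
      simp [f] at this
    obtain ⟨y, hy, hy0⟩ := exists_orthogonal_of_not_isCompactOperator
      (F := cfcHom (R := ℂ) hv f) hf K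
    let idf : C(spectrum ℂ v, ℂ) := (ContinuousMap.id ℂ).restrict (spectrum ℂ v)
    have hid : cfcHom (R := ℂ) hv idf = v := cfcHom_id hv
    obtain ⟨g, hg, hgf⟩ := (idf - algebraMap ℂ _ (α : ℂ)).exists_truncation hr
    have hmul : (idf - algebraMap ℂ _ (α : ℂ)) * f = g * f := by
      ext z
      by_cases hz : ‖(z : ℂ) - α‖ ≤ r
      · have := hgf z (by simpa [idf] using hz)
        simp only [ContinuousMap.mul_apply, this]
      · have : f z = 0 := by
          have : 1 ≤ ‖(z : ℂ) - α‖ / r := (one_le_div hr).2 (not_le.1 hz).le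
          simp only [f, ContinuousMap.coe_mk]
          rw [max_eq_left (by linarith), Complex.ofReal_zero]
        simp only [ContinuousMap.mul_apply, this, mul_zero]
    have hop := congrArg (cfcHom (R := ℂ) hv) hmul
    rw [map_mul, map_mul, map_sub, hid, AlgHomClass.commutes] at hop
    set F := cfcHom (R := ℂ) hv f
    have hbd : ‖v (F y) - (α : ℂ) • F y‖ ≤ r * ‖F y‖ := by
      have h1 : v (F y) - (α : ℂ) • F y = cfcHom (R := ℂ) hv g (F y) := by
        have := congrArg (fun T : E →L[ℂ] E => T y) hop
        simpa [Algebra.algebraMap_eq_smul_one, mul_apply_eq_comp] using this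
      rw [h1]
      refine (ContinuousLinearMap.le_opNorm _ _).trans ?_
      gcongr
      rw [norm_cfcHom v g hv]
      exact hg
    have hn : 0 < ‖F y‖ := norm_pos_iff.2 hy0
    have hc : ‖((‖F y‖ : ℂ)⁻¹)‖ = ‖F y‖⁻¹ := by simp
    refine ⟨(‖F y‖ : ℂ)⁻¹ • F y, Submodule.smul_mem _ _ hy, ?_, ?_⟩
    · rw [norm_smul, hc, inv_mul_cancel₀ hn.ne']
    · rw [map_smul, smul_comm (α : ℂ), ← smul_sub, norm_smul, hc, inv_mul_le_iff₀ hn, mul_comm]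
      exact hbd

lemma HilbertBasis.exists_isEssApproxEigenvalue (b : HilbertBasis ℕ ℂ E) {v : E →L[ℂ] E}
    (hv : IsStarNormal v) : ∃ α ∈ spectrum ℂ v, IsEssApproxEigenvalue v α := by
  obtain ⟨S, hS, hS'⟩ := exists_essentialSpectrum hv
  by_contra! h
  refine b.not_isCompactOperator_one ?_
  have := hS 1 fun x hx => absurd (hS' x hx) (h x x.2)
  rwa [map_one] at this

lemma HilbertBasis.exists_isEssApproxEigenvalue_pair (b : HilbertBasis ℕ ℂ E) {v : E →L[ℂ] E}
    (hv : v ∈ unitary (E →L[ℂ] E)) {δ : ℝ} (hδ : 0 < δ)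
    (h : ∀ c : ℂ, ‖c‖ = 1 →
      δ < Metric.infDist (1 - c • v) {k : E →L[ℂ] E | IsCompactOperator k}) :
    ∃ α β : ℂ, ‖α‖ = 1 ∧ ‖β‖ = 1 ∧ δ ≤ ‖α - β‖ ∧ IsEssApproxEigenvalue v α ∧
      IsEssApproxEigenvalue v β := by
  have hn : IsStarNormal v := isStarNormal_of_mem_unitary hv
  have hnorm : ∀ z ∈ spectrum ℂ v, ‖z‖ = 1 := fun z hz => (unitary_spectrum_bound hv hz).1
  obtain ⟨α, hα, hαe⟩ := b.exists_isEssApproxEigenvalue hn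
  obtain ⟨S, hS, hS'⟩ := exists_essentialSpectrum hn
  by_cases hβ : ∃ β ∈ S, δ ≤ ‖α - β‖
  · obtain ⟨β, hβS, hle⟩ := hβ
    exact ⟨α, β, hnorm α hα, hnorm β β.2, hle, hαe, hS' β hβS⟩
  · exfalso
    push Not at hβ
    have hα1 := hnorm α hα
    have hcα : starRingEnd ℂ α * α = 1 := by
      rw [← Complex.normSq_eq_conj_mul_self, Complex.normSq_eq_norm_sq, hα1]; simp
    let idf : C(spectrum ℂ v, ℂ) := (ContinuousMap.id ℂ).restrict (spectrum ℂ v)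
    have hid : cfcHom (R := ℂ) hn idf = v := cfcHom_id hn
    let f : C(spectrum ℂ v, ℂ) := 1 - starRingEnd ℂ α • idf
    obtain ⟨g, hg, hgf⟩ := f.exists_truncation hδ
    have hfS : ∀ x ∈ S, (f - g) x = 0 := fun x hx => by
      rw [ContinuousMap.sub_apply, hgf, sub_self]
      have h1 : f x = starRingEnd ℂ α * (α - x) := by
        simp [f, idf, mul_sub, hcα]
      rw [h1, norm_mul, RCLike.norm_conj, hα1, one_mul]
      exact (hβ x hx).le
    have hk := hS (f - g) hfS
    have h2 := Metric.infDist_le_dist_of_mem (x := 1 - starRingEnd ℂ α • v)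
      (s := {k : E →L[ℂ] E | IsCompactOperator k}) hk
    have h3 : cfcHom (R := ℂ) hn f = 1 - starRingEnd ℂ α • v := by
      simp only [f, map_sub, map_one, map_smul, hid]
    rw [map_sub, h3, dist_eq_norm, sub_sub_cancel, norm_cfcHom v g hn] at h2
    exact absurd (h (starRingEnd ℂ α) (by rw [RCLike.norm_conj, hα1])) (not_lt.2 (h2.trans hg))

end EssentialSpectrum

section Perturbation

variable {E : Type*} [NormedAddCommGroup E] [InnerProductSpace ℂ E] [CompleteSpace E]

/-- The inverse square root of a positive operator `K` close to `1`, written as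
`1 + G * (1 - K)`. -/
lemma exists_inv_sqrt {K : E →L[ℂ] E} (hK : IsSelfAdjoint K) (h : ‖1 - K‖ ≤ 1 / 2) :
    ∃ G : E →L[ℂ] E, star G = G ∧ Commute G K ∧ ‖G‖ ≤ 2 ∧
      (1 + G * (1 - K)) * K * (1 + G * (1 - K)) = 1 := by
  have hsp : ∀ x : spectrum ℝ K, 1 / 2 ≤ (x : ℝ) := fun x => by
    have h2 : 1 - (x : ℝ) ∈ spectrum ℝ (1 - K) := by
      have h3 := spectrum.singleton_sub_eq K (1 : ℝ)
      rw [map_one] at h3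
      rw [← h3]
      exact Set.sub_mem_sub rfl x.2
    have h4 := (spectrum.norm_le_norm_mul_of_mem h2).trans
      (mul_le_of_le_one_right (norm_nonneg _) ContinuousLinearMap.norm_id_le)
    have := (le_abs_self _).trans (h4.trans h)
    linarith
  have hpos : ∀ x : spectrum ℝ K, 0 < √(x : ℝ) := fun x => Real.sqrt_pos.2 (by linarith [hsp x])
  let idf : C(spectrum ℝ K, ℝ) := (ContinuousMap.id ℝ).restrict (spectrum ℝ K)
  have hid : cfcHom (R := ℝ) hK idf = K := cfcHom_id hK
  let g : C(spectrum ℝ K, ℝ) := ⟨fun x => 1 / (√x * (1 + √x)),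
    continuous_const.div (by fun_prop) fun x => by have := hpos x; positivity⟩
  have hprod : (1 + g * (1 - idf)) * idf * (1 + g * (1 - idf)) = 1 := by
    ext x
    have h1 := hpos x
    have h2 : √(x : ℝ) ^ 2 = x := Real.sq_sqrt (by linarith [hsp x])
    have h3 : 1 + 1 / (√(x : ℝ) * (1 + √x)) * (1 - x) = 1 / √x := by
      field_simp
      nlinarith
    have h4 : ((1 + g * (1 - idf)) * idf * (1 + g * (1 - idf))) x =
        (1 + 1 / (√(x : ℝ) * (1 + √x)) * (1 - x)) * x *
          (1 + 1 / (√(x : ℝ) * (1 + √x)) * (1 - x)) := rfl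
    rw [h4, h3, ContinuousMap.one_apply]
    nth_rewrite 2 [← h2]
    field_simp
  refine ⟨cfcHom (R := ℝ) hK g, ?_, ?_, ?_, ?_⟩
  · rw [← map_star]
    congr 1
  · have := congrArg (cfcHom (R := ℝ) hK) (mul_comm g idf)
    rwa [map_mul, map_mul, hid] at this
  · rw [norm_cfcHom K g hK]
    refine (ContinuousMap.norm_le _ zero_le_two).2 fun x => ?_
    have h1 : 1 / 2 ≤ √(x : ℝ) := Real.le_sqrt_of_sq_le (by linarith [hsp x])
    have h2 : g x = 1 / (√(x : ℝ) * (1 + √x)) := rfl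
    rw [h2, Real.norm_of_nonneg (by positivity), div_le_iff₀ (by positivity)]
    nlinarith
  · have := congrArg (cfcHom (R := ℝ) hK) hprod
    simpa only [map_mul, map_add, map_sub, map_one, hid] using this

lemma hsSq_add_le_of_le (b : HilbertBasis ℕ ℂ E) {S T : E →L[ℂ] E} {r s : ℝ≥0∞}
    (hS : hsSq b S ≤ r) (hT : hsSq b T ≤ s) : hsSq b (S + T) ≤ 2 * (r + s) :=
  (hsSq_add_le b S T).trans (by gcongr)

lemma hsSq_mul_le_of_norm_le (b : HilbertBasis ℕ ℂ E) {S T : E →L[ℂ] E} {r : ℝ≥0∞} {c : ℕ}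
    (hS : ‖S‖ ≤ c) (hT : hsSq b T ≤ r) : hsSq b (S * T) ≤ c ^ 2 * r := by
  refine (hsSq_mul_le_left b S T).trans ?_
  have : ‖S‖ₑ ≤ c := by
    rw [← ofReal_norm, ← ENNReal.ofReal_natCast]
    exact ENNReal.ofReal_le_ofReal hS
  gcongr

lemma HilbertBasis.exists_unitary_near_of_almost_eigen (b : HilbertBasis ℕ ℂ E) {v S₁ S₂ : E →L[ℂ] E}
    (hS : OrthIsom S₁ S₂) (hv : v ∈ unitary (E →L[ℂ] E)) {α β : ℂ} (hα : ‖α‖ = 1)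
    (hβ : ‖β‖ = 1) {ρ : ℝ≥0∞} (h1 : hsSq b (v * S₁ - α • S₁) ≤ ρ)
    (h2 : hsSq b (v * S₂ - β • S₂) ≤ ρ) (hρ : 640 * ρ ≤ 1) :
    ∃ v₁ ∈ unitary (E →L[ℂ] E), v₁ * S₁ = α • S₁ ∧ v₁ * S₂ = β • S₂ ∧
      hsSq b (v - v₁) ≤ 6000 * ρ := by
  have hαα : starRingEnd ℂ α * α = 1 := by
    rw [← Complex.normSq_eq_conj_mul_self, Complex.normSq_eq_norm_sq, hα]; simp
  have hββ : starRingEnd ℂ β * β = 1 := by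
    rw [← Complex.normSq_eq_conj_mul_self, Complex.normSq_eq_norm_sq, hβ]; simp
  have hvv := Unitary.star_mul_self_of_mem hv
  have hv1 := norm_le_one_of_mem_unitary hv
  have hdual : ∀ (S : E →L[ℂ] E) (γ : ℂ), ‖γ‖ = 1 → starRingEnd ℂ γ * γ = 1 →
      hsSq b (v * S - γ • S) ≤ ρ → hsSq b (star S * v - γ • star S) ≤ ρ := by
    intro S γ hγ hγγ h
    have e1 : star S * v - γ • star S = star (starRingEnd ℂ γ • (star v * -(v * S - γ • S))) := by
      simp only [mul_neg, mul_sub, ← mul_assoc, hvv, one_mul, mul_smul_comm, star_smul, star_neg,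
        star_sub, star_mul, star_star, smul_neg, smul_sub, smul_smul]
      have e2 : star γ * star (starRingEnd ℂ γ) = 1 := by simpa using hγγ
      rw [e2]
      simp
    rw [e1, hsSq_star, hsSq_smul]
    have e3 : ‖starRingEnd ℂ γ‖ₑ = 1 := by
      rw [← ofReal_norm, RCLike.norm_conj, hγ, ENNReal.ofReal_one]
    rw [e3, one_pow, one_mul]
    refine (hsSq_mul_le_of_norm_le_one b (by rwa [norm_star]) _).trans ?_
    rwa [neg_sub, hsSq_sub_comm]
  have h1' := hdual S₁ α hα hαα h1
  have h2' := hdual S₂ β hβ hββ h2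
  have n1 := norm_le_one_of_isometry hS.one
  have n2 := norm_le_one_of_isometry hS.two
  have n1s : ‖star S₁‖ ≤ 1 := by rwa [norm_star]
  have n2s : ‖star S₂‖ ≤ 1 := by rwa [norm_star]
  obtain ⟨q, hq⟩ : ∃ q, q = 1 - (S₁ * star S₁ + S₂ * star S₂) := ⟨_, rfl⟩
  have qs : star q = q := by simp [hq]
  have qS1 : q * S₁ = 0 := by
    simp only [hq, sub_mul, add_mul, one_mul, mul_assoc, hS.one, hS.orth', mul_one, mul_zero,
      add_zero, sub_self]
  have qS2 : q * S₂ = 0 := by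
    simp only [hq, sub_mul, add_mul, one_mul, mul_assoc, hS.two, hS.orth, mul_one, mul_zero,
      zero_add, sub_self]
  have S1q : star S₁ * q = 0 := by rw [← qs, ← star_mul, qS1, star_zero]
  have S2q : star S₂ * q = 0 := by rw [← qs, ← star_mul, qS2, star_zero]
  have qq : q * q = q := by
    nth_rewrite 2 [hq]
    rw [mul_sub, mul_one, mul_add, ← mul_assoc, ← mul_assoc, qS1, qS2]
    simp
  have nq : ‖q‖ ≤ 1 := by
    have : ‖q‖ * ‖q‖ = ‖q‖ := by rw [← CStarRing.norm_star_mul_self, qs, qq]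
    by_contra! hlt
    nlinarith
  obtain ⟨T, hT⟩ : ∃ T, T = α • (S₁ * star S₁) + β • (S₂ * star S₂) + q * v * q := ⟨_, rfl⟩
  have TS1 : T * S₁ = α • S₁ := by
    simp only [hT, add_mul, smul_mul_assoc, mul_assoc, hS.one, hS.orth', qS1, mul_one, mul_zero,
      smul_zero, add_zero]
  have TS2 : T * S₂ = β • S₂ := by
    simp only [hT, add_mul, smul_mul_assoc, mul_assoc, hS.two, hS.orth, qS2, mul_one, mul_zero,
      smul_zero, add_zero, zero_add]
  have Ts : star T = starRingEnd ℂ α • (S₁ * star S₁) + starRingEnd ℂ β • (S₂ * star S₂) +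
      q * star v * q := by
    simp only [hT, star_add, star_smul, star_mul, star_star, qs, mul_assoc]
    rfl
  have KS1 : star T * T * S₁ = S₁ := by
    rw [mul_assoc, TS1, mul_smul_comm, Ts]
    simp only [add_mul, smul_mul_assoc, mul_assoc, hS.one, hS.orth', qS1, mul_one, mul_zero,
      smul_zero, add_zero, smul_smul]
    rw [mul_comm, hαα, one_smul]
  have KS2 : star T * T * S₂ = S₂ := by
    rw [mul_assoc, TS2, mul_smul_comm, Ts]
    simp only [add_mul, smul_mul_assoc, mul_assoc, hS.two, hS.orth, qS2, mul_one, mul_zero,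
      smul_zero, add_zero, zero_add, smul_smul]
    rw [mul_comm, hββ, one_smul]
  have hvT : hsSq b (v - T) ≤ 16 * ρ := by
    have e1 : v - T = (v * S₁ - α • S₁) * star S₁ + (v * S₂ - β • S₂) * star S₂ +
        (S₁ * ((star S₁ * v - α • star S₁) * q) + S₂ * ((star S₂ * v - β • star S₂) * q)) := by
      have e2 : v = v * S₁ * star S₁ + v * S₂ * star S₂ + v * q := by
        rw [hq]; simp only [mul_sub, mul_add, mul_one, mul_assoc]; abel
      have e3 : v * q = S₁ * (star S₁ * v * q) + S₂ * (star S₂ * v * q) + q * v * q := by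
        nth_rewrite 4 [hq]
        simp only [sub_mul, add_mul, one_mul, mul_assoc]; abel
      simp only [sub_mul, smul_mul_assoc, S1q, S2q, smul_zero, sub_zero]
      nth_rewrite 1 [e2]
      rw [e3, hT]
      abel
    rw [e1]
    refine (hsSq_add_le_of_le b
      (hsSq_add_le_of_le b ((hsSq_mul_le_of_norm_le_one' b n1s _).trans h1)
        ((hsSq_mul_le_of_norm_le_one' b n2s _).trans h2))
      (hsSq_add_le_of_le b ((hsSq_mul_le_of_norm_le_one b n1 _).trans
        ((hsSq_mul_le_of_norm_le_one' b nq _).trans h1'))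
        ((hsSq_mul_le_of_norm_le_one b n2 _).trans
        ((hsSq_mul_le_of_norm_le_one' b nq _).trans h2')))).trans_eq ?_
    ring
  have hsmall : ∀ c : ℝ≥0∞, c ≤ 160 → c * ρ ≤ ENNReal.ofReal ((1 / 2) ^ 2) := fun c hc => by
    have e1 : ENNReal.ofReal ((1 / 2) ^ 2) = 4⁻¹ := by
      rw [show ((1 : ℝ) / 2) ^ 2 = 4⁻¹ by norm_num, ENNReal.ofReal_inv_of_pos (by norm_num)]
      norm_num
    rw [e1, ENNReal.le_inv_iff_mul_le]
    refine le_trans ?_ hρ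
    calc c * ρ * 4 ≤ 160 * ρ * 4 := by gcongr
      _ = 640 * ρ := by ring
  have nvT : ‖v - T‖ ≤ 1 / 2 := norm_le_of_hsSq_le b (by norm_num)
    (hvT.trans (hsmall 16 (by norm_num)))
  have nT : ‖T‖ ≤ 2 := by
    have := norm_sub_le v (v - T)
    rw [sub_sub_cancel] at this
    linarith
  have hK : hsSq b (1 - star T * T) ≤ 160 * ρ := by
    have e1 : 1 - star T * T = star v * (v - T) + star (star T * (v - T)) := by
      rw [star_mul, star_star, star_sub, mul_sub, sub_mul, hvv]; abel
    rw [e1]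
    refine (hsSq_add_le_of_le b
      ((hsSq_mul_le_of_norm_le_one b (by rwa [norm_star]) _).trans hvT)
      ((hsSq_star b _).le.trans
        (hsSq_mul_le_of_norm_le b (c := 2) (by rw [norm_star]; exact nT) hvT))).trans_eq ?_
    push_cast
    ring
  have nK : ‖1 - star T * T‖ ≤ 1 / 2 := norm_le_of_hsSq_le b (by norm_num)
    (hK.trans (hsmall 160 le_rfl))
  obtain ⟨G, hGs, hGK, hG, hGp⟩ := exists_inv_sqrt (IsSelfAdjoint.star_mul_self T) nK
  obtain ⟨k, hk⟩ : ∃ k, k = 1 + G * (1 - star T * T) := ⟨_, rfl⟩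
  rw [← hk] at hGp
  have ks : star k = k := by
    rw [hk, star_add, star_one, star_mul, hGs, star_sub, star_one, star_mul, star_star]
    congr 1
    exact ((Commute.one_right G).sub_right hGK).eq.symm
  have kS1 : k * S₁ = S₁ := by
    rw [hk, add_mul, one_mul, mul_assoc, sub_mul, one_mul, KS1, sub_self, mul_zero, add_zero]
  have kS2 : k * S₂ = S₂ := by
    rw [hk, add_mul, one_mul, mul_assoc, sub_mul, one_mul, KS2, sub_self, mul_zero, add_zero]
  have hiso : star (T * k) * (T * k) = 1 := by
    rw [star_mul, ks, ← hGp]; simp only [mul_assoc]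
  have hTu : IsUnit T := by
    have e1 : T = v * (1 - star v * (v - T)) := by
      rw [mul_sub, mul_one, ← mul_assoc, Unitary.mul_star_self_of_mem hv, one_mul, sub_sub_cancel]
    rw [e1]
    refine (Unitary.isUnit_coe (U := ⟨v, hv⟩)).mul (isUnit_one_sub_of_norm_lt_one ?_)
    refine (norm_mul_le _ _).trans_lt ?_
    rw [norm_star]
    nlinarith [norm_nonneg (v - T)]
  have hku : IsUnit k :=
    ⟨⟨k, star T * T * k, by rw [← mul_assoc, hGp], by
      have e1 : Commute (star T * T) k := by
        rw [hk]
        exact (Commute.one_right _).add_right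
          (hGK.symm.mul_right ((Commute.one_right _).sub_right (Commute.refl _)))
      rw [e1.eq, hGp]⟩, rfl⟩
  refine ⟨T * k, ?_, by rw [mul_assoc, kS1, TS1], by rw [mul_assoc, kS2, TS2], ?_⟩
  · rw [Unitary.mem_iff]
    exact ⟨hiso, by
      obtain ⟨w, hw⟩ := hTu.mul hku
      rw [← hw] at hiso ⊢
      rw [left_inv_eq_right_inv hiso w.mul_inv, w.mul_inv]⟩
  · have e1 : v - T * k = (v - T) + (-(T * G)) * (1 - star T * T) := by
      rw [hk, mul_add, mul_one, neg_mul, mul_assoc]; abel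
    rw [e1]
    have nTG : ‖-(T * G)‖ ≤ (4 : ℕ) := by
      rw [norm_neg]
      refine (norm_mul_le _ _).trans ?_
      push_cast
      nlinarith [norm_nonneg T, norm_nonneg G]
    refine (hsSq_add_le_of_le b hvT (hsSq_mul_le_of_norm_le b nTG hK)).trans ?_
    calc 2 * (16 * ρ + ((4 : ℕ) : ℝ≥0∞) ^ 2 * (160 * ρ)) = 5152 * ρ := by push_cast; ring
      _ ≤ 6000 * ρ := by gcongr; norm_num

/-- Two essential approximate eigenvalues of a unitary become eigenvalues of infinite multiplicity
after an arbitrarily small Hilbert–Schmidt perturbation. -/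
lemma HilbertBasis.exists_unitary_near_of_isEssApproxEigenvalue (b : HilbertBasis ℕ ℂ E)
    {v : E →L[ℂ] E} (hv : v ∈ unitary (E →L[ℂ] E)) {α β : ℂ} (hα : ‖α‖ = 1) (hβ : ‖β‖ = 1)
    (hvα : IsEssApproxEigenvalue v α) (hvβ : IsEssApproxEigenvalue v β) {η : ℝ} (hη : 0 < η) :
    ∃ S₁ S₂ : E →L[ℂ] E, OrthIsom S₁ S₂ ∧ ∃ v₁ ∈ unitary (E →L[ℂ] E), v₁ * S₁ = α • S₁ ∧
      v₁ * S₂ = β • S₂ ∧ hsSq b (v - v₁) ≤ ENNReal.ofReal η := by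
  obtain ⟨ρ, hρ0, hρη, hρ1⟩ : ∃ ρ : ℝ, 0 < ρ ∧ 6000 * ρ ≤ η ∧ 640 * ρ ≤ 1 :=
    ⟨min (η / 6000) (1 / 640), by positivity, by
      have := min_le_left (η / 6000) (1 / 640); linarith, by
      have := min_le_right (η / 6000) (1 / 640); linarith⟩
  let c : ℕ → ℝ := fun k => √(ρ / 2 * (1 / 2) ^ k)
  have hc : ∀ k, 0 < c k := fun k => Real.sqrt_pos.2 (by positivity)
  obtain ⟨f, hf, hfr⟩ := exists_seq_of_forall_finset_exists
    (fun z : ℕ × E × E => ‖z.2.1‖ = 1 ∧ ‖z.2.2‖ = 1 ∧ ⟪z.2.1, z.2.2⟫_ℂ = 0 ∧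
      ‖v z.2.1 - α • z.2.1‖ ≤ c z.1 ∧ ‖v z.2.2 - β • z.2.2‖ ≤ c z.1)
    (fun z z' => z.1 < z'.1 ∧ (⟪z.2.1, z'.2.1⟫_ℂ = 0 ∧ ⟪z.2.1, z'.2.2⟫_ℂ = 0) ∧
      ⟪z.2.2, z'.2.1⟫_ℂ = 0 ∧ ⟪z.2.2, z'.2.2⟫_ℂ = 0) (by
    classical
    intro s _
    let k := s.sup Prod.fst + 1
    let t : Finset E := s.image (fun z => z.2.1) ∪ s.image (fun z => z.2.2)
    have hK : FiniteDimensional ℂ (Submodule.span ℂ (t : Set E)) := inferInstance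
    obtain ⟨x, hx, hx1, hxv⟩ := hvα _ hK (c k) (hc k)
    have hK' : FiniteDimensional ℂ (Submodule.span ℂ ((insert x t : Finset E) : Set E)) :=
      inferInstance
    obtain ⟨y, hy, hy1, hyv⟩ := hvβ _ hK' (c k) (hc k)
    have hx' : ∀ w ∈ t, ⟪w, x⟫_ℂ = 0 := fun w hw =>
      (Submodule.mem_orthogonal _ _).1 hx w (Submodule.subset_span hw)
    have hy' : ∀ w ∈ insert x t, ⟪w, y⟫_ℂ = 0 := fun w hw =>
      (Submodule.mem_orthogonal _ _).1 hy w (Submodule.subset_span hw)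
    refine ⟨(k, x, y), ⟨hx1, hy1, hy' x (Finset.mem_insert_self _ _), hxv, hyv⟩,
      fun z hz => ⟨Nat.lt_succ_of_le (Finset.le_sup (f := Prod.fst) hz), ?_⟩⟩
    have h1 : z.2.1 ∈ t := Finset.mem_union_left _ (Finset.mem_image_of_mem (fun z => z.2.1) hz)
    have h2 : z.2.2 ∈ t := Finset.mem_union_right _ (Finset.mem_image_of_mem (fun z => z.2.2) hz)
    exact ⟨⟨hx' _ h1, hy' _ (Finset.mem_insert_of_mem h1)⟩,
      hx' _ h2, hy' _ (Finset.mem_insert_of_mem h2)⟩)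
  have hmono : StrictMono fun n => (f n).1 := fun m n hmn => (hfr m n hmn).1
  have hle : ∀ n, n ≤ (f n).1 := fun n => hmono.le_apply
  have hsymm : ∀ {a b : E}, ⟪a, b⟫_ℂ = 0 → ⟪b, a⟫_ℂ = 0 := fun h => inner_eq_zero_symm.1 h
  have hx : Orthonormal ℂ fun n => (f n).2.1 := ⟨fun n => (hf n).1, fun m n hmn => by
    rcases hmn.lt_or_gt with h | h
    · exact (hfr m n h).2.1.1
    · exact hsymm (hfr n m h).2.1.1⟩
  have hy : Orthonormal ℂ fun n => (f n).2.2 := ⟨fun n => (hf n).2.1, fun m n hmn => by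
    rcases hmn.lt_or_gt with h | h
    · exact (hfr m n h).2.2.2
    · exact hsymm (hfr n m h).2.2.2⟩
  have hxy : ∀ m n, ⟪(f m).2.1, (f n).2.2⟫_ℂ = 0 := fun m n => by
    rcases lt_trichotomy m n with h | rfl | h
    · exact (hfr m n h).2.1.2
    · exact (hf m).2.2.1
    · exact hsymm (hfr n m h).2.2.1
  obtain ⟨V₁, hV₁⟩ := b.exists_linearIsometry hx
  obtain ⟨V₂, hV₂⟩ := b.exists_linearIsometry hy
  have hS : OrthIsom V₁.toContinuousLinearMap V₂.toContinuousLinearMap :=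
    ⟨isometry_of_inner V₁.inner_map_map, isometry_of_inner V₂.inner_map_map,
      b.clm_ext_inner fun m n => by
        rw [ContinuousLinearMap.star_eq_adjoint, mul_apply_eq_comp,
          ContinuousLinearMap.adjoint_inner_right]
        simpa [hV₁, hV₂] using hxy m n⟩
  have hsum : ∀ (γ : ℂ) (V : E →ₗᵢ[ℂ] E), (∀ n, ‖v (V (b n)) - γ • V (b n)‖ ≤ c (f n).1) →
      hsSq b (v * V.toContinuousLinearMap - γ • V.toContinuousLinearMap) ≤ ENNReal.ofReal ρ := by
    intro γ V h
    have h1 : HasSum (fun n : ℕ => ρ / 2 * (1 / 2) ^ n) ρ := by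
      have := hasSum_geometric_two.mul_left (ρ / 2)
      rwa [div_mul_cancel₀ _ (two_ne_zero)] at this
    rw [← h1.tsum_eq, ENNReal.ofReal_tsum_of_nonneg (fun n => by positivity) h1.summable, hsSq]
    refine ENNReal.tsum_le_tsum fun n => ?_
    have h2 : ‖v (V (b n)) - γ • V (b n)‖ ^ 2 ≤ ρ / 2 * (1 / 2) ^ n := by
      calc _ ≤ c (f n).1 ^ 2 := by gcongr; exact h n
        _ = ρ / 2 * (1 / 2) ^ (f n).1 := Real.sq_sqrt (by positivity)
        _ ≤ _ := by
          refine mul_le_mul_of_nonneg_left ?_ (by positivity)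
          exact pow_le_pow_of_le_one (by norm_num) (by norm_num) (hle n)
    calc _ = ‖v (V (b n)) - γ • V (b n)‖ₑ ^ 2 := rfl
      _ = ENNReal.ofReal (‖v (V (b n)) - γ • V (b n)‖ ^ 2) := by
        rw [ENNReal.ofReal_pow (norm_nonneg _), ofReal_norm]
      _ ≤ _ := ENNReal.ofReal_le_ofReal h2
  have hmul : ∀ k : ℕ, (k : ℝ≥0∞) * ENNReal.ofReal ρ = ENNReal.ofReal (k * ρ) := fun k => by
    rw [ENNReal.ofReal_mul k.cast_nonneg, ENNReal.ofReal_natCast]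
  obtain ⟨v₁, hv₁, h1, h2, h3⟩ := b.exists_unitary_near_of_almost_eigen hS hv hα hβ
    (hsum α V₁ fun n => by simpa only [hV₁] using (hf n).2.2.2.1)
    (hsum β V₂ fun n => by simpa only [hV₂] using (hf n).2.2.2.2) (by
      have := hmul 640
      push_cast at this
      rw [this]
      exact ENNReal.ofReal_le_one.2 hρ1)
  refine ⟨_, _, hS, v₁, hv₁, h1, h2, h3.trans ?_⟩
  have := hmul 6000
  push_cast at this
  rw [this]
  exact ENNReal.ofReal_le_ofReal hρη

end Perturbation

section Approximation

open scoped Pointwise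

variable {E : Type*} [NormedAddCommGroup E] [InnerProductSpace ℂ E] [CompleteSpace E]

lemma conjSet_subset_unitary {A : Type*} [Monoid A] [StarMul A] {v : A} (hv : v ∈ unitary A) :
    conjSet v ⊆ unitary A := by
  rintro x ⟨g, hg, rfl | rfl⟩
  · exact mul_mem (mul_mem hg hv) (Unitary.star_mem hg)
  · exact mul_mem (mul_mem hg (Unitary.star_mem hv)) (Unitary.star_mem hg)

lemma exists_mem_conjSet_near (b : HilbertBasis ℕ ℂ E) (v : E →L[ℂ] E) {v₁ y : E →L[ℂ] E}
    (hy : y ∈ conjSet v₁) : ∃ x ∈ conjSet v, hsSq b (x - y) ≤ hsSq b (v - v₁) := by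
  have key : ∀ g ∈ unitary (E →L[ℂ] E), ∀ w w₁ : E →L[ℂ] E,
      hsSq b (g * w * star g - g * w₁ * star g) ≤ hsSq b (w - w₁) := fun g hg w w₁ => by
    rw [← sub_mul, ← mul_sub]
    exact (hsSq_mul_le_of_norm_le_one' b
      (norm_le_one_of_mem_unitary (Unitary.star_mem hg)) _).trans
      (hsSq_mul_le_of_norm_le_one b (norm_le_one_of_mem_unitary hg) _)
  obtain ⟨g, hg, rfl | rfl⟩ := hy
  · exact ⟨_, ⟨g, hg, Or.inl rfl⟩, key g hg v v₁⟩
  · refine ⟨_, ⟨g, hg, Or.inr rfl⟩, (key g hg (star v) (star v₁)).trans_eq ?_⟩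
    rw [← star_sub, hsSq_star]

lemma exists_mem_conjSet_pow_near (b : HilbertBasis ℕ ℂ E) {v v₁ : E →L[ℂ] E}
    (hv : v ∈ unitary (E →L[ℂ] E)) (hv₁ : v₁ ∈ unitary (E →L[ℂ] E)) (n : ℕ) :
    ∀ y ∈ conjSet v₁ ^ n, y ∈ unitary (E →L[ℂ] E) ∧
      ∃ x ∈ conjSet v ^ n, hsSq b (x - y) ≤ 4 ^ n * hsSq b (v - v₁) := by
  induction n with
  | zero =>
    intro y hy
    rw [pow_zero, Set.mem_one] at hy
    exact ⟨hy ▸ one_mem _, 1, by simp, by simp [hy, hsSq]⟩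
  | succ n ih =>
    intro y hy
    rw [pow_succ] at hy
    obtain ⟨y, hy, z, hz, rfl⟩ := hy
    obtain ⟨hyu, x, hx, hxy⟩ := ih y hy
    obtain ⟨w, hw, hwz⟩ := exists_mem_conjSet_near b v hz
    refine ⟨mul_mem hyu (conjSet_subset_unitary hv₁ hz), x * w, ?_, ?_⟩
    · rw [pow_succ]; exact Set.mul_mem_mul hx hw
    · have e1 : x * w - y * z = (x - y) * w + y * (w - z) := by rw [sub_mul, mul_sub]; abel
      simp only [e1]
      refine (hsSq_add_le_of_le b ((hsSq_mul_le_of_norm_le_one' b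
        (norm_le_one_of_mem_unitary (conjSet_subset_unitary hv hw)) _).trans hxy)
        ((hsSq_mul_le_of_norm_le_one b (norm_le_one_of_mem_unitary hyu) _).trans hwz)).trans ?_
      have h1 : (1 : ℝ≥0∞) ≤ 4 ^ n := one_le_pow₀ (by norm_num)
      calc 2 * (4 ^ n * hsSq b (v - v₁) + hsSq b (v - v₁))
          ≤ 2 * (4 ^ n * hsSq b (v - v₁) + 4 ^ n * hsSq b (v - v₁)) := by
            gcongr
            exact le_mul_of_one_le_left zero_le h1
        _ = 4 ^ (n + 1) * hsSq b (v - v₁) := by ring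

lemma exists_norm_one_sub_smul_le_iInf (u : E →L[ℂ] E) :
    ∃ c : ℂ, ‖c‖ = 1 ∧ ‖1 - c • u‖ ≤ ⨅ c : {c : ℂ // ‖c‖ = 1}, ‖1 - (c : ℂ) • u‖ := by
  obtain ⟨c, hc, hmin⟩ := (isCompact_sphere (0 : ℂ) 1).exists_isMinOn ⟨1, by simp⟩
    (f := fun c : ℂ => ‖1 - c • u‖) (by fun_prop)
  have : Nonempty {c : ℂ // ‖c‖ = 1} := ⟨⟨1, by simp⟩⟩
  exact ⟨c, by simpa using hc, le_ciInf fun d => hmin (by simpa using d.2)⟩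

lemma hsSq_lt_of_le (b : HilbertBasis ℕ ℂ E) {S T : E →L[ℂ] E} {ε : ℝ} (hε : 0 < ε)
    (hS : hsSq b S ≤ ENNReal.ofReal (ε ^ 2 / 8)) (hT : hsSq b T ≤ ENNReal.ofReal (ε ^ 2 / 8)) :
    hsSq b (S + T) < ENNReal.ofReal (ε ^ 2) := by
  refine (hsSq_add_le_of_le b hS hT).trans_lt ?_
  rw [← ENNReal.ofReal_add (by positivity) (by positivity),
    ← ENNReal.ofReal_ofNat, ← ENNReal.ofReal_mul (by norm_num)]
  exact (ENNReal.ofReal_lt_ofReal_iff (by positivity)).2 (by nlinarith [pow_pos hε 2])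

/-- The main approximation theorem, for a Hilbert space with a countably infinite Hilbert basis. -/
theorem HilbertBasis.exists_conjSet_pow_near (b : HilbertBasis ℕ ℂ E) {m : ℕ} (hm : 1 ≤ m)
    {u v : E →L[ℂ] E} (hu : u ∈ unitary (E →L[ℂ] E)) (hv : v ∈ unitary (E →L[ℂ] E))
    (h : (⨅ c : {c : ℂ // ‖c‖ = 1}, ‖1 - (c : ℂ) • u‖) ≤ m * ⨅ c : {c : ℂ // ‖c‖ = 1},
      Metric.infDist (1 - (c : ℂ) • v) {k : E →L[ℂ] E | IsCompactOperator k})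
    {ε : ℝ} (hε : 0 < ε) :
    ∃ c : ℂ, ‖c‖ = 1 ∧ ∃ x ∈ conjSet v ^ (128 * m),
      hsSq b (u - c • x) < ENNReal.ofReal (ε ^ 2) := by
  obtain ⟨δ, hδ⟩ : ∃ δ, δ = ⨅ c : {c : ℂ // ‖c‖ = 1},
      Metric.infDist (1 - (c : ℂ) • v) {k : E →L[ℂ] E | IsCompactOperator k} := ⟨_, rfl⟩
  rw [← hδ] at h
  have hm0 : (1 : ℝ) ≤ m := by exact_mod_cast hm
  obtain ⟨c₀, hc₀, hle⟩ := exists_norm_one_sub_smul_le_iInf u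
  replace hle := hle.trans h
  have hcc : ∀ c : ℂ, ‖c‖ = 1 → starRingEnd ℂ c * c = 1 := fun c hc => by
    rw [← Complex.normSq_eq_conj_mul_self, Complex.normSq_eq_norm_sq, hc]; simp
  rcases le_or_gt δ 0 with hδ0 | hδ0
  · have h1 : 1 - c₀ • u = 0 := norm_le_zero_iff.1 (hle.trans (by nlinarith))
    refine ⟨starRingEnd ℂ c₀, by rw [RCLike.norm_conj, hc₀], 1, ?_, ?_⟩
    · rw [show 128 * m = 2 * (64 * m) by ring]
      exact one_mem_conjSet_pow hv _
    · have h2 : u - starRingEnd ℂ c₀ • (1 : E →L[ℂ] E) = 0 := by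
        rw [sub_eq_zero.1 h1, smul_smul, hcc c₀ hc₀, one_smul, sub_self]
      rw [h2]
      simpa [hsSq] using pow_pos hε 2
  obtain ⟨α, β, hα, hβ, hαβ, hvα, hvβ⟩ := b.exists_isEssApproxEigenvalue_pair hv
    (δ := 4 / 5 * δ) (by positivity) fun c hc => by
      have h1 : δ ≤ _ := hδ.le.trans (ciInf_le ⟨0, by
        rintro _ ⟨c, rfl⟩; exact Metric.infDist_nonneg⟩ (⟨c, hc⟩ : {c : ℂ // ‖c‖ = 1}))
      exact lt_of_lt_of_le (by linarith) h1
  obtain ⟨γ, hγ, huγ⟩ := b.exists_isEssApproxEigenvalue (isStarNormal_of_mem_unitary hu)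
  have hγ1 : ‖γ‖ = 1 := (unitary_spectrum_bound hu hγ).1
  have hmδ : 0 < m * δ := by positivity
  have hγ0 : ‖c₀ * γ - 1‖ ≤ 2 * (m * δ) := by
    obtain ⟨x, -, hx1, hx⟩ := huγ ⊥ inferInstance (m * δ) hmδ
    have e1 : (c₀ * γ - 1) • x = -(1 - c₀ • u) x - c₀ • (u x - γ • x) := by
      simp [smul_sub, sub_smul, smul_smul]
    have e2 : ‖c₀ * γ - 1‖ = ‖-(1 - c₀ • u) x - c₀ • (u x - γ • x)‖ := by
      rw [← e1, norm_smul, hx1, mul_one]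
    rw [e2]
    refine (norm_sub_le _ _).trans ?_
    rw [norm_smul, hc₀, one_mul, ← neg_apply, two_mul]
    refine add_le_add ?_ hx
    refine (ContinuousLinearMap.le_opNorm _ _).trans ?_
    rwa [hx1, mul_one, norm_neg]
  have huγ1 : ‖1 - starRingEnd ℂ γ • u‖ ≤ 3 * (m * δ) := by
    have e1 : ‖(c₀ * γ - 1) • (1 : E →L[ℂ] E) + (1 - c₀ • u)‖ = ‖1 - starRingEnd ℂ γ • u‖ := by
      have e2 : (c₀ * γ - 1) • (1 : E →L[ℂ] E) + (1 - c₀ • u) =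
          (c₀ * γ) • (1 - starRingEnd ℂ γ • u) := by
        rw [sub_smul, one_smul, smul_sub, smul_smul, mul_assoc, mul_comm γ, hcc γ hγ1, mul_one]
        abel
      rw [e2, norm_smul, norm_mul, hc₀, hγ1, one_mul, one_mul]
    rw [← e1]
    refine (norm_add_le _ _).trans ?_
    have h1 : ‖(c₀ * γ - 1) • (1 : E →L[ℂ] E)‖ ≤ ‖c₀ * γ - 1‖ := by
      rw [norm_smul]
      exact mul_le_of_le_one_right (norm_nonneg _) ContinuousLinearMap.norm_id_le
    linarith
  obtain ⟨R, _, hR, u₁, hu₁, hu₁R, -, huu₁⟩ := b.exists_unitary_near_of_isEssApproxEigenvalue hu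
    hγ1 hγ1 huγ huγ (η := min (ε ^ 2 / 8) ((m * δ) ^ 2)) (by positivity)
  have hnuu₁ : ‖u - u₁‖ ≤ m * δ := norm_le_of_hsSq_le b hmδ.le
    (huu₁.trans (ENNReal.ofReal_le_ofReal (min_le_right _ _)))
  obtain ⟨S₁, S₂, hS, v₁, hv₁, hv₁α, hv₁β, hvv₁⟩ :=
    b.exists_unitary_near_of_isEssApproxEigenvalue hv hα hβ hvα hvβ
      (η := ε ^ 2 / 8 / 4 ^ (128 * m)) (by positivity)
  have hU : starRingEnd ℂ γ • u₁ ∈ unitary (E →L[ℂ] E) := by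
    rw [Unitary.mem_iff, star_smul, smul_mul_smul_comm, smul_mul_smul_comm,
      Unitary.star_mul_self_of_mem hu₁, Unitary.mul_star_self_of_mem hu₁]
    have e1 : star (starRingEnd ℂ γ) = γ := star_star γ
    rw [e1, mul_comm, hcc γ hγ1, one_smul]
    exact ⟨rfl, rfl⟩
  have hUle : ‖1 - starRingEnd ℂ γ • u₁‖ ≤ 4 * (m * δ) := by
    have e1 : 1 - starRingEnd ℂ γ • u₁ =
        (1 - starRingEnd ℂ γ • u) + starRingEnd ℂ γ • (u - u₁) := by
      rw [smul_sub]; abel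
    rw [e1]
    refine (norm_add_le _ _).trans ?_
    rw [norm_smul, RCLike.norm_conj, hγ1, one_mul]
    linarith
  have hmem := b.mem_conjSet_pow_of_eigen (N := 16 * m) hS hU hv₁ hR.one
    (by rw [smul_mul_assoc, hu₁R, smul_smul, hcc γ hγ1, one_smul]) hα hβ hv₁α hv₁β
    ((pow_sub_pow_large hα hβ hαβ m).imp id fun h1 => hUle.trans (by linarith))
  rw [show 8 * (16 * m) = 128 * m by ring] at hmem
  obtain ⟨-, x, hx, hxU⟩ := exists_mem_conjSet_pow_near b hv hv₁ _ _ hmem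
  refine ⟨γ, hγ1, x, hx, ?_⟩
  have e1 : u - γ • x = (u - u₁) + γ • (starRingEnd ℂ γ • u₁ - x) := by
    rw [smul_sub, smul_smul, mul_comm γ, hcc γ hγ1, one_smul]; abel
  rw [e1]
  refine hsSq_lt_of_le b hε (huu₁.trans (ENNReal.ofReal_le_ofReal (min_le_left _ _))) ?_
  have e2 : ‖γ‖ₑ = 1 := by rw [← ofReal_norm, hγ1, ENNReal.ofReal_one]
  rw [hsSq_smul, e2, one_pow, one_mul, hsSq_sub_comm]
  refine hxU.trans ((mul_le_mul_right hvv₁ _).trans_eq ?_)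
  have e3 : (4 : ℝ≥0∞) ^ (128 * m) = ENNReal.ofReal (4 ^ (128 * m)) := by
    rw [ENNReal.ofReal_pow (by norm_num), ENNReal.ofReal_ofNat]
  rw [e3, ← ENNReal.ofReal_mul (by positivity), mul_div_cancel₀ _ (by positivity)]

lemma summable_and_tsum_lt_of_hsSq_lt (b : HilbertBasis ℕ ℂ E) {T : E →L[ℂ] E} {r : ℝ}
    (h : hsSq b T < ENNReal.ofReal r) :
    Summable (fun n => ‖T (b n)‖ ^ 2) ∧ ∑' n, ‖T (b n)‖ ^ 2 < r := by
  have h1 : hsSq b T = ∑' n, ENNReal.ofReal (‖T (b n)‖ ^ 2) :=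
    tsum_congr fun n => by rw [ENNReal.ofReal_pow (norm_nonneg _), ofReal_norm]
  rw [h1] at h
  have hs : Summable fun n => ‖T (b n)‖ ^ 2 :=
    (ENNReal.summable_toReal h.ne_top).congr fun n => ENNReal.toReal_ofReal (by positivity)
  refine ⟨hs, ?_⟩
  rw [← ENNReal.ofReal_tsum_of_nonneg (fun n => by positivity) hs] at h
  exact (ENNReal.ofReal_lt_ofReal_iff_of_nonneg (tsum_nonneg fun n => by positivity)).1 h

lemma exists_of_mem_conjSet_pow {A : Type*} [Monoid A] [StarMul A] {v x : A} {n : ℕ}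
    (hx : x ∈ conjSet v ^ n) : ∃ (g : Fin n → A) (s : Fin n → Bool), (∀ i, g i ∈ unitary A) ∧
      (List.ofFn fun i => g i * (if s i then v else star v) * star (g i)).prod = x := by
  obtain ⟨f, rfl⟩ := Set.mem_pow.1 hx
  have h : ∀ i, ∃ g ∈ unitary A, ∃ s : Bool, g * (if s then v else star v) * star g = f i := by
    intro i
    obtain ⟨g, hg, h | h⟩ := (f i).2
    · exact ⟨g, hg, true, by simp [h]⟩
    · exact ⟨g, hg, false, by simp [h]⟩
  choose g hg s hs using h
  exact ⟨g, s, hg, by simp only [hs]⟩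

end Approximation

end Auxiliary

theorem unitary_prod_conjugates_hilbertSchmidt_approx
    (m : ℕ) (hm : 1 ≤ m) (u v : H →L[ℂ] H)
    (hu : u ∈ unitary (H →L[ℂ] H)) (hv : v ∈ unitary (H →L[ℂ] H))
    (h : ell u ≤ (m : ℝ) * ellEss v) :
    ∀ ε : ℝ, 0 < ε →
      ∃ lam : ℂ, ‖lam‖ = 1 ∧
        ∃ (g : Fin (128 * m) → H →L[ℂ] H) (sgn : Fin (128 * m) → Bool),
          (∀ i, g i ∈ unitary (H →L[ℂ] H)) ∧
          Summable (fun n : ℕ =>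
            ‖(u - lam • (List.ofFn fun i =>
                g i * (if sgn i then v else star v) * star (g i)).prod) (e n)‖ ^ 2) ∧
          (∑' n : ℕ,
            ‖(u - lam • (List.ofFn fun i =>
                g i * (if sgn i then v else star v) * star (g i)).prod) (e n)‖ ^ 2) < ε ^ 2 := by
  intro ε hε
  let b : HilbertBasis ℕ ℂ H := HilbertBasis.ofRepr (LinearIsometryEquiv.refl ℂ H)
  have hb : ∀ n, b n = e n := fun n => by
    rw [← b.repr_symm_single]
    rfl
  obtain ⟨c, hc, x, hx, hlt⟩ := b.exists_conjSet_pow_near hm hu hv h hε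
  obtain ⟨g, s, hg, rfl⟩ := exists_of_mem_conjSet_pow hx
  have hT := summable_and_tsum_lt_of_hsSq_lt b hlt
  simp only [hb] at hT
  exact ⟨c, hc, g, s, hg, hT.1, hT.2⟩
end
end

section
/- Let G = SU(2), let φ, θ ∈ ℝ, and let u = [[e^{iφ}, 0], [0, e^{−iφ}]] and v = [[e^{iθ}, 0], [0, e^{−iθ}]] be elements of G that are both non-central (i.e., e^{iφ} ≠ ±1 and e^{iθ} ≠ ±1), with θ ∈ [−π/2, π/2]. If m ∈ ℕ is even and |φ| ≤ m·|θ|, then u is a product of m conjugates of v: there exist g₁, …, g_m ∈ SU(2) with u = ∏_{i=1}^{m} gᵢ v gᵢ⁻¹. -/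
/- Statement 5 (Nikolov–Segal lemma): if `u = diag(e^{iφ}, e^{-iφ})` and
`v = diag(e^{iθ}, e^{-iθ})` are non-central elements of `SU(2)` with `θ ∈ [-π/2, π/2]`,
`m` even and `|φ| ≤ m·|θ|`, then `u` is a product of `m` conjugates of `v`. -/

open Complex Matrix

noncomputable section

/-- The diagonal matrix `diag(e^{ix}, e^{-ix})`. -/
def diagPhase (x : ℝ) : Matrix (Fin 2) (Fin 2) ℂ :=
  !![Complex.exp (x * Complex.I), 0; 0, Complex.exp (-x * Complex.I)]

lemma diagPhase_zero : diagPhase 0 = 1 := by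
  ext i j
  fin_cases i <;> fin_cases j <;> simp [diagPhase]

lemma diagPhase_add (x y : ℝ) : diagPhase (x + y) = diagPhase x * diagPhase y := by
  ext i j
  fin_cases i <;> fin_cases j <;>
    simp [diagPhase, Matrix.mul_apply, Fin.sum_univ_two, ← Complex.exp_add] <;> ring_nf

/-- The element of `SU(2)` whose adjoint action rotates the diagonal axis by the angle `t`,
towards the direction of phase `β`. -/
def axisRotation (t β : ℝ) : Matrix (Fin 2) (Fin 2) ℂ :=
  !![(Real.cos (t / 2) : ℂ), -(Real.sin (t / 2) * Complex.exp (-β * Complex.I));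
    Real.sin (t / 2) * Complex.exp (β * Complex.I), (Real.cos (t / 2) : ℂ)]

lemma exp_mul_exp_neg_phase (β : ℝ) :
    Complex.exp (β * Complex.I) * Complex.exp (-β * Complex.I) = 1 := by
  rw [← Complex.exp_add]
  simp

lemma star_axisRotation (t β : ℝ) :
    star (axisRotation t β) =
      !![(Real.cos (t / 2) : ℂ), Real.sin (t / 2) * Complex.exp (-β * Complex.I);
        -(Real.sin (t / 2) * Complex.exp (β * Complex.I)), (Real.cos (t / 2) : ℂ)] := by
  ext i j
  fin_cases i <;> fin_cases j <;>
    simp [axisRotation, Matrix.star_apply, ← Complex.exp_conj, -Complex.ofReal_cos,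
      -Complex.ofReal_sin]

lemma axisRotation_mem (t β : ℝ) :
    axisRotation t β ∈ Matrix.specialUnitaryGroup (Fin 2) ℂ := by
  have hE := exp_mul_exp_neg_phase β
  have hcs : (Real.cos (t / 2) : ℂ) ^ 2 + (Real.sin (t / 2) : ℂ) ^ 2 = 1 := by
    exact_mod_cast Real.cos_sq_add_sin_sq (t / 2)
  rw [Matrix.mem_specialUnitaryGroup_iff, Matrix.mem_unitaryGroup_iff, star_axisRotation]
  constructor
  · ext i j
    fin_cases i <;> fin_cases j <;>
      simp [axisRotation, Matrix.mul_apply, Fin.sum_univ_two, -Complex.ofReal_cos,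
        -Complex.ofReal_sin] <;> grind
  · simp only [axisRotation, Matrix.det_fin_two_of]
    grind

lemma axisRotation_conj_diagPhase (t β θ : ℝ) :
    axisRotation t β * diagPhase θ * star (axisRotation t β) =
      !![Real.cos θ + Real.sin θ * Real.cos t * Complex.I,
          Real.sin θ * Real.sin t * Complex.exp (-β * Complex.I) * Complex.I;
        Real.sin θ * Real.sin t * Complex.exp (β * Complex.I) * Complex.I,
          Real.cos θ - Real.sin θ * Real.cos t * Complex.I] := by
  have hE := exp_mul_exp_neg_phase β
  have hcs : (Real.cos (t / 2) : ℂ) ^ 2 + (Real.sin (t / 2) : ℂ) ^ 2 = 1 := by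
    exact_mod_cast Real.cos_sq_add_sin_sq (t / 2)
  have hc : (Real.cos t : ℂ) = (Real.cos (t / 2) : ℂ) ^ 2 - (Real.sin (t / 2) : ℂ) ^ 2 := by
    have := Real.cos_two_mul' (t / 2)
    rw [mul_div_cancel₀ t two_ne_zero] at this
    exact_mod_cast this
  have hs : (Real.sin t : ℂ) = 2 * Real.sin (t / 2) * Real.cos (t / 2) := by
    have := Real.sin_two_mul (t / 2)
    rw [mul_div_cancel₀ t two_ne_zero] at this
    exact_mod_cast this
  have h1 : Complex.exp (θ * Complex.I) = Real.cos θ + Real.sin θ * Complex.I := by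
    simp [Complex.exp_mul_I]
  have h2 : Complex.exp (-θ * Complex.I) = Real.cos θ - Real.sin θ * Complex.I := by
    rw [Complex.exp_mul_I]
    simp [sub_eq_add_neg]
  rw [star_axisRotation, diagPhase, h1, h2, axisRotation, hc, hs]
  generalize Complex.exp (β * Complex.I) = E at *
  generalize Complex.exp (-β * Complex.I) = F at *
  generalize (Real.cos (t / 2) : ℂ) = p at *
  generalize (Real.sin (t / 2) : ℂ) = q at *
  generalize (Real.cos θ : ℂ) = a at *
  generalize (Real.sin θ : ℂ) = b at *
  ext i j
  fin_cases i <;> fin_cases j <;>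
    simp [Matrix.mul_apply, Fin.sum_univ_two]
  · linear_combination (a - b * I) * q ^ 2 * hE + a * hcs
  · ring
  · ring
  · linear_combination (a + b * I) * q ^ 2 * hE + a * hcs

lemma exists_conj_mul_conj_eq_diagPhase (s θ : ℝ) (hθ : |θ| ≤ Real.pi / 2) (hs : |s| ≤ |θ|) :
    ∃ g₁ ∈ Matrix.specialUnitaryGroup (Fin 2) ℂ, ∃ g₂ ∈ Matrix.specialUnitaryGroup (Fin 2) ℂ,
      g₁ * diagPhase θ * star g₁ * (g₂ * diagPhase θ * star g₂) = diagPhase (2 * s) := by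
  have hcos : Real.cos θ ≤ Real.cos s := by
    rw [← Real.cos_abs θ, ← Real.cos_abs s]
    exact Real.cos_le_cos_of_nonneg_of_le_pi (abs_nonneg s) (by linarith [Real.pi_pos]) hs
  have hcos0 : 0 ≤ Real.cos θ :=
    Real.cos_nonneg_of_mem_Icc ⟨by linarith [neg_abs_le θ], by linarith [le_abs_self θ]⟩
  obtain ⟨r, t, hr, ht⟩ : ∃ r t : ℝ, Real.cos θ = r * Real.cos s ∧
      Real.sin θ * Real.cos t = r * Real.sin s := by
    rcases (hcos0.trans hcos).eq_or_lt with h0 | h0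
    · exact ⟨0, Real.pi / 2, by linarith, by simp⟩
    set r := Real.cos θ / Real.cos s with hr_def
    have hr0 : 0 ≤ r := div_nonneg hcos0 h0.le
    have hr1 : r ≤ 1 := (div_le_one h0).2 hcos
    have hsin : |Real.sin s| ≤ |Real.sin θ| := by
      apply sq_le_sq.1
      nlinarith [Real.sin_sq_add_cos_sq s, Real.sin_sq_add_cos_sq θ]
    have hle : |r * Real.sin s| ≤ |Real.sin θ| := by
      rw [abs_mul, abs_of_nonneg hr0]
      nlinarith [abs_nonneg (Real.sin s)]
    refine ⟨r, Real.arccos (r * Real.sin s / Real.sin θ), (div_mul_cancel₀ _ h0.ne').symm, ?_⟩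
    have hq : |r * Real.sin s / Real.sin θ| ≤ 1 := by
      rw [abs_div]
      exact div_le_one_of_le₀ hle (abs_nonneg _)
    rw [Real.cos_arccos (abs_le.1 hq).1 (abs_le.1 hq).2]
    by_cases h : Real.sin θ = 0
    · rw [h, abs_zero] at hle
      rw [abs_nonpos_iff.1 hle, h, zero_mul]
    · exact mul_div_cancel₀ _ h
  refine ⟨_, axisRotation_mem t 0, _, axisRotation_mem t (2 * s + Real.pi), ?_⟩
  rw [axisRotation_conj_diagPhase, axisRotation_conj_diagPhase]
  have hS : (r : ℂ) ^ 2 + (Real.sin θ : ℂ) ^ 2 * (Real.sin t : ℂ) ^ 2 = 1 := by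
    have : r ^ 2 + Real.sin θ ^ 2 * Real.sin t ^ 2 = 1 := by
      linear_combination Real.sin_sq_add_cos_sq θ - r ^ 2 * Real.sin_sq_add_cos_sq s +
        Real.sin θ ^ 2 * Real.sin_sq_add_cos_sq t -
        (Real.sin θ * Real.cos t + r * Real.sin s) * ht - (Real.cos θ + r * Real.cos s) * hr
    exact_mod_cast this
  have hEF := exp_mul_exp_neg_phase s
  have h1 : Real.cos θ + Real.sin θ * Real.cos t * Complex.I =
      r * Complex.exp (s * Complex.I) := by
    rw [Complex.exp_mul_I, ← Complex.ofReal_mul, ht, hr]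
    push_cast
    ring
  have h2 : Real.cos θ - Real.sin θ * Real.cos t * Complex.I =
      r * Complex.exp (-s * Complex.I) := by
    rw [Complex.exp_mul_I, ← Complex.ofReal_mul, ht, hr, Complex.cos_neg, Complex.sin_neg]
    push_cast
    ring
  have h3 : Complex.exp ((2 * s + Real.pi : ℝ) * Complex.I) =
      -Complex.exp (s * Complex.I) ^ 2 := by
    push_cast
    rw [add_mul, Complex.exp_add, Complex.exp_pi_mul_I, ← Complex.exp_nat_mul]
    push_cast
    ring_nf
  have h4 : Complex.exp (-(2 * s + Real.pi : ℝ) * Complex.I) =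
      -Complex.exp (-s * Complex.I) ^ 2 := by
    push_cast
    rw [neg_mul, Complex.exp_neg, add_mul, Complex.exp_add, Complex.exp_pi_mul_I, neg_mul,
      Complex.exp_neg, inv_pow, ← Complex.exp_nat_mul]
    push_cast
    rw [mul_neg_one, inv_neg]
    ring_nf
  have h5 : diagPhase (2 * s) =
      !![Complex.exp (s * Complex.I) ^ 2, 0; 0, Complex.exp (-s * Complex.I) ^ 2] := by
    rw [two_mul, diagPhase_add]
    simp [diagPhase, sq]
  rw [h1, h2, h3, h4, h5]
  generalize Complex.exp (s * Complex.I) = E at *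
  generalize Complex.exp (-s * Complex.I) = F at *
  generalize (Real.sin θ : ℂ) = a at *
  generalize (Real.sin t : ℂ) = b at *
  ext i j
  fin_cases i <;> fin_cases j <;>
    simp [Matrix.mul_apply, Fin.sum_univ_two]
  · linear_combination E ^ 2 * hS - a ^ 2 * b ^ 2 * E ^ 2 * Complex.I_sq
  · linear_combination (-r * a * b * F * I) * hEF
  · linear_combination (-r * a * b * E * I) * hEF
  · linear_combination F ^ 2 * hS - a ^ 2 * b ^ 2 * F ^ 2 * Complex.I_sq

lemma exists_prod_conj_eq_diagPhase (s θ : ℝ) (hθ : |θ| ≤ Real.pi / 2) (hs : |s| ≤ |θ|)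
    (k : ℕ) :
    ∃ g : Fin (2 * k) → Matrix (Fin 2) (Fin 2) ℂ,
      (∀ i, g i ∈ Matrix.specialUnitaryGroup (Fin 2) ℂ) ∧
      diagPhase (k * (2 * s)) =
        (List.ofFn fun i => g i * diagPhase θ * star (g i)).prod := by
  induction k with
  | zero => exact ⟨fun _ => 1, fun _ => one_mem _, by simp [diagPhase_zero]⟩
  | succ k ih =>
    obtain ⟨g, hg, hprod⟩ := ih
    obtain ⟨g₁, hg₁, g₂, hg₂, h⟩ := exists_conj_mul_conj_eq_diagPhase s θ hθ hs
    refine ⟨(Fin.cons g₁ (Fin.cons g₂ g : Fin (2 * k + 1) → Matrix (Fin 2) (Fin 2) ℂ) :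
      Fin (2 * k + 1 + 1) → Matrix (Fin 2) (Fin 2) ℂ), ?_, ?_⟩
    · exact Fin.cases hg₁ (Fin.cases hg₂ hg)
    · have hk : ((k + 1 : ℕ) : ℝ) * (2 * s) = 2 * s + k * (2 * s) := by
        push_cast
        ring
      rw [hk, diagPhase_add, ← h, hprod]
      change _ = (List.ofFn (n := 2 * k + 1 + 1) _).prod
      simp only [List.ofFn_succ, List.prod_cons, Fin.cons_zero, Fin.cons_succ]
      exact mul_assoc _ _ _

theorem su2_prod_conjugates (φ θ : ℝ) (m : ℕ) (hm : Even m)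
    (u v : Matrix.specialUnitaryGroup (Fin 2) ℂ)
    (hu : (u : Matrix (Fin 2) (Fin 2) ℂ) =
      !![Complex.exp (φ * Complex.I), 0; 0, Complex.exp (-φ * Complex.I)])
    (hv : (v : Matrix (Fin 2) (Fin 2) ℂ) =
      !![Complex.exp (θ * Complex.I), 0; 0, Complex.exp (-θ * Complex.I)])
    (hu_noncentral : Complex.exp (φ * Complex.I) ≠ 1 ∧ Complex.exp (φ * Complex.I) ≠ -1)
    (hv_noncentral : Complex.exp (θ * Complex.I) ≠ 1 ∧ Complex.exp (θ * Complex.I) ≠ -1)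
    (hθ : θ ∈ Set.Icc (-(Real.pi / 2)) (Real.pi / 2))
    (h : |φ| ≤ (m : ℝ) * |θ|) :
    ∃ g : Fin m → Matrix (Fin 2) (Fin 2) ℂ,
      (∀ i, g i ∈ Matrix.specialUnitaryGroup (Fin 2) ℂ) ∧
      (u : Matrix (Fin 2) (Fin 2) ℂ) =
        (List.ofFn fun i => g i * (v : Matrix (Fin 2) (Fin 2) ℂ) * star (g i)).prod := by
  have hθ' : |θ| ≤ Real.pi / 2 := abs_le.2 hθ
  obtain ⟨k, rfl⟩ := hm.exists_two_nsmul
  rw [smul_eq_mul] at *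
  have hsk : |φ / (2 * k)| ≤ |θ| := by
    rw [abs_div, abs_of_nonneg (by positivity : (0 : ℝ) ≤ 2 * k)]
    refine div_le_of_le_mul₀ (by positivity) (abs_nonneg θ) ?_
    push_cast at h
    linarith
  obtain ⟨g, hg, hprod⟩ := exists_prod_conj_eq_diagPhase (φ / (2 * k)) θ hθ' hsk k
  refine ⟨g, hg, ?_⟩
  have hφ : (k : ℝ) * (2 * (φ / (2 * k))) = φ := by
    rcases Nat.eq_zero_or_pos k with rfl | hk
    · have : φ = 0 := by simpa using h
      simp [this]
    · field_simp
  rw [hφ] at hprod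
  rw [hv]
  exact hu.trans hprod
end
end

section
/- Let (α_n)_{n∈ℕ} be a sequence of real numbers such that the sets {n : α_n > 0} and {n : α_n < 0} are both infinite, the series of the positive terms diverges (∑_{n : α_n > 0} α_n = +∞), and the series of the negative terms diverges (∑_{n : α_n < 0} α_n = −∞). Then there exists a bijection σ : ℕ → ℕ such that for every n ∈ ℕ, |∑_{i=0}^{n} α_{σ(i)}| ≤ sup_{j∈ℕ} |α_j| (where the supremum is taken in [0, ∞]). -/
/- Statement 7: a real sequence with infinitely many positive and negative terms, whose positive
part sums to `+∞` and whose negative part sums to `-∞`, can be rearranged so that all partial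
sums are bounded in absolute value by `sup_j |α_j|` (computed in `[0, ∞]`). -/


open scoped ENNReal

open Filter in
/-- Under any enumeration `e` of a set on which `f` is nonnegative, the partial sums of `f` tend to
infinity as soon as the finite sums of `f` over that set are unbounded. -/
theorem tendsto_sum_range_atTop_of_unbounded {ι : Type*} {s : Set ι} {f : ι → ℝ} (e : ℕ ≃ s)
    (hf : ∀ i ∈ s, 0 ≤ f i)
    (hdiv : ∀ C : ℝ, ∃ F : Finset ι, (∀ i ∈ F, i ∈ s) ∧ C < ∑ i ∈ F, f i) :
    Tendsto (fun n => ∑ k ∈ Finset.range n, f (e k)) atTop atTop := by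
  classical
  refine tendsto_atTop_atTop_of_monotone ?_ fun C => ?_
  · refine monotone_nat_of_le_succ fun n => ?_
    rw [Finset.sum_range_succ]
    exact le_add_of_nonneg_right (hf _ (e n).2)
  · obtain ⟨F, hFs, hF⟩ := hdiv C
    obtain ⟨N, hN⟩ := (F.attach.image fun i : F => e.symm ⟨i, hFs i i.2⟩).exists_nat_subset_range
    refine ⟨N, hF.le.trans ?_⟩
    rw [← Finset.sum_image (f := f) (g := fun k => (e k : ι))
      (fun _ _ _ _ h => e.injective (Subtype.ext h))]
    refine Finset.sum_le_sum_of_subset_of_nonneg (fun i hi => ?_) fun i hi _ => ?_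
    · refine Finset.mem_image.2 ⟨e.symm ⟨i, hFs i hi⟩, hN ?_, by simp⟩
      exact Finset.mem_image.2 ⟨⟨i, hi⟩, Finset.mem_attach _ _, rfl⟩
    · obtain ⟨k, -, rfl⟩ := Finset.mem_image.1 hi
      exact hf _ (e k).2

/-- The numbers of terms of `a` and of `b` used after `n` steps of the greedy interleaving, which
takes the next term of `a` if the current sum is nonpositive and the next term of `b` otherwise. -/
noncomputable def greedyCount (a b : ℕ → ℝ) : ℕ → ℕ × ℕ
  | 0 => (0, 0)
  | n + 1 =>
    let p := greedyCount a b n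
    if ∑ k ∈ Finset.range p.1, a k + ∑ k ∈ Finset.range p.2, b k ≤ 0 then (p.1 + 1, p.2)
    else (p.1, p.2 + 1)

/-- The sum of the terms used after `n` steps of the greedy interleaving. -/
noncomputable def greedySum (a b : ℕ → ℝ) (n : ℕ) : ℝ :=
  ∑ k ∈ Finset.range (greedyCount a b n).1, a k + ∑ k ∈ Finset.range (greedyCount a b n).2, b k

/-- The position of the term taken at step `n` of the greedy interleaving. -/
noncomputable def greedyPick (a b : ℕ → ℝ) (n : ℕ) : ℕ ⊕ ℕ :=
  if greedySum a b n ≤ 0 then .inl (greedyCount a b n).1 else .inr (greedyCount a b n).2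

section Greedy

variable {a b : ℕ → ℝ}

theorem greedyCount_succ_of_nonpos {n : ℕ} (h : greedySum a b n ≤ 0) :
    greedyCount a b (n + 1) = ((greedyCount a b n).1 + 1, (greedyCount a b n).2) :=
  if_pos h

theorem greedyCount_succ_of_pos {n : ℕ} (h : 0 < greedySum a b n) :
    greedyCount a b (n + 1) = ((greedyCount a b n).1, (greedyCount a b n).2 + 1) :=
  if_neg h.not_ge

theorem greedyPick_of_nonpos {n : ℕ} (h : greedySum a b n ≤ 0) :
    greedyPick a b n = .inl (greedyCount a b n).1 :=
  if_pos h

theorem greedyPick_of_pos {n : ℕ} (h : 0 < greedySum a b n) :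
    greedyPick a b n = .inr (greedyCount a b n).2 :=
  if_neg h.not_ge

theorem greedySum_zero : greedySum a b 0 = 0 := by
  simp [greedySum, greedyCount]

theorem greedySum_succ (n : ℕ) :
    greedySum a b (n + 1) = greedySum a b n + Sum.elim a b (greedyPick a b n) := by
  rcases le_or_gt (greedySum a b n) 0 with h | h
  · rw [greedyPick_of_nonpos h, greedySum, greedyCount_succ_of_nonpos h, greedySum,
      Finset.sum_range_succ, Sum.elim_inl]
    ring
  · rw [greedyPick_of_pos h, greedySum, greedyCount_succ_of_pos h, greedySum,
      Finset.sum_range_succ, Sum.elim_inr]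
    ring

theorem sum_range_greedyPick (n : ℕ) :
    ∑ k ∈ Finset.range n, Sum.elim a b (greedyPick a b k) = greedySum a b n := by
  induction n with
  | zero => simp [greedySum_zero]
  | succ n ih => rw [Finset.sum_range_succ, ih, greedySum_succ]

theorem abs_greedySum_succ_le (ha : ∀ k, 0 ≤ a k) (hb : ∀ k, b k ≤ 0) (n : ℕ) :
    |greedySum a b (n + 1)| ≤ max |greedySum a b n| |Sum.elim a b (greedyPick a b n)| := by
  rw [greedySum_succ]
  rcases le_or_gt (greedySum a b n) 0 with h | h
  · have := ha (greedyCount a b n).1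
    rw [greedyPick_of_nonpos h, Sum.elim_inl, abs_of_nonpos h, abs_of_nonneg this, abs_le']
    exact ⟨le_max_of_le_right (by linarith), le_max_of_le_left (by linarith)⟩
  · have := hb (greedyCount a b n).2
    rw [greedyPick_of_pos h, Sum.elim_inr, abs_of_pos h, abs_of_nonpos this, abs_le']
    exact ⟨le_max_of_le_left (by linarith), le_max_of_le_right (by linarith)⟩

theorem greedyCount_mono : Monotone (greedyCount a b) := by
  refine monotone_nat_of_le_succ fun n => ?_
  rcases le_or_gt (greedySum a b n) 0 with h | h
  · rw [greedyCount_succ_of_nonpos h]; exact ⟨Nat.le_succ _, le_rfl⟩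
  · rw [greedyCount_succ_of_pos h]; exact ⟨le_rfl, Nat.le_succ _⟩

theorem greedyCount_fst_add_snd (n : ℕ) : (greedyCount a b n).1 + (greedyCount a b n).2 = n := by
  induction n with
  | zero => rfl
  | succ n ih =>
    rcases le_or_gt (greedySum a b n) 0 with h | h
    · rw [greedyCount_succ_of_nonpos h]; dsimp only; omega
    · rw [greedyCount_succ_of_pos h]; dsimp only; omega

theorem greedyPick_injective : Function.Injective (greedyPick a b) := by
  refine Function.Injective.of_lt_imp_ne fun m n hmn heq => ?_
  have hle : greedyCount a b (m + 1) ≤ greedyCount a b n := greedyCount_mono hmn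
  rcases le_or_gt (greedySum a b m) 0 with hm | hm <;>
    rcases le_or_gt (greedySum a b n) 0 with hn | hn
  · rw [greedyPick_of_nonpos hm, greedyPick_of_nonpos hn, Sum.inl.injEq] at heq
    rw [greedyCount_succ_of_nonpos hm] at hle
    have := hle.1
    dsimp only at this
    omega
  · simp [greedyPick_of_nonpos hm, greedyPick_of_pos hn] at heq
  · simp [greedyPick_of_pos hm, greedyPick_of_nonpos hn] at heq
  · rw [greedyPick_of_pos hm, greedyPick_of_pos hn, Sum.inr.injEq] at heq
    rw [greedyCount_succ_of_pos hm] at hle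
    have := hle.2
    dsimp only at this
    omega

open Filter

theorem exists_greedyCount_fst_eq
    (hb : Tendsto (fun n => ∑ k ∈ Finset.range n, b k) atTop atBot) (k : ℕ) :
    ∃ n, greedySum a b n ≤ 0 ∧ (greedyCount a b n).1 = k := by
  induction k using Nat.strong_induction_on with
  | _ k ih =>
  by_contra! hk
  obtain ⟨m, hm⟩ : ∃ m, (greedyCount a b m).1 = k := by
    cases k with
    | zero => exact ⟨0, rfl⟩
    | succ k =>
      obtain ⟨m, hm, hmk⟩ := ih k k.lt_succ_self
      exact ⟨m + 1, by rw [greedyCount_succ_of_nonpos hm, hmk]⟩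
  have hconst : ∀ n, m ≤ n → (greedyCount a b n).1 = k := by
    intro n hn
    induction n, hn using Nat.le_induction with
    | base => exact hm
    | succ n _ ih' =>
      rw [greedyCount_succ_of_pos (not_le.1 fun h => hk n h ih'), ih']
  obtain ⟨N, hN⟩ := eventually_atTop.1
    (hb.eventually_le_atBot (-∑ i ∈ Finset.range k, a i))
  have h1 := hconst (m + N + k) (by omega)
  have h2 := greedyCount_fst_add_snd (a := a) (b := b) (m + N + k)
  refine hk (m + N + k) ?_ h1
  have h3 := hN (greedyCount a b (m + N + k)).2 (by omega)
  rw [greedySum, h1]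
  linarith

theorem exists_greedyCount_snd_eq
    (ha : Tendsto (fun n => ∑ k ∈ Finset.range n, a k) atTop atTop) (k : ℕ) :
    ∃ n, 0 < greedySum a b n ∧ (greedyCount a b n).2 = k := by
  induction k using Nat.strong_induction_on with
  | _ k ih =>
  by_contra! hk
  obtain ⟨m, hm⟩ : ∃ m, (greedyCount a b m).2 = k := by
    cases k with
    | zero => exact ⟨0, rfl⟩
    | succ k =>
      obtain ⟨m, hm, hmk⟩ := ih k k.lt_succ_self
      exact ⟨m + 1, by rw [greedyCount_succ_of_pos hm, hmk]⟩
  have hconst : ∀ n, m ≤ n → (greedyCount a b n).2 = k := by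
    intro n hn
    induction n, hn using Nat.le_induction with
    | base => exact hm
    | succ n _ ih' =>
      rw [greedyCount_succ_of_nonpos (not_lt.1 fun h => hk n h ih'), ih']
  obtain ⟨N, hN⟩ := eventually_atTop.1
    (ha.eventually_gt_atTop (-∑ i ∈ Finset.range k, b i))
  have h1 := hconst (m + N + k) (by omega)
  have h2 := greedyCount_fst_add_snd (a := a) (b := b) (m + N + k)
  refine hk (m + N + k) ?_ h1
  have h3 := hN (greedyCount a b (m + N + k)).1 (by omega)
  rw [greedySum, h1]
  linarith

theorem greedyPick_bijective
    (ha : Tendsto (fun n => ∑ k ∈ Finset.range n, a k) atTop atTop)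
    (hb : Tendsto (fun n => ∑ k ∈ Finset.range n, b k) atTop atBot) :
    Function.Bijective (greedyPick a b) := by
  refine ⟨greedyPick_injective, ?_⟩
  rintro (k | k)
  · obtain ⟨n, hn, rfl⟩ := exists_greedyCount_fst_eq (a := a) hb k
    exact ⟨n, greedyPick_of_nonpos hn⟩
  · obtain ⟨n, hn, rfl⟩ := exists_greedyCount_snd_eq (b := b) ha k
    exact ⟨n, greedyPick_of_pos hn⟩

end Greedy

theorem exists_rearrangement_partial_sums_le_sup
    (α : ℕ → ℝ)
    (hpos_inf : {n : ℕ | 0 < α n}.Infinite)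
    (hneg_inf : {n : ℕ | α n < 0}.Infinite)
    (hpos_div : ∀ C : ℝ, ∃ F : Finset ℕ, (∀ n ∈ F, 0 < α n) ∧ C < ∑ n ∈ F, α n)
    (hneg_div : ∀ C : ℝ, ∃ F : Finset ℕ, (∀ n ∈ F, α n < 0) ∧ (∑ n ∈ F, α n) < C) :
    ∃ σ : ℕ → ℕ, Function.Bijective σ ∧
      ∀ n : ℕ, ENNReal.ofReal |∑ k ∈ Finset.range (n + 1), α (σ k)| ≤
        ⨆ j : ℕ, ENNReal.ofReal |α j| := by
  classical
  let s : Set ℕ := {n | α n < 0}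
  have : Infinite s := hneg_inf.to_subtype
  have : Infinite (sᶜ : Set ℕ) :=
    (hpos_inf.mono fun n (hn : 0 < α n) => (not_lt.2 hn.le : ¬ α n < 0)).to_subtype
  obtain ⟨e⟩ : Nonempty (ℕ ≃ (sᶜ : Set ℕ)) := nonempty_equiv_of_countable
  obtain ⟨f⟩ : Nonempty (ℕ ≃ s) := nonempty_equiv_of_countable
  let a : ℕ → ℝ := fun k => α (e k)
  let b : ℕ → ℝ := fun k => α (f k)
  have ha_nonneg (k : ℕ) : 0 ≤ a k := not_lt.1 (e k).2
  have hb_nonpos (k : ℕ) : b k ≤ 0 := (f k).2.le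
  have ha : Filter.Tendsto (fun n => ∑ k ∈ Finset.range n, a k) .atTop .atTop := by
    refine tendsto_sum_range_atTop_of_unbounded e (fun i hi => not_lt.1 hi) fun C => ?_
    obtain ⟨F, hF, hC⟩ := hpos_div C
    exact ⟨F, fun i hi => not_lt.2 (hF i hi).le, hC⟩
  have hb : Filter.Tendsto (fun n => ∑ k ∈ Finset.range n, b k) .atTop .atBot := by
    rw [← Filter.tendsto_neg_atTop_iff]
    simp only [← Finset.sum_neg_distrib]
    refine tendsto_sum_range_atTop_of_unbounded (f := fun i => -α i) f
      (fun i hi => neg_nonneg.2 (le_of_lt hi)) fun C => ?_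
    obtain ⟨F, hF, hC⟩ := hneg_div (-C)
    exact ⟨F, hF, by rw [Finset.sum_neg_distrib]; linarith⟩
  let g : ℕ ⊕ ℕ ≃ ℕ :=
    (Equiv.sumComm ℕ ℕ).trans ((Equiv.sumCongr f e).trans (Equiv.Set.sumCompl s))
  have hg (x : ℕ ⊕ ℕ) : α (g x) = Sum.elim a b x := by
    rcases x with k | k <;> simp [g, a, b]
  refine ⟨g ∘ greedyPick a b, g.bijective.comp (greedyPick_bijective ha hb), fun n => ?_⟩
  simp only [Function.comp_apply, hg, sum_range_greedyPick]
  induction n + 1 with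
  | zero => simp [greedySum_zero]
  | succ n ih =>
    refine (ENNReal.ofReal_le_ofReal (abs_greedySum_succ_le ha_nonneg hb_nonpos n)).trans ?_
    rw [ENNReal.ofReal_max]
    refine max_le ih ?_
    rw [← hg]
    exact le_iSup (fun j => ENNReal.ofReal |α j|) _
end
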